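/- There exists a real constant c such that for every A > 0 there is a constant C = C(A) with |V(x,x) − x² log x + c x²| ≤ C x² (log x)^{−A} for all real x ≥ 2. -/

import Mathlib

open Finset

/-- `ψ(x;q,a) = Σ_{n ≤ x, n ≡ a (mod q)} Λ(n)`. -/
noncomputable def psi (x : ℝ) (q a : ℕ) : ℝ :=
  ∑ n ∈ (Finset.Icc 1 ⌊x⌋₊).filter (fun n => n % q = a % q),
    ArithmeticFunction.vonMangoldt n

/-- `V(x,Q) = Σ_{q ≤ Q} Σ_{1 ≤ a ≤ q, gcd(a,q)=1} |ψ(x;q,a) − x/φ(q)|²`. -/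
noncomputable def V (x Q : ℝ) : ℝ :=
  ∑ q ∈ Finset.Icc 1 ⌊Q⌋₊,
    ∑ a ∈ (Finset.Icc 1 q).filter (fun a => Nat.gcd a q = 1),
      (psi x q a - x / (Nat.totient q : ℝ)) ^ 2

section DirichletSeriesContinuation

open MeasureTheory Complex

/-- The deviation of the partial sums of `g` beyond `M` from linear growth, cut off to `t > M`. -/
noncomputable def tailDeviation (g : ℕ → ℂ) (κ : ℂ) (M : ℕ) : ℝ → ℂ :=
  (Set.Ioi (M : ℝ)).indicator
    (fun t => ∑ k ∈ Icc 1 ⌊t⌋₊, g k - ∑ k ∈ Icc 1 M, g k - κ * (t - M))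

variable {g : ℕ → ℂ} {κ : ℂ} {D : ℝ}

lemma measurable_tailDeviation (M : ℕ) : Measurable (tailDeviation g κ M) := by
  refine Measurable.indicator ?_ measurableSet_Ioi
  refine Measurable.sub (Measurable.sub ?_ measurable_const) (by fun_prop)
  exact (measurable_from_top (f := fun n : ℕ => ∑ k ∈ Icc 1 n, g k)).comp Nat.measurable_floor

lemma norm_tailDeviation_le (hκ : ‖κ‖ ≤ 1)
    (hR : ∀ n : ℕ, ‖∑ k ∈ Icc 1 n, g k - κ * n‖ ≤ D) (M : ℕ) (t : ℝ) :
    ‖tailDeviation g κ M t‖ ≤ 2 * D + 1 := by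
  have hD : 0 ≤ D := (norm_nonneg _).trans (hR 0)
  unfold tailDeviation
  rw [Set.indicator_apply]
  split_ifs with h
  · have ht : 0 ≤ t := (Nat.cast_nonneg M).trans (Set.mem_Ioi.mp h).le
    have e : ∑ k ∈ Icc 1 ⌊t⌋₊, g k - ∑ k ∈ Icc 1 M, g k - κ * (t - M)
        = (∑ k ∈ Icc 1 ⌊t⌋₊, g k - κ * ⌊t⌋₊) - (∑ k ∈ Icc 1 M, g k - κ * M)
          - κ * (((t - ⌊t⌋₊ : ℝ)) : ℂ) := by push_cast; ring
    rw [e]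
    have h1 := hR ⌊t⌋₊
    have h2 := hR M
    have h3 : ‖κ * (((t - ⌊t⌋₊ : ℝ)) : ℂ)‖ ≤ 1 := by
      rw [norm_mul, Complex.norm_real, Real.norm_eq_abs, abs_of_nonneg]
      · have := Nat.lt_floor_add_one t
        have h5 : t - ⌊t⌋₊ ≤ 1 := by linarith
        have h6 : 0 ≤ t - ⌊t⌋₊ := by linarith [Nat.floor_le ht]
        nlinarith [norm_nonneg κ]
      · linarith [Nat.floor_le ht]
    calc _ ≤ D + D + 1 := (norm_sub_le _ _).trans
          (add_le_add ((norm_sub_le _ _).trans (add_le_add h1 h2)) h3)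
      _ = _ := by ring
  · simp; linarith

lemma locallyIntegrableOn_tailDeviation (hκ : ‖κ‖ ≤ 1)
    (hR : ∀ n : ℕ, ‖∑ k ∈ Icc 1 n, g k - κ * n‖ ≤ D) (M : ℕ) :
    LocallyIntegrableOn (tailDeviation g κ M) (Set.Ioi 0) := by
  refine LocallyIntegrable.locallyIntegrableOn ?_ _
  refine (locallyIntegrable_const (2 * D + 1)).mono
    (measurable_tailDeviation M).aestronglyMeasurable ?_
  refine Filter.Eventually.of_forall fun t => ?_
  exact (norm_tailDeviation_le hκ hR M t).trans (Real.le_norm_self _)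

lemma tailDeviation_isBigO_top (hκ : ‖κ‖ ≤ 1)
    (hR : ∀ n : ℕ, ‖∑ k ∈ Icc 1 n, g k - κ * n‖ ≤ D) (M : ℕ) :
    tailDeviation g κ M =O[Filter.atTop] (fun t : ℝ => t ^ (-(0 : ℝ))) := by
  refine Asymptotics.IsBigO.of_bound (2 * D + 1) (Filter.Eventually.of_forall fun t => ?_)
  simpa using norm_tailDeviation_le hκ hR M t

lemma tailDeviation_isBigO_zero {M : ℕ} (hM : 1 ≤ M) (b : ℝ) :
    tailDeviation g κ M =O[nhdsWithin 0 (Set.Ioi 0)] (fun t : ℝ => t ^ (-b)) := by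
  have : tailDeviation g κ M =ᶠ[nhdsWithin 0 (Set.Ioi 0)] (fun _ => 0) := by
    filter_upwards [Ioo_mem_nhdsGT (show (0 : ℝ) < 1 by norm_num)] with t ht
    unfold tailDeviation
    rw [Set.indicator_of_notMem]
    have : (1 : ℝ) ≤ M := by exact_mod_cast hM
    simp only [Set.mem_Ioi, not_lt]
    linarith [ht.2]
  exact this.trans_isBigO (Asymptotics.isBigO_zero _ _)

lemma mellinConvergent_tailDeviation (hκ : ‖κ‖ ≤ 1)
    (hR : ∀ n : ℕ, ‖∑ k ∈ Icc 1 n, g k - κ * n‖ ≤ D) {M : ℕ} (hM : 1 ≤ M) {s : ℂ}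
    (hs : 0 < s.re) : MellinConvergent (tailDeviation g κ M) (-s) :=
  mellinConvergent_of_isBigO_rpow (locallyIntegrableOn_tailDeviation hκ hR M)
    (tailDeviation_isBigO_top hκ hR M) (by simpa using hs)
    (tailDeviation_isBigO_zero hM ((-s).re - 1)) (by linarith)

lemma differentiableAt_mellin_tailDeviation (hκ : ‖κ‖ ≤ 1)
    (hR : ∀ n : ℕ, ‖∑ k ∈ Icc 1 n, g k - κ * n‖ ≤ D) {M : ℕ} (hM : 1 ≤ M) {s : ℂ}
    (hs : 0 < s.re) : DifferentiableAt ℂ (mellin (tailDeviation g κ M)) (-s) :=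
  mellin_differentiableAt_of_isBigO_rpow (locallyIntegrableOn_tailDeviation hκ hR M)
    (tailDeviation_isBigO_top hκ hR M) (by simpa using hs)
    (tailDeviation_isBigO_zero hM ((-s).re - 1)) (by linarith)

lemma norm_mellin_tailDeviation_le (hκ : ‖κ‖ ≤ 1)
    (hR : ∀ n : ℕ, ‖∑ k ∈ Icc 1 n, g k - κ * n‖ ≤ D) {M : ℕ} (hM : 1 ≤ M) {s : ℂ}
    (hs : 0 < s.re) :
    ‖mellin (tailDeviation g κ M) (-s)‖ ≤ (2 * D + 1) * (M : ℝ) ^ (-s.re) / s.re := by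
  have hM0 : (0 : ℝ) < M := by exact_mod_cast hM
  have hI : IntegrableOn (fun t : ℝ => (2 * D + 1) * t ^ (-s.re - 1)) (Set.Ioi (M : ℝ)) :=
    (integrableOn_Ioi_rpow_of_lt (by linarith) hM0).const_mul _
  have e : mellin (tailDeviation g κ M) (-s)
      = ∫ t in Set.Ioi (M : ℝ), (t : ℂ) ^ (-s - 1) • tailDeviation g κ M t := by
    unfold mellin
    apply setIntegral_eq_of_subset_of_forall_sdiff_eq_zero measurableSet_Ioi
      (Set.Ioi_subset_Ioi hM0.le)
    intro t ht
    have : tailDeviation g κ M t = 0 := Set.indicator_of_notMem ht.2 _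
    simp [this]
  rw [e]
  refine (norm_integral_le_of_norm_le hI ?_).trans ?_
  · refine (ae_restrict_iff' measurableSet_Ioi).mpr (Filter.Eventually.of_forall fun t ht => ?_)
    have ht0 : 0 < t := hM0.trans ht
    rw [norm_smul, Complex.norm_cpow_eq_rpow_re_of_pos ht0, mul_comm]
    have : (-s - 1).re = -s.re - 1 := by simp
    rw [this]
    exact mul_le_mul_of_nonneg_right (norm_tailDeviation_le hκ hR M t) (by positivity)
  · rw [integral_const_mul, integral_Ioi_rpow_of_lt (by linarith) hM0]
    have : -s.re - 1 + 1 = -s.re := by ring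
    rw [this]
    apply le_of_eq
    field_simp

lemma LSeries_eq_sum_add_mellin (hg : ∀ n, ‖g n‖ ≤ 1) (hκ : ‖κ‖ ≤ 1)
    (hR : ∀ n : ℕ, ‖∑ k ∈ Icc 1 n, g k - κ * n‖ ≤ D) {M : ℕ} (hM : 1 ≤ M) {s : ℂ}
    (hs : 1 < s.re) :
    LSeries g s = ∑ n ∈ Icc 1 M, g n * (n : ℂ) ^ (-s) + κ * (M : ℂ) ^ (1 - s) / (s - 1)
      + s * mellin (tailDeviation g κ M) (-s) := by
  have hM0 : (0 : ℝ) < M := by exact_mod_cast hM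
  have hMc : (M : ℂ) ≠ 0 := by exact_mod_cast hM0.ne'
  have hs0 : s ≠ 0 := fun h => by simp [h] at hs; linarith
  have hs1 : s - 1 ≠ 0 := fun h => by
    have : s = 1 := sub_eq_zero.mp h
    simp [this] at hs
  have hsum : LSeriesSummable g s := LSeriesSummable_of_bounded_of_one_lt_re (fun n _ => hg n) hs
  set f : ℕ → ℂ := fun n => if n ≤ M then 0 else g n with hf
  have hfb : ∀ n, ‖f n‖ ≤ 1 := fun n => by
    simp only [hf]; split_ifs
    · simp
    · exact hg n
  have h1 : LSeries g s = ∑ n ∈ Icc 1 M, g n * (n : ℂ) ^ (-s) + LSeries f s := by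
    have hfs : LSeriesSummable f s := LSeriesSummable_of_bounded_of_one_lt_re (fun n _ => hfb n) hs
    unfold LSeries
    have e : ∑ n ∈ Icc 1 M, g n * (n : ℂ) ^ (-s)
        = ∑' n, (LSeries.term g s n - LSeries.term f s n) := by
      rw [tsum_eq_sum (s := Icc 1 M)]
      · refine sum_congr rfl fun n hn => ?_
        rw [mem_Icc] at hn
        have : n ≠ 0 := by omega
        rw [LSeries.term_of_ne_zero this, LSeries.term_of_ne_zero this]
        simp only [hf, if_pos hn.2, zero_div, sub_zero]
        rw [cpow_neg, div_eq_mul_inv]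
      · intro n hn
        rw [mem_Icc] at hn
        rcases Nat.eq_zero_or_pos n with rfl | hn0
        · simp
        · have : ¬ n ≤ M := fun h => hn ⟨hn0, h⟩
          rw [LSeries.term_of_ne_zero hn0.ne', LSeries.term_of_ne_zero hn0.ne']
          simp [hf, this]
    rw [e, Summable.tsum_sub hsum hfs]; ring
  have hfG : ∀ n : ℕ, ∑ k ∈ Icc 1 n, f k =
      if n ≤ M then 0 else ∑ k ∈ Icc 1 n, g k - ∑ k ∈ Icc 1 M, g k := by
    intro n
    split_ifs with h
    · refine sum_eq_zero fun k hk => ?_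
      rw [mem_Icc] at hk
      simp [hf, hk.2.trans h]
    · push Not at h
      have hsub : Icc 1 M ⊆ Icc 1 n := Icc_subset_Icc_right h.le
      rw [← sum_sdiff hsub (f := f), ← sum_sdiff hsub (f := g), add_sub_cancel_right]
      have z : ∑ x ∈ Icc 1 M, f x = 0 := sum_eq_zero fun k hk => by
        rw [mem_Icc] at hk
        simp [hf, hk.2]
      rw [z, add_zero]
      refine sum_congr rfl fun k hk => ?_
      simp only [mem_sdiff, mem_Icc, not_and, not_le] at hk
      simp [hf, hk.2 hk.1.1]
  have h2 : LSeries f s = s * ∫ t in Set.Ioi (1 : ℝ), (∑ k ∈ Icc 1 ⌊t⌋₊, f k) * t ^ (-(s + 1)) := by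
    refine LSeries_eq_mul_integral' f zero_le_one hs ?_
    refine Asymptotics.IsBigO.of_bound 1 (Filter.Eventually.of_forall fun n => ?_)
    rw [Real.norm_of_nonneg (sum_nonneg fun _ _ => norm_nonneg _), Real.rpow_one, one_mul,
      Real.norm_of_nonneg (Nat.cast_nonneg n)]
    calc ∑ k ∈ Icc 1 n, ‖f k‖ ≤ ∑ k ∈ Icc 1 n, (1 : ℝ) := sum_le_sum fun k _ => hfb k
      _ = n := by simp
  have hI1 : IntegrableOn (fun t : ℝ => (t : ℂ) ^ (-s - 1) • tailDeviation g κ M t) (Set.Ioi 0) :=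
    mellinConvergent_tailDeviation hκ hR hM (by linarith)
  have hIa : IntegrableOn (fun t : ℝ => (t : ℂ) ^ (-s)) (Set.Ioi (M : ℝ)) :=
    integrableOn_Ioi_cpow_of_lt (by simpa using hs) hM0
  have hIb : IntegrableOn (fun t : ℝ => (t : ℂ) ^ (-s - 1)) (Set.Ioi (M : ℝ)) :=
    integrableOn_Ioi_cpow_of_lt (by simp; linarith) hM0
  have h3 : ∫ t in Set.Ioi (1 : ℝ), (∑ k ∈ Icc 1 ⌊t⌋₊, f k) * (t : ℂ) ^ (-(s + 1))
      = ∫ t in Set.Ioi (M : ℝ), ((t : ℂ) ^ (-s - 1) • tailDeviation g κ M t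
        + (κ * (t : ℂ) ^ (-s) - κ * M * (t : ℂ) ^ (-s - 1))) := by
    have hsub : Set.Ioi (M : ℝ) ⊆ Set.Ioi 1 := Set.Ioi_subset_Ioi (by exact_mod_cast hM)
    rw [setIntegral_eq_of_subset_of_forall_sdiff_eq_zero measurableSet_Ioi hsub]
    · refine setIntegral_congr_fun measurableSet_Ioi fun t ht => ?_
      have ht' : (M : ℝ) < t := ht
      have ht0 : 0 < t := hM0.trans ht
      have htc : (t : ℂ) ≠ 0 := by exact_mod_cast ht0.ne'
      have e0 : ∑ k ∈ Icc 1 ⌊t⌋₊, f k = ∑ k ∈ Icc 1 ⌊t⌋₊, g k - ∑ k ∈ Icc 1 M, g k := by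
        rw [hfG]
        split_ifs with h
        · have : ⌊t⌋₊ = M := le_antisymm h (Nat.le_floor ht'.le)
          rw [this, sub_self]
        · rfl
      simp only [e0, tailDeviation, Set.indicator_of_mem ht, smul_eq_mul]
      have e1 : (t : ℂ) ^ (-s) = t * (t : ℂ) ^ (-s - 1) := by
        rw [cpow_sub _ _ htc, cpow_one]; field_simp
      have e2 : -(s + 1) = -s - 1 := by ring
      rw [e1, e2]; ring
    · intro t ht
      have : ⌊t⌋₊ ≤ M := by
        have h := ht.2
        simp only [Set.mem_Ioi, not_lt] at h
        exact Nat.floor_le_of_le h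
      rw [hfG, if_pos this, zero_mul]
  have h4 : mellin (tailDeviation g κ M) (-s)
      = ∫ t in Set.Ioi (M : ℝ), (t : ℂ) ^ (-s - 1) • tailDeviation g κ M t := by
    unfold mellin
    apply setIntegral_eq_of_subset_of_forall_sdiff_eq_zero measurableSet_Ioi
      (Set.Ioi_subset_Ioi hM0.le)
    intro t ht
    have : tailDeviation g κ M t = 0 := Set.indicator_of_notMem ht.2 _
    simp [this]
  have hIab : IntegrableOn (fun t : ℝ => κ * (t : ℂ) ^ (-s) - κ * M * (t : ℂ) ^ (-s - 1))
      (Set.Ioi (M : ℝ)) := (hIa.const_mul κ).sub (hIb.const_mul (κ * M))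
  rw [h1, h2, h3, integral_add (hI1.mono_set (Set.Ioi_subset_Ioi hM0.le)) hIab, ← h4,
    integral_sub (hIa.const_mul κ) (hIb.const_mul (κ * M)), integral_const_mul,
    integral_const_mul, integral_Ioi_cpow_of_lt (by simpa using hs) hM0,
    integral_Ioi_cpow_of_lt (by simp; linarith) hM0]
  have e3 : -s - 1 + 1 = -s := by ring
  have e4 : -s + 1 = 1 - s := by ring
  have e5 : (M : ℂ) ^ (1 - s) = M * (M : ℂ) ^ (-s) := by
    rw [sub_eq_add_neg, cpow_add _ _ hMc, cpow_one]
  have hs2 : (1 - s) ≠ 0 := fun h => hs1 (by linear_combination -h)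
  simp only [e3, e4, ofReal_natCast, e5]
  field_simp
  ring

end DirichletSeriesContinuation

section PeriodicSums

lemma sum_range_natCast_zmod (q : ℕ) [NeZero q] (g : ZMod q → ℂ) :
    ∑ k ∈ range q, g (k : ZMod q) = ∑ a, g a := by
  refine sum_bij (fun k _ => (k : ZMod q)) (fun _ _ => mem_univ _) ?_ ?_ (fun _ _ => rfl)
  · intro a ha b hb hab
    rw [mem_range] at ha hb
    have := congrArg ZMod.val hab
    rwa [ZMod.val_cast_of_lt ha, ZMod.val_cast_of_lt hb] at this
  · intro b _
    exact ⟨b.val, mem_range.mpr (ZMod.val_lt b), ZMod.natCast_zmod_val b⟩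

lemma sum_Icc_add_period (q : ℕ) [NeZero q] (g : ZMod q → ℂ) (n : ℕ) :
    ∑ k ∈ Icc 1 (n + q), g (k : ZMod q) = ∑ k ∈ Icc 1 n, g (k : ZMod q) + ∑ a, g a := by
  have h : ∀ m : ℕ, ∑ k ∈ Icc 1 m, g (k : ZMod q) = ∑ k ∈ range m, g ((k + 1 : ℕ) : ZMod q) := by
    intro m
    induction m with
    | zero => simp
    | succ m ih => rw [sum_Icc_succ_top (by omega), sum_range_succ, ih]
  rw [h, h, sum_range_add]
  congr 1
  rw [← Equiv.sum_comp (Equiv.addRight ((n + 1 : ℕ) : ZMod q)) g, ← sum_range_natCast_zmod]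
  refine sum_congr rfl fun k _ => ?_
  simp only [Equiv.coe_addRight]
  congr 1
  push_cast; ring

lemma norm_sum_Icc_sub_le (q : ℕ) [NeZero q] (g : ZMod q → ℂ) (hg : ∀ a, ‖g a‖ ≤ 1) (n : ℕ) :
    ‖∑ k ∈ Icc 1 n, g (k : ZMod q) - (∑ a, g a) / q * n‖ ≤ 2 * q := by
  have hq : (q : ℂ) ≠ 0 := by exact_mod_cast NeZero.ne q
  have hqpos : 0 < q := Nat.pos_of_ne_zero (NeZero.ne q)
  induction n using Nat.strong_induction_on with
  | _ n ih =>
    rcases lt_or_ge n q with h | h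
    · have h1 : ‖∑ k ∈ Icc 1 n, g (k : ZMod q)‖ ≤ n := by
        refine (norm_sum_le _ _).trans ((sum_le_sum fun k _ => hg _).trans ?_)
        simp
      have h2 : ‖∑ a, g a‖ ≤ q := by
        refine (norm_sum_le _ _).trans ((sum_le_sum fun k _ => hg _).trans ?_)
        simp [ZMod.card]
      have h3 : ‖(∑ a, g a) / q * n‖ ≤ n := by
        rw [norm_mul, norm_div, Complex.norm_natCast, Complex.norm_natCast]
        have : ‖∑ a, g a‖ / q ≤ 1 := by
          rw [div_le_one (by exact_mod_cast hqpos)]; exact h2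
        nlinarith [(Nat.cast_nonneg n : (0:ℝ) ≤ n)]
      have h4 : (n : ℝ) ≤ q := by exact_mod_cast h.le
      linarith [norm_sub_le (∑ k ∈ Icc 1 n, g (k : ZMod q)) ((∑ a, g a) / q * n)]
    · obtain ⟨m, rfl⟩ := Nat.exists_eq_add_of_le h
      have := ih m (by omega)
      rw [add_comm q m, sum_Icc_add_period]
      convert this using 2
      push_cast
      field_simp
      ring

lemma sum_Icc_rpow_sub_one_le {η : ℝ} (h0 : 0 < η) (h1 : η ≤ 1) (M : ℕ) :
    ∑ n ∈ Icc 1 M, (n : ℝ) ^ (η - 1) ≤ (M : ℝ) ^ η / η := by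
  induction M with
  | zero => simp [Real.zero_rpow h0.ne']
  | succ m ih =>
    rw [sum_Icc_succ_top (by omega)]
    refine (add_le_add_left ih _).trans ?_
    have hm : (0 : ℝ) < (m + 1 : ℕ) := by positivity
    have e : (m : ℝ) = (m + 1 : ℕ) * (1 + -(1 / ((m + 1 : ℕ) : ℝ))) := by
      field_simp; push_cast; ring
    have hle : 1 / ((m + 1 : ℕ) : ℝ) ≤ 1 := by
      rw [div_le_one hm]; push_cast; linarith [(Nat.cast_nonneg m : (0:ℝ) ≤ m)]
    have hb := rpow_one_add_le_one_add_mul_self (s := -(1 / ((m + 1 : ℕ) : ℝ))) (by linarith)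
      h0.le h1
    have : (m : ℝ) ^ η ≤ ((m + 1 : ℕ) : ℝ) ^ η * (1 + η * -(1 / ((m + 1 : ℕ) : ℝ))) := by
      conv_lhs => rw [e]
      rw [Real.mul_rpow hm.le (by linarith)]
      gcongr
    have e2 : ((m + 1 : ℕ) : ℝ) ^ (η - 1) = ((m + 1 : ℕ) : ℝ) ^ η / ((m + 1 : ℕ) : ℝ) :=
      Real.rpow_sub_one hm.ne' η
    rw [e2, ← sub_nonneg]
    have : 0 ≤ (((m + 1 : ℕ) : ℝ) ^ η * (1 + η * -(1 / ((m + 1 : ℕ) : ℝ))) - (m : ℝ) ^ η) / η :=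
      div_nonneg (by linarith) h0.le
    refine this.trans (le_of_eq ?_)
    field_simp
    ring

end PeriodicSums

section DirichletLFunctionBounds

open Complex

variable {g : ℕ → ℂ} {κ : ℂ}

lemma norm_sum_add_mellin_le (hg : ∀ n, ‖g n‖ ≤ 1) (hκ : ‖κ‖ ≤ 1) {q : ℕ} (hq : 1 ≤ q)
    (hR : ∀ n : ℕ, ‖∑ k ∈ Icc 1 n, g k - κ * n‖ ≤ 2 * q) {η : ℝ} (h0 : 0 < η) (h1 : η ≤ 1 / 2)
    {s : ℂ} (hs : 1 - η ≤ s.re) {M : ℕ} (hM : M = ⌈q * (1 + ‖s‖)⌉₊) :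
    ‖∑ n ∈ Icc 1 M, g n * (n : ℂ) ^ (-s) + s * mellin (tailDeviation g κ M) (-s)‖
      ≤ (2 / η + 20) * (q * (1 + ‖s‖)) ^ η := by
  set X : ℝ := q * (1 + ‖s‖) with hX
  have hq' : (1 : ℝ) ≤ q := by exact_mod_cast hq
  have hX1 : 1 ≤ X := by nlinarith [norm_nonneg s]
  have hXM : X ≤ M := by rw [hM]; exact Nat.le_ceil _
  have hMX : (M : ℝ) ≤ 2 * X := by
    rw [hM]; linarith [Nat.ceil_lt_add_one (show (0:ℝ) ≤ X by linarith)]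
  have hM1 : (1 : ℝ) ≤ M := hX1.trans hXM
  have hM1' : 1 ≤ M := by exact_mod_cast hM1
  have hM0 : (0 : ℝ) < M := by linarith
  have hσ : 1 / 2 ≤ s.re := by linarith
  have hMη : (M : ℝ) ^ η ≤ 2 * X ^ η := by
    calc (M : ℝ) ^ η ≤ (2 * X) ^ η := by gcongr
      _ = 2 ^ η * X ^ η := Real.mul_rpow (by norm_num) (by linarith)
      _ ≤ 2 ^ (1 : ℝ) * X ^ η := by
        gcongr
        · norm_num
        · linarith
      _ = _ := by rw [Real.rpow_one]
  have b1 : ‖∑ n ∈ Icc 1 M, g n * (n : ℂ) ^ (-s)‖ ≤ (M : ℝ) ^ η / η := by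
    refine (norm_sum_le _ _).trans (le_trans (sum_le_sum fun n hn => ?_)
      (sum_Icc_rpow_sub_one_le h0 (by linarith) M))
    rw [mem_Icc] at hn
    have hn1 : (1 : ℝ) ≤ n := by exact_mod_cast hn.1
    rw [norm_mul, Complex.norm_natCast_cpow_of_pos (by omega)]
    calc ‖g n‖ * (n : ℝ) ^ (-s).re ≤ 1 * (n : ℝ) ^ (η - 1) := by
          refine mul_le_mul (hg n) (Real.rpow_le_rpow_of_exponent_le hn1 ?_) (by positivity)
            zero_le_one
          simp; linarith
      _ = _ := one_mul _
  have b2 : ‖s * mellin (tailDeviation g κ M) (-s)‖ ≤ 10 * (M : ℝ) ^ η := by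
    rw [norm_mul]
    have := norm_mellin_tailDeviation_le hκ hR hM1' (s := s) (by linarith)
    have hp : (M : ℝ) ^ (-s.re) ≤ (M : ℝ) ^ (η - 1) :=
      Real.rpow_le_rpow_of_exponent_le hM1 (by linarith)
    have e2 : (M : ℝ) ^ (η - 1) = (M : ℝ) ^ η / M := Real.rpow_sub_one hM0.ne' η
    calc ‖s‖ * ‖mellin (tailDeviation g κ M) (-s)‖
        ≤ ‖s‖ * ((2 * (2 * q) + 1) * (M : ℝ) ^ (-s.re) / s.re) := by gcongr
      _ ≤ ‖s‖ * ((5 * q) * (M : ℝ) ^ (η - 1) / (1 / 2)) := by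
        gcongr
        linarith
      _ = 10 * (q * ‖s‖) * (M : ℝ) ^ (η - 1) := by ring
      _ ≤ 10 * M * (M : ℝ) ^ (η - 1) := by
        gcongr
        rw [hX] at hXM
        linarith
      _ = _ := by rw [e2]; field_simp
  calc _ ≤ (M : ℝ) ^ η / η + 10 * (M : ℝ) ^ η := (norm_add_le _ _).trans (add_le_add b1 b2)
    _ = (1 / η + 10) * (M : ℝ) ^ η := by ring
    _ ≤ (1 / η + 10) * (2 * X ^ η) := by gcongr
    _ = _ := by ring

lemma analyticOnNhd_sum_add_mellin (hκ : ‖κ‖ ≤ 1) {D : ℝ}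
    (hR : ∀ n : ℕ, ‖∑ k ∈ Icc 1 n, g k - κ * n‖ ≤ D) {M : ℕ} (hM : 1 ≤ M) :
    DifferentiableOn ℂ (fun s : ℂ => ∑ n ∈ Icc 1 M, g n * (n : ℂ) ^ (-s)
      + s * mellin (tailDeviation g κ M) (-s)) {s | 0 < s.re} := by
  intro s hs
  refine DifferentiableAt.differentiableWithinAt (DifferentiableAt.add ?_ ?_)
  · refine DifferentiableAt.fun_sum fun n hn => ?_
    rw [mem_Icc] at hn
    refine DifferentiableAt.const_mul ?_ _
    refine DifferentiableAt.const_cpow (by fun_prop) (Or.inl ?_)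
    exact_mod_cast (by omega : n ≠ 0)
  · refine DifferentiableAt.mul differentiableAt_id ?_
    exact (differentiableAt_mellin_tailDeviation hκ hR hM hs).comp s
      (differentiableAt_id.neg)

lemma eqOn_re_pos {f h : ℂ → ℂ} (hf : DifferentiableOn ℂ f {s | 0 < s.re})
    (hh : DifferentiableOn ℂ h {s | 0 < s.re}) (e : ∀ s : ℂ, 1 < s.re → f s = h s) :
    Set.EqOn f h {s | 0 < s.re} := by
  have ho : IsOpen {s : ℂ | 0 < s.re} := isOpen_lt continuous_const continuous_re
  have ho1 : IsOpen {s : ℂ | 1 < s.re} := isOpen_lt continuous_const continuous_re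
  refine (hf.analyticOnNhd ho).eqOn_of_preconnected_of_eventuallyEq (hh.analyticOnNhd ho)
    (convex_halfSpace_re_gt 0).isPreconnected (z₀ := 2) (by simp) ?_
  filter_upwards [ho1.mem_nhds (show (2 : ℂ) ∈ {s : ℂ | 1 < s.re} by simp)] with s hs
  exact e s hs

variable {q : ℕ} [NeZero q]

lemma norm_sum_dirichletCharacter_le {χ : DirichletCharacter ℂ q} (hχ : χ ≠ 1) (n : ℕ) :
    ‖∑ k ∈ Icc 1 n, χ (k : ZMod q) - 0 * n‖ ≤ 2 * q := by
  have := norm_sum_Icc_sub_le q (fun a => χ a) (fun a => χ.norm_le_one a) n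
  rwa [MulChar.sum_eq_zero_of_ne_one hχ, zero_div] at this

/-- Convexity-type bound for Dirichlet `L`-functions near the line `re s = 1`. -/
theorem norm_LFunction_le {χ : DirichletCharacter ℂ q} (hχ : χ ≠ 1) {η : ℝ} (h0 : 0 < η)
    (h1 : η ≤ 1 / 2) {s : ℂ} (hs : 1 - η ≤ s.re) :
    ‖χ.LFunction s‖ ≤ (2 / η + 20) * (q * (1 + ‖s‖)) ^ η := by
  have hq : 1 ≤ q := Nat.pos_of_ne_zero (NeZero.ne q)
  have hg : ∀ n : ℕ, ‖χ (n : ZMod q)‖ ≤ 1 := fun n => χ.norm_le_one _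
  have hM1 : 1 ≤ ⌈q * (1 + ‖s‖)⌉₊ := Nat.one_le_ceil_iff.mpr (by positivity)
  have hR := norm_sum_dirichletCharacter_le hχ
  have := eqOn_re_pos (DirichletCharacter.differentiable_LFunction hχ).differentiableOn
    (analyticOnNhd_sum_add_mellin (by simp) hR hM1) (fun s hs => by
      rw [χ.LFunction_eq_LSeries hs, LSeries_eq_sum_add_mellin hg (by simp) hR hM1 hs]
      simp) (show 0 < s.re by linarith)
  rw [this]
  exact norm_sum_add_mellin_le hg (by simp) hq hR h0 h1 hs rfl

lemma norm_cpow_div_sub_one_le {M : ℕ} (hM : 1 ≤ M) {s : ℂ} {η : ℝ} (hs : 1 - η ≤ s.re) :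
    ‖κ * (M : ℂ) ^ (1 - s) / (s - 1)‖ ≤ ‖κ‖ * (M : ℝ) ^ η / ‖s - 1‖ := by
  rw [norm_div, norm_mul, Complex.norm_natCast_cpow_of_pos hM]
  gcongr
  · exact_mod_cast hM
  · simp; linarith

/-- The principal `L`-function to the right of `re s = 1`. -/
theorem norm_LFunction_one_le {s : ℂ} (hs : 1 < s.re) {η : ℝ} (h0 : 0 < η) (h1 : η ≤ 1 / 2) :
    ‖(1 : DirichletCharacter ℂ q).LFunction s‖
      ≤ (2 / η + 20) * (q * (1 + ‖s‖)) ^ η + 1 / ‖s - 1‖ := by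
  set χ : DirichletCharacter ℂ q := 1
  have hq : 1 ≤ q := Nat.pos_of_ne_zero (NeZero.ne q)
  have hq0 : (0 : ℝ) < q := by exact_mod_cast hq
  have hg : ∀ n : ℕ, ‖χ (n : ZMod q)‖ ≤ 1 := fun n => χ.norm_le_one _
  have hM1 : 1 ≤ ⌈q * (1 + ‖s‖)⌉₊ := Nat.one_le_ceil_iff.mpr (by positivity)
  have hR := norm_sum_Icc_sub_le q (fun a => χ a) (fun a => χ.norm_le_one a)
  have hκ : ‖(∑ a, χ a) / (q : ℂ)‖ ≤ 1 := by
    rw [norm_div, Complex.norm_natCast, div_le_one hq0]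
    refine (norm_sum_le _ _).trans ((sum_le_sum fun k _ => χ.norm_le_one _).trans ?_)
    simp [ZMod.card]
  rw [χ.LFunction_eq_LSeries hs, LSeries_eq_sum_add_mellin hg hκ hR hM1 hs, add_right_comm]
  refine (norm_add_le _ _).trans (add_le_add
    (norm_sum_add_mellin_le hg hκ hq hR h0 h1 (by linarith) rfl) ?_)
  refine (norm_cpow_div_sub_one_le hM1 (η := 0) (by linarith)).trans ?_
  rw [Real.rpow_zero, mul_one]
  gcongr

/-- Truncated expansion of the Riemann zeta function in the half-plane `re s > 0`. -/
theorem riemannZeta_eq_sum_add_mellin {M : ℕ} (hM1 : 1 ≤ M) {s : ℂ} (hs : 0 < s.re)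
    (hs1 : s ≠ 1) :
    riemannZeta s = ∑ n ∈ Icc 1 M, (1 : ℕ → ℂ) n * (n : ℂ) ^ (-s)
      + s * mellin (tailDeviation 1 1 M) (-s) + 1 * (M : ℂ) ^ (1 - s) / (s - 1) := by
  have hg : ∀ n : ℕ, ‖(1 : ℕ → ℂ) n‖ ≤ 1 := fun n => by simp
  have hR : ∀ n : ℕ, ‖∑ k ∈ Icc 1 n, (1 : ℕ → ℂ) k - 1 * n‖ ≤ 0 := fun n => by simp
  have hκ : ‖(1 : ℂ)‖ ≤ 1 := by simp
  have hζ : Set.EqOn (DirichletCharacter.LFunctionTrivChar₁ 1)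
      (fun s => (s - 1) * (∑ n ∈ Icc 1 M, (1 : ℕ → ℂ) n * (n : ℂ) ^ (-s)
      + s * mellin (tailDeviation 1 1 M) (-s)) + (M : ℂ) ^ (1 - s)) {s | 0 < s.re} := by
    refine eqOn_re_pos (DirichletCharacter.differentiable_LFunctionTrivChar₁ 1).differentiableOn ?_
      fun s hs => ?_
    · refine DifferentiableOn.add (DifferentiableOn.mul (by fun_prop)
        (analyticOnNhd_sum_add_mellin hκ hR hM1)) ?_
      refine DifferentiableOn.const_cpow (by fun_prop) (Or.inl ?_)
      exact_mod_cast (by omega : M ≠ 0)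
    · have hs1 : s ≠ 1 := fun h => by simp [h] at hs
      have hs2 : s - 1 ≠ 0 := sub_ne_zero.mpr hs1
      rw [DirichletCharacter.LFunctionTrivChar₁, Function.update_of_ne hs1]
      simp only [DirichletCharacter.LFunctionTrivChar, DirichletCharacter.LFunction_modOne_eq]
      rw [← LSeries_one_eq_riemannZeta hs, LSeries_eq_sum_add_mellin hg hκ hR hM1 hs]
      field_simp
      ring
  have hs2 : s - 1 ≠ 0 := sub_ne_zero.mpr hs1
  have := hζ hs
  rw [DirichletCharacter.LFunctionTrivChar₁, Function.update_of_ne hs1] at this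
  simp only [DirichletCharacter.LFunctionTrivChar, DirichletCharacter.LFunction_modOne_eq] at this
  rw [← mul_right_inj' hs2, this]
  field_simp

lemma re_riemannZeta_neg {β : ℝ} (h0 : 1 / 2 < β) (h1 : β < 1) : (riemannZeta β).re < 0 := by
  have hR : ∀ n : ℕ, ‖∑ k ∈ Icc 1 n, (1 : ℕ → ℂ) k - 1 * n‖ ≤ 0 := fun n => by simp
  have hb : (β : ℂ) ≠ 1 := by exact_mod_cast h1.ne
  have hβ : 0 < β := by linarith
  rw [riemannZeta_eq_sum_add_mellin le_rfl (by simpa using hβ) hb]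
  have h := norm_mellin_tailDeviation_le (κ := 1) (by simp) hR le_rfl (s := β) (by simpa using hβ)
  have h2 : ‖(β : ℂ) * mellin (tailDeviation 1 1 1) (-(β : ℂ))‖ ≤ 1 := by
    rw [norm_mul, norm_real, Real.norm_of_nonneg hβ.le]
    refine (mul_le_mul_of_nonneg_left h hβ.le).trans (le_of_eq ?_)
    simp [hβ.ne']
  have h3 := (re_le_norm _).trans h2
  have e : (1 : ℂ) / (β - 1) = ((1 / (β - 1) : ℝ) : ℂ) := by push_cast; rfl
  simp only [Icc_self, sum_singleton, Pi.one_apply, Nat.cast_one, one_cpow, mul_one, add_re, one_re,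
    e, ofReal_re]
  have h4 : 1 / (β - 1) < -2 := by
    rw [div_lt_iff_of_neg (by linarith)]
    linarith
  linarith

/-- Convexity-type bound for the Riemann zeta function near the line `re s = 1`. -/
theorem norm_riemannZeta_le {η : ℝ} (h0 : 0 < η) (h1 : η ≤ 1 / 2) {s : ℂ} (hs : 1 - η ≤ s.re)
    (hs1 : s ≠ 1) :
    ‖riemannZeta s‖ ≤ (2 / η + 20) * (1 + ‖s‖) ^ η + 2 * (1 + ‖s‖) ^ η / ‖s - 1‖ := by
  have hg : ∀ n : ℕ, ‖(1 : ℕ → ℂ) n‖ ≤ 1 := fun n => by simp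
  have hR : ∀ n : ℕ, ‖∑ k ∈ Icc 1 n, (1 : ℕ → ℂ) k - 1 * n‖ ≤ 2 * (1 : ℕ) := fun n => by simp
  have hκ : ‖(1 : ℂ)‖ ≤ 1 := by simp
  set M := ⌈(1 : ℕ) * (1 + ‖s‖)⌉₊ with hMdef
  have hM1 : 1 ≤ M := Nat.one_le_ceil_iff.mpr (by positivity)
  have hM2 : (M : ℝ) ≤ 2 * (1 + ‖s‖) := by
    have := Nat.ceil_lt_add_one (show (0:ℝ) ≤ (1 : ℕ) * (1 + ‖s‖) by positivity)
    rw [← hMdef] at this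
    push_cast at this
    linarith [norm_nonneg s]
  have e := riemannZeta_eq_sum_add_mellin hM1 (show 0 < s.re by linarith) hs1
  rw [e]
  refine (norm_add_le _ _).trans (add_le_add ?_ ?_)
  · simpa using norm_sum_add_mellin_le hg hκ le_rfl hR h0 h1 hs hMdef
  · refine (norm_cpow_div_sub_one_le hM1 hs).trans ?_
    rw [norm_one, one_mul]
    gcongr
    calc (M : ℝ) ^ η ≤ (2 * (1 + ‖s‖)) ^ η := by gcongr
      _ = 2 ^ η * (1 + ‖s‖) ^ η := Real.mul_rpow (by norm_num) (by positivity)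
      _ ≤ 2 ^ (1 : ℝ) * (1 + ‖s‖) ^ η := by
        gcongr
        · norm_num
        · linarith
      _ = _ := by rw [Real.rpow_one]

end DirichletLFunctionBounds

section EstermannLemma

open Complex ComplexOrder

lemma iteratedDeriv_div_sub_one (c : ℂ) (m : ℕ) :
    iteratedDeriv m (fun s : ℂ => c / (s - 1)) 2 = c * ((-1) ^ m * m.factorial) := by
  have h : (fun s : ℂ => c / (s - 1)) = fun s => c * (fun z : ℂ => Inv.inv (z - 1)) s := by
    funext s; rw [div_eq_mul_inv]
  rw [h, iteratedDeriv_const_mul_field, iteratedDeriv_comp_sub_const m Inv.inv 1,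
    iteratedDeriv_eq_iterate]
  norm_num [iter_deriv_inv]

/-- Estermann's lower bound for the residue of a Dirichlet series with nonnegative coefficients
which is not positive at a point slightly to the left of `1`. -/
theorem residue_lower_bound {a : ℕ → ℂ} (ha : 0 ≤ a) (ha1 : a 1 = 1)
    (habs : LSeries.abscissaOfAbsConv a ≤ 1) {G : ℂ → ℂ} (hG : Differentiable ℂ G) {l : ℂ}
    (hl : ∀ s : ℂ, 1 < s.re → LSeries a s = G s + l / (s - 1)) {M : ℝ}
    (hM : ∀ z ∈ Metric.sphere (2 : ℂ) (3 / 2), ‖G z‖ ≤ M) {β : ℝ} (hβ : 7 / 8 < β) (hβ1 : β < 1)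
    (hGβ : (G β).re ≤ l.re / (1 - β)) {T : ℕ} (hT1 : 1 ≤ T)
    (hT : 8 * M * (3 / 4 : ℝ) ^ T ≤ 1) :
    (1 - β) / 2 ≤ l.re * (2 - β) ^ T := by
  have habs2 : LSeries.abscissaOfAbsConv a < ((2 : ℝ) : EReal) :=
    habs.trans_lt (by exact_mod_cast (by norm_num : (1 : ℝ) < 2))
  set u : ℝ := 2 - β with hu
  have hu1 : 1 < u := by linarith
  have hu2 : u < 9 / 8 := by linarith
  have hM0 : 0 ≤ M := (norm_nonneg _).trans
    (hM (2 + (3 / 2 : ℝ)) (by simp))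
  set c : ℕ → ℂ := fun m => (-1) ^ m * iteratedDeriv m G 2 / m.factorial with hc
  have hder : ∀ m, iteratedDeriv m (LSeries a) 2 = iteratedDeriv m G 2
      + l * ((-1) ^ m * m.factorial) := by
    intro m
    have ho1 : IsOpen {s : ℂ | 1 < s.re} := isOpen_lt continuous_const continuous_re
    have e : LSeries a =ᶠ[nhds 2] (G + fun s => l / (s - 1)) := by
      filter_upwards [ho1.mem_nhds (show (2 : ℂ) ∈ {s : ℂ | 1 < s.re} by simp)] with s hs
      exact hl s hs
    rw [e.iteratedDeriv_eq, iteratedDeriv_add, iteratedDeriv_div_sub_one]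
    · exact hG.contDiff.contDiffAt
    · refine ContDiffAt.div contDiffAt_const (contDiffAt_id.sub contDiffAt_const) ?_
      norm_num
  have hcl : ∀ m, 0 ≤ (c m).re + l.re := by
    intro m
    have h := LSeries.iteratedDeriv_alternating ha habs2 m
    rw [ofReal_ofNat, hder] at h
    have h2 : (-1 : ℂ) ^ m * (iteratedDeriv m G 2 + l * ((-1) ^ m * m.factorial))
        = m.factorial * (c m + l) := by
      have : ((-1 : ℂ) ^ m) * (-1) ^ m = 1 := by rw [← mul_pow]; norm_num
      have hf : (m.factorial : ℂ) ≠ 0 := by exact_mod_cast m.factorial_ne_zero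
      simp only [hc]
      field_simp
      linear_combination (l * m.factorial) * this
    rw [h2, Complex.le_def] at h
    have h3 := h.1
    rw [← ofReal_natCast, re_ofReal_mul, zero_re, add_re] at h3
    exact nonneg_of_mul_nonneg_right h3 (by exact_mod_cast m.factorial_pos)
  have hc0 : 1 ≤ (c 0).re + l.re := by
    have h := hder 0
    simp only [iteratedDeriv_zero, pow_zero, Nat.factorial_zero, Nat.cast_one, mul_one] at h
    have h2 : c 0 + l = LSeries a 2 := by rw [h]; simp [hc]
    rw [← add_re, h2]
    have hs : LSeriesSummable a 2 :=
      LSeriesSummable_of_abscissaOfAbsConv_lt_re (by simpa using habs2)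
    have hre : (LSeries a 2).re = ∑' n, (LSeries.term a 2 n).re := by
      unfold LSeries; exact re_tsum hs
    rw [hre]
    have hs' : Summable fun n => (LSeries.term a 2 n).re := reCLM.summable hs
    refine le_trans ?_ (hs'.le_tsum 1 fun n _ => ?_)
    · rw [LSeries.term_of_ne_zero one_ne_zero, ha1]; simp
    · have := LSeries.term_nonneg (ha n) (2 : ℝ)
      rw [ofReal_ofNat, Complex.le_def] at this
      simpa using this.1
  have hcM : ∀ m, |(c m).re| ≤ M * (2 / 3) ^ m := by
    intro m
    refine (abs_re_le_norm _).trans ?_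
    have := norm_iteratedDeriv_le_of_forall_mem_sphere_norm_le m (by norm_num)
      (hG.diffContOnCl) hM
    have hf : (0 : ℝ) < m.factorial := by exact_mod_cast m.factorial_pos
    simp only [hc]
    rw [norm_div, norm_mul, norm_pow, norm_neg, norm_one, one_pow, one_mul, norm_natCast,
      div_le_iff₀ hf]
    refine this.trans (le_of_eq ?_)
    rw [div_pow, div_pow]
    field_simp
  have hsum : HasSum (fun m => (c m).re * u ^ m) (G β).re := by
    have hb : (β : ℂ) ∈ Metric.ball (2 : ℂ) (3 / 2) := by
      rw [Metric.mem_ball, dist_eq_norm]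
      have : (β : ℂ) - 2 = ((-u : ℝ) : ℂ) := by rw [hu]; push_cast; ring
      rw [this, norm_real, Real.norm_eq_abs, abs_neg, abs_of_pos (by linarith)]
      linarith
    have h := hasSum_re (hasSum_taylorSeries_on_ball (hG.differentiableOn) hb)
    convert h using 2 with m
    have : (β : ℂ) - 2 = (-1) * ((u : ℝ) : ℂ) := by rw [hu]; push_cast; ring
    rw [this, mul_pow, ← re_mul_ofReal]
    congr 1
    simp only [hc, smul_eq_mul]
    push_cast
    ring
  have hgeom : Summable fun m : ℕ => M * (3 / 4 : ℝ) ^ m :=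
    (summable_geometric_of_lt_one (by norm_num) (by norm_num)).mul_left _
  have htail : -(1 / 2) ≤ ∑' m, (c (m + T)).re * u ^ (m + T) := by
    have hle : ∀ m, -(M * (3 / 4) ^ T * (3 / 4 : ℝ) ^ m) ≤ (c (m + T)).re * u ^ (m + T) := by
      intro m
      have h1 := (abs_le.mp (hcM (m + T))).1
      have h2 : (2 / 3 : ℝ) ^ (m + T) * u ^ (m + T) ≤ (3 / 4) ^ (m + T) := by
        rw [← mul_pow]
        exact pow_le_pow_left₀ (by positivity) (by linarith) _
      have h3 : 0 ≤ u ^ (m + T) := by positivity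
      have h4 : (3 / 4 : ℝ) ^ (m + T) = (3 / 4) ^ T * (3 / 4 : ℝ) ^ m := by rw [pow_add]; ring
      nlinarith
    have hs1 : HasSum (fun m : ℕ => -(M * (3 / 4) ^ T * (3 / 4 : ℝ) ^ m))
        (-(M * (3 / 4) ^ T * (1 - 3 / 4)⁻¹)) :=
      ((hasSum_geometric_of_lt_one (by norm_num) (by norm_num)).mul_left _).neg
    have := hs1.summable.tsum_le_tsum hle ((summable_nat_add_iff T).mpr hsum.summable)
    rw [hs1.tsum_eq] at this
    refine le_trans ?_ this
    norm_num
    linarith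
  have hhead : 1 - l.re * ∑ m ∈ range T, u ^ m ≤ ∑ m ∈ range T, (c m).re * u ^ m := by
    obtain ⟨t, rfl⟩ := Nat.exists_eq_succ_of_ne_zero (by omega : T ≠ 0)
    rw [Nat.succ_eq_add_one, mul_sum, sum_range_succ', sum_range_succ']
    simp only [pow_zero, mul_one]
    have : ∑ k ∈ range t, -(l.re * u ^ (k + 1)) ≤ ∑ k ∈ range t, (c (k + 1)).re * u ^ (k + 1) := by
      refine sum_le_sum fun k _ => ?_
      have h1 := hcl (k + 1)
      have h2 : 0 ≤ u ^ (k + 1) := by positivity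
      nlinarith
    rw [sum_neg_distrib] at this
    linarith
  have htot : (G β).re = ∑ m ∈ range T, (c m).re * u ^ m
      + ∑' m, (c (m + T)).re * u ^ (m + T) := by
    rw [← hsum.tsum_eq, hsum.summable.sum_add_tsum_nat_add]
  have hgs : ∑ m ∈ range T, u ^ m = (u ^ T - 1) / (u - 1) := geom_sum_eq hu1.ne' T
  have hb : 1 - β = u - 1 := by rw [hu]; ring
  rw [hb] at hGβ ⊢
  have hfin : 1 / 2 ≤ l.re * u ^ T / (u - 1) := by
    have h1 : 1 - l.re * ((u ^ T - 1) / (u - 1)) - 1 / 2 ≤ l.re / (u - 1) := by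
      rw [← hgs]; linarith
    have h2 : l.re * u ^ T / (u - 1)
        = l.re / (u - 1) + l.re * ((u ^ T - 1) / (u - 1)) := by ring
    rw [h2]; linarith
  rw [le_div_iff₀ (by linarith)] at hfin
  linarith

end EstermannLemma

section NonnegativeConvolution

open ArithmeticFunction ComplexOrder

/-- `b` is the arithmetic logarithmic derivative of `a`. -/
def IsLogDeriv (a b : ArithmeticFunction ℂ) : Prop :=
  ∀ n, a n * (Real.log n : ℂ) = (b * a) n

lemma IsLogDeriv.mul {a b a' b' : ArithmeticFunction ℂ} (h : IsLogDeriv a b)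
    (h' : IsLogDeriv a' b') : IsLogDeriv (a * a') (b + b') := by
  have key : ∀ f g : ArithmeticFunction ℂ, ∀ (Df Dg : ArithmeticFunction ℂ),
      (∀ n, f n * (Real.log n : ℂ) = Df n) → (∀ n, g n * (Real.log n : ℂ) = Dg n) →
      ∀ n, (f * g) n * (Real.log n : ℂ) = (Df * g + f * Dg) n := by
    intro f g Df Dg hf hg n
    rw [ArithmeticFunction.add_apply, mul_apply, mul_apply, mul_apply, sum_mul, ← sum_add_distrib]
    refine sum_congr rfl fun p hp => ?_
    rw [Nat.mem_divisorsAntidiagonal] at hp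
    have h1 : p.1 ≠ 0 := fun h => hp.2 (by rw [← hp.1, h, zero_mul])
    have h2 : p.2 ≠ 0 := fun h => hp.2 (by rw [← hp.1, h, mul_zero])
    rw [← hf, ← hg, ← hp.1, Nat.cast_mul, Real.log_mul (by exact_mod_cast h1)
      (by exact_mod_cast h2)]
    push_cast
    ring
  intro n
  rw [key a a' (b * a) (b' * a') h h' n]
  congr 1
  ring

lemma IsLogDeriv.nonneg {a b : ArithmeticFunction ℂ} (h : IsLogDeriv a b) (ha : 0 ≤ a 1)
    (hb1 : b 1 = 0) (hb : ∀ n, 0 ≤ b n) (n : ℕ) : 0 ≤ a n := by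
  induction n using Nat.strong_induction_on with
  | _ n ih =>
    rcases Nat.lt_or_ge n 2 with hn | hn
    · interval_cases n
      · simp
      · exact ha
    · have hlog : 0 < Real.log n := Real.log_pos (by exact_mod_cast hn)
      have h1 : 0 ≤ (b * a) n := by
        rw [mul_apply]
        refine sum_nonneg fun p hp => ?_
        rw [Nat.mem_divisorsAntidiagonal] at hp
        rcases eq_or_ne p.1 1 with e | e
        · rw [e, hb1, zero_mul]
        · refine mul_nonneg (hb _) (ih _ ?_)
          have h2 : p.1 ≠ 0 := fun h => hp.2 (by rw [← hp.1, h, zero_mul])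
          have h3 : p.2 ≠ 0 := fun h => hp.2 (by rw [← hp.1, h, mul_zero])
          rw [← hp.1]
          have : 2 ≤ p.1 := by omega
          nlinarith [Nat.pos_of_ne_zero h3]
      rw [← h n] at h1
      have h2 : a n = (a n * (Real.log n : ℂ)) * ((Real.log n)⁻¹ : ℝ) := by
        rw [mul_assoc, ← Complex.ofReal_mul, mul_inv_cancel₀ hlog.ne', Complex.ofReal_one, mul_one]
      rw [h2]
      refine mul_nonneg h1 ?_
      rw [Complex.zero_le_real]
      positivity

variable {q : ℕ}

/-- A Dirichlet character as an arithmetic function. -/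
noncomputable def charFun (χ : DirichletCharacter ℂ q) : ArithmeticFunction ℂ :=
  toArithmeticFunction (fun n => χ n)

/-- The von Mangoldt function twisted by a Dirichlet character. -/
noncomputable def twistedMangoldt (χ : DirichletCharacter ℂ q) : ArithmeticFunction ℂ :=
  ⟨fun n => χ n * (Λ n : ℂ), by simp⟩

lemma charFun_apply (χ : DirichletCharacter ℂ q) {n : ℕ} (hn : n ≠ 0) : charFun χ n = χ n := by
  simp [charFun, toArithmeticFunction, hn]

lemma isLogDeriv_charFun (χ : DirichletCharacter ℂ q) :
    IsLogDeriv (charFun χ) (twistedMangoldt χ) := by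
  intro n
  rcases eq_or_ne n 0 with rfl | hn
  · simp
  have h := congrFun χ.convolution_twist_vonMangoldt n
  rw [LSeries.convolution_def] at h
  rw [charFun_apply χ hn, mul_apply]
  simp only [Pi.mul_apply] at h
  rw [← Complex.ofReal_natCast, ← Complex.ofReal_log (Nat.cast_nonneg n)] at h
  rw [← h]
  refine sum_congr rfl fun p hp => ?_
  rw [Nat.mem_divisorsAntidiagonal] at hp
  have h2 : p.2 ≠ 0 := fun h => hp.2 (by rw [← hp.1, h, mul_zero])
  rw [charFun_apply χ h2]
  simp [twistedMangoldt]

lemma LSeriesSummable_charFun (χ : DirichletCharacter ℂ q) {s : ℂ} (hs : 1 < s.re) :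
    LSeriesSummable (fun n => charFun χ n) s :=
  LSeriesSummable_of_bounded_of_one_lt_re (m := 1) (fun n hn => by
    rw [charFun_apply χ hn]; exact χ.norm_le_one _) hs

lemma LSeries_charFun [NeZero q] (χ : DirichletCharacter ℂ q) {s : ℂ} (hs : 1 < s.re) :
    LSeries (fun n => charFun χ n) s = χ.LFunction s := by
  rw [χ.LFunction_eq_LSeries hs]
  exact LSeries_congr (fun {n} hn => charFun_apply χ hn) s

end NonnegativeConvolution

section PrimeProducts

lemma one_div_card_le_prod (S : Finset ℕ) (hS : ∀ n ∈ S, 2 ≤ n) :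
    1 / ((#S : ℝ) + 1) ≤ ∏ n ∈ S, (1 - 1 / (n : ℝ)) := by
  induction S using Finset.induction_on_max with
  | empty => simp
  | insert a S ha ih =>
    have haS : a ∉ S := fun h => (ha a h).false
    rw [prod_insert haS, card_insert_of_notMem haS]
    have h1 := ih fun n hn => hS n (mem_insert_of_mem hn)
    have ha2 : 2 ≤ a := hS a (mem_insert_self _ _)
    have hcard : #S + 2 ≤ a := by
      have : S ⊆ Ico 2 a := fun n hn =>
        mem_Ico.mpr ⟨hS n (mem_insert_of_mem hn), ha n hn⟩
      have := card_le_card this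
      rw [Nat.card_Ico] at this
      omega
    have hcard' : (#S : ℝ) + 2 ≤ a := by exact_mod_cast hcard
    have hk : (0 : ℝ) ≤ #S := Nat.cast_nonneg _
    have h2 : 1 - 1 / ((#S : ℝ) + 2) ≤ 1 - 1 / (a : ℝ) := by
      gcongr
    have h3 : 0 ≤ 1 - 1 / ((#S : ℝ) + 2) := by
      rw [sub_nonneg, div_le_one (by linarith)]; linarith
    calc 1 / (((#S + 1 : ℕ) : ℝ) + 1)
        = (1 - 1 / ((#S : ℝ) + 2)) * (1 / ((#S : ℝ) + 1)) := by
          push_cast; field_simp; ring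
      _ ≤ _ := mul_le_mul h2 h1 (by positivity) (h3.trans h2)

lemma card_primeFactors_le_log {n : ℕ} (hn : n ≠ 0) : #n.primeFactors ≤ Nat.log 2 n := by
  refine Nat.le_log_of_pow_le (by norm_num) ?_
  calc 2 ^ #n.primeFactors ≤ ∏ p ∈ n.primeFactors, p :=
        pow_card_le_prod _ _ _ fun p hp => (Nat.prime_of_mem_primeFactors hp).two_le
    _ ≤ n := Nat.le_of_dvd (Nat.pos_of_ne_zero hn) (Nat.prod_primeFactors_dvd n)

lemma card_primeFactors_le_two_mul_log {n : ℕ} (hn : n ≠ 0) :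
    (#n.primeFactors : ℝ) ≤ 2 * Real.log n := by
  have h1 : (#n.primeFactors : ℝ) ≤ Nat.log 2 n := by exact_mod_cast card_primeFactors_le_log hn
  have h2 : ((2 : ℝ) ^ Nat.log 2 n) ≤ n := by exact_mod_cast Nat.pow_log_le_self 2 hn
  have h3 := Real.log_le_log (by positivity) h2
  rw [Real.log_pow] at h3
  have h4 := Real.log_two_gt_d9
  have h5 : (0 : ℝ) ≤ Nat.log 2 n := Nat.cast_nonneg _
  nlinarith

lemma one_div_log_le_prod_primeFactors {n : ℕ} (hn : n ≠ 0) :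
    1 / (2 * Real.log n + 1) ≤ ∏ p ∈ n.primeFactors, (1 - 1 / (p : ℝ)) := by
  refine le_trans ?_ (one_div_card_le_prod _ fun p hp => (Nat.prime_of_mem_primeFactors hp).two_le)
  have := card_primeFactors_le_two_mul_log hn
  gcongr

lemma div_totient_le {n : ℕ} (hn : n ≠ 0) : (n : ℝ) / n.totient ≤ 2 * Real.log n + 1 := by
  have h := one_div_log_le_prod_primeFactors hn
  have hlog : 0 ≤ Real.log n := Real.log_natCast_nonneg n
  have e : (n.totient : ℝ) = n * ∏ p ∈ n.primeFactors, (1 - 1 / (p : ℝ)) := by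
    have := Nat.totient_eq_mul_prod_factors n
    have h2 := congrArg (fun x : ℚ => (x : ℝ)) this
    push_cast at h2
    simpa [one_div] using h2
  have hn0 : (0 : ℝ) < n := by exact_mod_cast Nat.pos_of_ne_zero hn
  have hP : 0 < ∏ p ∈ n.primeFactors, (1 - 1 / (p : ℝ)) := lt_of_lt_of_le (by positivity) h
  rw [e, div_le_iff₀ (by positivity)]
  rw [div_le_iff₀ (by positivity)] at h
  nlinarith

end PrimeProducts

section RealCharacters

open Complex ComplexOrder

variable {q : ℕ} {χ : DirichletCharacter ℂ q}

lemma DirichletCharacter.eq_zero_or_one_or_neg_one (hχ : χ ^ 2 = 1) (a : ZMod q) :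
    χ a = 0 ∨ χ a = 1 ∨ χ a = -1 := by
  by_cases ha : IsUnit a
  · right
    have h : χ a ^ 2 = 1 := by
      have := congrArg (fun ψ : DirichletCharacter ℂ q => ψ a) hχ
      simpa [MulChar.pow_apply' χ two_ne_zero, MulChar.one_apply ha] using this
    exact sq_eq_sq_iff_eq_or_eq_neg.mp (h.trans (one_pow 2).symm)
  · exact Or.inl (χ.map_nonunit ha)

variable [NeZero q]

lemma conj_LFunction_conj (hχ : χ ^ 2 = 1) (hχ1 : χ ≠ 1) (s : ℂ) :
    (starRingEnd ℂ) (χ.LFunction ((starRingEnd ℂ) s)) = χ.LFunction s := by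
  have hd := DirichletCharacter.differentiable_LFunction hχ1
  have hd' : Differentiable ℂ ((starRingEnd ℂ) ∘ χ.LFunction ∘ (starRingEnd ℂ)) :=
    fun z => by simpa using (hd ((starRingEnd ℂ) z)).conj_conj
  have ho1 : IsOpen {s : ℂ | 1 < s.re} := isOpen_lt continuous_const continuous_re
  have := (hd'.differentiableOn.analyticOnNhd isOpen_univ).eq_of_eventuallyEq
    (hd.differentiableOn.analyticOnNhd isOpen_univ) (z₀ := 2) ?_
  · exact congrFun this s
  · filter_upwards [ho1.mem_nhds (show (2 : ℂ) ∈ {s : ℂ | 1 < s.re} by simp)] with s hs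
    have hs' : 1 < s.re := hs
    simp only [Function.comp_apply]
    rw [χ.LFunction_eq_LSeries hs, χ.LFunction_eq_LSeries (by simpa using hs')]
    unfold LSeries
    rw [conj_tsum]
    refine tsum_congr fun n => ?_
    rcases Nat.eq_zero_or_pos n with rfl | hn
    · simp
    · rw [LSeries.term_of_ne_zero hn.ne', LSeries.term_of_ne_zero hn.ne', map_div₀,
        cpow_conj _ _ (by rw [natCast_arg]; exact Real.pi_ne_zero.symm), Complex.conj_conj,
        conj_natCast]
      congr 1
      rcases DirichletCharacter.eq_zero_or_one_or_neg_one hχ (n : ZMod q) with h | h | h <;>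
        simp [h]

lemma LFunction_ofReal_eq_re (hχ : χ ^ 2 = 1) (hχ1 : χ ≠ 1) (σ : ℝ) :
    χ.LFunction σ = ((χ.LFunction σ).re : ℂ) := by
  have := conj_LFunction_conj hχ hχ1 σ
  rw [conj_ofReal] at this
  exact (conj_eq_iff_re.mp this).symm

lemma LFunction_re_pos (hχ : χ ^ 2 = 1) (hχ1 : χ ≠ 1) {β : ℝ}
    (h : ∀ σ : ℝ, β ≤ σ → σ < 1 → χ.LFunction σ ≠ 0) : 0 < (χ.LFunction β).re := by
  by_contra! hneg
  have hlim : Filter.Tendsto (fun x : ℝ => (χ.LFunction x).re) Filter.atTop (nhds 1) := by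
    have h1 := LSeries.tendsto_atTop (f := fun n => χ n)
      ((LSeries.abscissaOfAbsConv_le_of_le_const ⟨1, fun n _ => χ.norm_le_one _⟩).trans_lt
        (EReal.coe_lt_top 1))
    have h2 := (continuous_re.tendsto _).comp h1
    simp only [Nat.cast_one, map_one, one_re] at h2
    refine h2.congr' ?_
    filter_upwards [Filter.eventually_gt_atTop 1] with x hx
    simp only [Function.comp_apply]
    rw [χ.LFunction_eq_LSeries (by simpa using hx)]
  obtain ⟨x, hx, hxβ⟩ := ((hlim.eventually (lt_mem_nhds (show (0 : ℝ) < 1 by norm_num))).and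
    (Filter.eventually_ge_atTop β)).exists
  have hcont : Continuous fun σ : ℝ => (χ.LFunction σ).re :=
    continuous_re.comp ((DirichletCharacter.differentiable_LFunction hχ1).continuous.comp
      continuous_ofReal)
  obtain ⟨σ, hσ, hσ0⟩ := intermediate_value_Icc hxβ hcont.continuousOn ⟨hneg, hx.le⟩
  have hz : χ.LFunction σ = 0 := by
    rw [LFunction_ofReal_eq_re hχ hχ1]
    simpa using hσ0
  rcases lt_or_ge σ 1 with h1 | h1
  · exact h σ hσ.1 h1 hz
  · exact DirichletCharacter.LFunction_ne_zero_of_one_le_re χ (Or.inl hχ1) (by simpa using h1) hz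

lemma norm_LFunction_le_of_mem_closedBall (hχ1 : χ ≠ 1) {s : ℂ}
    (hs : ‖s - 2‖ ≤ 3 / 2) : ‖χ.LFunction s‖ ≤ 108 * q := by
  have hre : 1 / 2 ≤ s.re := by
    have := (abs_le.mp ((abs_re_le_norm _).trans hs)).1
    simp at this
    linarith
  have hn : ‖s‖ ≤ 7 / 2 := by
    have := norm_add_le (s - 2) 2
    simp at this
    linarith
  have hq : (1 : ℝ) ≤ q := by exact_mod_cast Nat.pos_of_ne_zero (NeZero.ne q)
  refine (norm_LFunction_le hχ1 (η := 1 / 2) (by norm_num) le_rfl (by linarith)).trans ?_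
  have h1 : (q * (1 + ‖s‖)) ^ (1 / 2 : ℝ) ≤ (q * (1 + ‖s‖)) ^ (1 : ℝ) :=
    Real.rpow_le_rpow_of_exponent_le (by nlinarith [norm_nonneg s]) (by norm_num)
  rw [Real.rpow_one] at h1
  have h2 : (q : ℝ) * (1 + ‖s‖) ≤ q * (9 / 2) := by
    gcongr; linarith
  norm_num at h1 ⊢
  linarith

/-- Estermann's inequality for a pair of real characters. -/
lemma estermann_pair {χ₁ χ₂ : DirichletCharacter ℂ q} (h1 : χ₁ ^ 2 = 1) (h2 : χ₂ ^ 2 = 1)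
    (n1 : χ₁ ≠ 1) (n2 : χ₂ ≠ 1) (n12 : χ₁ * χ₂ ≠ 1) {β : ℝ} (hβ : 7 / 8 < β) (hβ1 : β < 1)
    (hneg : (riemannZeta β * (χ₁.LFunction β * χ₂.LFunction β * (χ₁ * χ₂).LFunction β)).re ≤ 0)
    {T : ℕ} (hT1 : 1 ≤ T) (hT : 8 * (1000 * (108 * q) ^ 3) * (3 / 4 : ℝ) ^ T ≤ 1) :
    (1 - β) / 2 ≤
      ‖χ₁.LFunction 1‖ * ‖χ₂.LFunction 1‖ * ‖(χ₁ * χ₂).LFunction 1‖ * (2 - β) ^ T := by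
  set H : ℂ → ℂ := fun s => χ₁.LFunction s * χ₂.LFunction s * (χ₁ * χ₂).LFunction s with hH
  set E := DirichletCharacter.LFunctionTrivChar₁ 1 with hE
  have hE1 : E 1 = 1 := by simp [hE, DirichletCharacter.LFunctionTrivChar₁]
  have hEs : ∀ s, s ≠ 1 → E s = (s - 1) * riemannZeta s := fun s hs => by
    simp only [hE, DirichletCharacter.LFunctionTrivChar₁, Function.update_of_ne hs,
      DirichletCharacter.LFunctionTrivChar, DirichletCharacter.LFunction_modOne_eq]
  have hHd : Differentiable ℂ H :=
    ((DirichletCharacter.differentiable_LFunction n1).mul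
      (DirichletCharacter.differentiable_LFunction n2)).mul
      (DirichletCharacter.differentiable_LFunction n12)
  have hEd : Differentiable ℂ E := DirichletCharacter.differentiable_LFunctionTrivChar₁ 1
  set G : ℂ → ℂ := dslope (fun s => E s * H s) 1 with hG
  have hGd : Differentiable ℂ G := by
    rw [← differentiableOn_univ, hG, Complex.differentiableOn_dslope Filter.univ_mem]
    exact (hEd.mul hHd).differentiableOn
  have hGs : ∀ s, s ≠ 1 → G s = riemannZeta s * H s - H 1 / (s - 1) := by
    intro s hs
    have hs' : s - 1 ≠ 0 := sub_ne_zero.mpr hs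
    rw [hG, dslope_of_ne _ hs, slope_def_field, hE1, hEs s hs]
    field_simp
  set χ₀ : DirichletCharacter ℂ 1 := 1
  set a : ArithmeticFunction ℂ := ((charFun χ₀ * charFun χ₁) * charFun χ₂) * charFun (χ₁ * χ₂)
  set b : ArithmeticFunction ℂ := ((twistedMangoldt χ₀ + twistedMangoldt χ₁) + twistedMangoldt χ₂)
    + twistedMangoldt (χ₁ * χ₂)
  have hab : IsLogDeriv a b :=
    (((isLogDeriv_charFun χ₀).mul (isLogDeriv_charFun χ₁)).mul (isLogDeriv_charFun χ₂)).mul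
      (isLogDeriv_charFun (χ₁ * χ₂))
  have ha1 : a 1 = 1 := by
    have : χ₀ (0 : ZMod 1) = 1 := MulChar.one_apply (isUnit_of_subsingleton _)
    simp [a, ArithmeticFunction.mul_apply, charFun_apply, this]
  have hb : ∀ n, 0 ≤ b n := by
    intro n
    have hΛ : (0 : ℂ) ≤ (ArithmeticFunction.vonMangoldt n : ℂ) := by
      rw [zero_le_real]; exact ArithmeticFunction.vonMangoldt_nonneg
    have e : b n = (1 + χ₁ n) * (1 + χ₂ n) * (ArithmeticFunction.vonMangoldt n : ℂ) := by
      have : χ₀ (n : ZMod 1) = 1 := MulChar.one_apply (isUnit_of_subsingleton _)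
      change χ₀ n * _ + χ₁ n * _ + χ₂ n * _ + (χ₁ * χ₂) n * _ = _
      rw [MulChar.mul_apply, this]
      ring
    rw [e]
    have key : ∀ χ : DirichletCharacter ℂ q, χ ^ 2 = 1 → (0 : ℂ) ≤ 1 + χ n := by
      intro χ hχ
      rcases DirichletCharacter.eq_zero_or_one_or_neg_one hχ (n : ZMod q) with h | h | h <;>
        simp [h]
      norm_num
    exact mul_nonneg (mul_nonneg (key _ h1) (key _ h2)) hΛ
  have ha : (0 : ℕ → ℂ) ≤ fun n => a n := fun n =>
    hab.nonneg (by rw [ha1]; exact zero_le_one)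
      (by
      change χ₀ _ * _ + χ₁ _ * _ + χ₂ _ * _ + (χ₁ * χ₂) _ * _ = _
      simp) hb n
  have hsum : ∀ s : ℂ, 1 < s.re → LSeriesSummable (fun n => a n) s ∧
      LSeries (fun n => a n) s = riemannZeta s * H s := by
    intro s hs
    have s0 := LSeriesSummable_charFun χ₀ hs
    have s1 := LSeriesSummable_charFun χ₁ hs
    have s2 := LSeriesSummable_charFun χ₂ hs
    have s3 := LSeriesSummable_charFun (χ₁ * χ₂) hs
    have s01 := ArithmeticFunction.LSeriesSummable_mul s0 s1
    have s012 := ArithmeticFunction.LSeriesSummable_mul s01 s2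
    refine ⟨ArithmeticFunction.LSeriesSummable_mul s012 s3, ?_⟩
    rw [ArithmeticFunction.LSeries_mul' s012 s3, ArithmeticFunction.LSeries_mul' s01 s2,
      ArithmeticFunction.LSeries_mul' s0 s1, LSeries_charFun _ hs, LSeries_charFun _ hs,
      LSeries_charFun _ hs, LSeries_charFun _ hs, DirichletCharacter.LFunction_modOne_eq]
    simp only [hH]
    ring
  have habs : LSeries.abscissaOfAbsConv (fun n => a n) ≤ 1 :=
    LSeries.abscissaOfAbsConv_le_of_forall_lt_LSeriesSummable fun y hy =>
      (hsum y (by simpa using hy)).1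
  have hHb : ∀ s, ‖s - 2‖ ≤ 3 / 2 → ‖H s‖ ≤ (108 * q) ^ 3 := by
    intro s hs
    simp only [hH]
    rw [norm_mul, norm_mul]
    calc _ ≤ (108 * q) * (108 * q) * (108 * (q : ℝ)) := by
          gcongr
          · exact norm_LFunction_le_of_mem_closedBall n1 hs
          · exact norm_LFunction_le_of_mem_closedBall n2 hs
          · exact norm_LFunction_le_of_mem_closedBall n12 hs
      _ = _ := by ring
  have hM : ∀ z ∈ Metric.sphere (2 : ℂ) (3 / 2), ‖G z‖ ≤ 1000 * (108 * q) ^ 3 := by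
    intro z hz
    rw [mem_sphere_iff_norm] at hz
    have hz1 : 1 / 2 ≤ ‖z - 1‖ := by
      have := norm_sub_norm_le (z - 2) (-1)
      rw [hz, norm_neg, norm_one] at this
      have e : z - 2 - -1 = z - 1 := by ring
      rw [e] at this
      linarith
    have hne : z ≠ 1 := fun h => by simp [h] at hz1; linarith
    have hre : 1 / 2 ≤ z.re := by
      have := (abs_le.mp ((abs_re_le_norm _).trans hz.le)).1
      simp at this
      linarith
    have hn : ‖z‖ ≤ 7 / 2 := by
      have := norm_add_le (z - 2) 2
      simp at this
      linarith
    have hζ : ‖riemannZeta z‖ ≤ 500 := by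
      refine (norm_riemannZeta_le (η := 1 / 2) (by norm_num) le_rfl (by linarith) hne).trans ?_
      have h1 : (1 + ‖z‖) ^ (1 / 2 : ℝ) ≤ (1 + ‖z‖) ^ (1 : ℝ) :=
        Real.rpow_le_rpow_of_exponent_le (by linarith [norm_nonneg z]) (by norm_num)
      rw [Real.rpow_one] at h1
      have h2 : (1 + ‖z‖) ^ (1 / 2 : ℝ) ≤ 9 / 2 := by linarith
      calc (2 / (1 / 2) + 20) * (1 + ‖z‖) ^ (1 / 2 : ℝ) + 2 * (1 + ‖z‖) ^ (1 / 2 : ℝ) / ‖z - 1‖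
          ≤ (2 / (1 / 2) + 20) * (9 / 2) + 2 * (9 / 2) / (1 / 2) := by gcongr
        _ ≤ 500 := by norm_num
    rw [hGs z hne]
    have hH1 := hHb 1 (by norm_num)
    have hHz := hHb z hz.le
    have hK : (0 : ℝ) ≤ (108 * q) ^ 3 := by positivity
    calc _ ≤ ‖riemannZeta z‖ * ‖H z‖ + ‖H 1‖ / ‖z - 1‖ := by
          rw [← norm_mul, ← norm_div]; exact norm_sub_le _ _
      _ ≤ 500 * (108 * q) ^ 3 + (108 * q) ^ 3 / (1 / 2) := by gcongr
      _ ≤ _ := by linarith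
  have hb1 : (β : ℂ) ≠ 1 := by exact_mod_cast hβ1.ne
  have hfin := residue_lower_bound ha ha1 habs hGd (l := H 1) (fun s hs => by
    have : s ≠ 1 := fun h => by simp [h] at hs
    rw [(hsum s hs).2, hGs s this]; ring) hM hβ hβ1 (by
    rw [hGs _ hb1]
    have : H 1 / ((β : ℂ) - 1) = H 1 * ((1 / (β - 1) : ℝ) : ℂ) := by
      push_cast; rw [div_eq_mul_one_div]
    rw [this, sub_re, re_mul_ofReal]
    have e : (H 1).re * (1 / (β - 1)) = - ((H 1).re / (1 - β)) := by
      have : β - 1 = -(1 - β) := by ring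
      rw [this, one_div_neg_eq_neg_one_div]; ring
    rw [e]
    have := hneg
    linarith) hT1 hT
  refine hfin.trans ?_
  have hp : 0 ≤ (2 - β) ^ T := pow_nonneg (by linarith) _
  refine mul_le_mul_of_nonneg_right ?_ hp
  rw [← norm_mul, ← norm_mul]
  exact re_le_norm _

end RealCharacters

section Siegel

open Complex

lemma exists_pow_le_rpow {N : ℕ} (hN : 1 ≤ N) {β : ℝ} (hβ : 7 / 8 < β) (hβ1 : β < 1) :
    ∃ T : ℕ, 1 ≤ T ∧ 8 * (1000 * (108 * N) ^ 3) * (3 / 4 : ℝ) ^ T ≤ 1 ∧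
      (2 - β) ^ T ≤ Real.exp (2 + 4 * Real.log (8000 * 108 ^ 3)) * (N : ℝ) ^ (12 * (1 - β)) := by
  have hN' : (1 : ℝ) ≤ N := by exact_mod_cast hN
  have hN0 : (0 : ℝ) < N := by linarith
  set K : ℝ := 8000 * 108 ^ 3 with hK
  have hY : Real.log (K * (N : ℝ) ^ 3) = Real.log K + 3 * Real.log N := by
    rw [Real.log_mul (by positivity) (by positivity), Real.log_pow]; push_cast; ring
  have hK0 : 0 ≤ Real.log K := Real.log_nonneg (by norm_num [hK])
  have hlN : 0 ≤ Real.log N := Real.log_nonneg hN'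
  set T := ⌈4 * Real.log (K * (N : ℝ) ^ 3)⌉₊ + 1 with hT
  have hT1 : 4 * Real.log (K * (N : ℝ) ^ 3) ≤ T := by
    have := Nat.le_ceil (4 * Real.log (K * (N : ℝ) ^ 3))
    rw [hT]; push_cast; linarith
  have hT2 : (T : ℝ) ≤ 4 * Real.log (K * (N : ℝ) ^ 3) + 2 := by
    have := Nat.ceil_lt_add_one (a := 4 * Real.log (K * (N : ℝ) ^ 3)) (by rw [hY]; positivity)
    rw [hT]; push_cast; linarith
  refine ⟨T, by omega, ?_, ?_⟩
  · have h1 : (3 / 4 : ℝ) ^ T ≤ (K * (N : ℝ) ^ 3)⁻¹ := by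
      calc (3 / 4 : ℝ) ^ T ≤ Real.exp (-(1 / 4)) ^ T := by
            gcongr
            have := Real.add_one_le_exp (-(1 / 4))
            linarith
        _ = Real.exp (-(T / 4)) := by rw [← Real.exp_nat_mul]; congr 1; ring
        _ ≤ Real.exp (-Real.log (K * (N : ℝ) ^ 3)) := by
            rw [Real.exp_le_exp, neg_le_neg_iff, le_div_iff₀ (by norm_num), mul_comm]
            exact hT1
        _ = _ := by rw [Real.exp_neg, Real.exp_log (by positivity)]
    calc 8 * (1000 * (108 * N) ^ 3) * (3 / 4 : ℝ) ^ T
        = (K * (N : ℝ) ^ 3) * (3 / 4 : ℝ) ^ T := by rw [hK]; ring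
      _ ≤ (K * (N : ℝ) ^ 3) * (K * (N : ℝ) ^ 3)⁻¹ := by gcongr
      _ = 1 := mul_inv_cancel₀ (by positivity)
  · calc (2 - β) ^ T ≤ Real.exp (1 - β) ^ T := by
          refine pow_le_pow_left₀ (by linarith) ?_ _
          have := Real.add_one_le_exp (1 - β)
          linarith
      _ = Real.exp (T * (1 - β)) := by rw [← Real.exp_nat_mul]
      _ ≤ Real.exp ((2 + 4 * Real.log K) + Real.log N * (12 * (1 - β))) := by
          apply Real.exp_le_exp.mpr
          rw [hY] at hT2
          have : (T : ℝ) * (1 - β) ≤ (4 * (Real.log K + 3 * Real.log N) + 2) * (1 - β) :=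
            mul_le_mul_of_nonneg_right hT2 (by linarith)
          nlinarith
      _ = _ := by rw [Real.exp_add, Real.rpow_def_of_pos hN0]

lemma two_mul_log_add_one_le {N : ℕ} (hN : 1 ≤ N) {η : ℝ} (h0 : 0 < η) :
    2 * Real.log N + 1 ≤ (2 / η + 20) * (N * (1 + 1)) ^ η := by
  have hN' : (1 : ℝ) ≤ N := by exact_mod_cast hN
  have h1 := Real.log_le_rpow_div (by linarith : (0 : ℝ) ≤ N) h0
  have h2 : (N : ℝ) ^ η ≤ (N * (1 + 1)) ^ η :=
    Real.rpow_le_rpow (by linarith) (by linarith) h0.le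
  have h3 : 1 ≤ (N * (1 + 1) : ℝ) ^ η := Real.one_le_rpow (by linarith) h0.le
  have h4 : 2 * ((N : ℝ) ^ η / η) = 2 / η * (N : ℝ) ^ η := by ring
  have h5 : 2 / η * (N : ℝ) ^ η ≤ 2 / η * (N * (1 + 1)) ^ η := by gcongr
  rw [add_mul]
  generalize ((N : ℝ) * (1 + 1)) ^ η = X at *
  linarith

lemma norm_LFunction_changeLevel_one {q N : ℕ} [NeZero q] [NeZero N] (h : q ∣ N)
    {χ : DirichletCharacter ℂ q} (hχ : χ ≠ 1) :
    ‖χ.LFunction 1‖ / (2 * Real.log N + 1) ≤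
        ‖(DirichletCharacter.changeLevel h χ).LFunction 1‖ ∧
      ‖(DirichletCharacter.changeLevel h χ).LFunction 1‖ ≤
        ‖χ.LFunction 1‖ * (2 * Real.log N + 1) := by
  have hlow := one_div_log_le_prod_primeFactors (NeZero.ne N)
  have hlog : 0 < 2 * Real.log N + 1 := by
    have := Real.log_natCast_nonneg N
    linarith
  have hp : ∀ p ∈ N.primeFactors, (0 : ℝ) < 1 - 1 / p := fun p hp => by
    have h2 : (2 : ℝ) ≤ p := by exact_mod_cast (Nat.prime_of_mem_primeFactors hp).two_le
    have : 1 / (p : ℝ) ≤ 1 / 2 := by gcongr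
    linarith
  have hnorm : ∀ p ∈ N.primeFactors, ‖χ p * (p : ℂ) ^ (-1 : ℂ)‖ ≤ 1 / p := fun p hp => by
    rw [norm_mul, cpow_neg_one, norm_inv, norm_natCast, one_div]
    exact mul_le_of_le_one_left (by positivity) (χ.norm_le_one _)
  rw [DirichletCharacter.LFunction_changeLevel h χ (Or.inl hχ), norm_mul, norm_prod]
  constructor
  · rw [div_eq_mul_one_div]
    refine mul_le_mul_of_nonneg_left (hlow.trans ?_) (norm_nonneg _)
    refine prod_le_prod (fun p h => (hp p h).le) fun p h => ?_
    have := norm_sub_norm_le (1 : ℂ) (χ p * (p : ℂ) ^ (-1 : ℂ))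
    rw [norm_one] at this
    linarith [hnorm p h]
  · refine mul_le_mul_of_nonneg_left ?_ (norm_nonneg _)
    have h2 : ∏ p ∈ N.primeFactors, ‖1 - χ p * (p : ℂ) ^ (-1 : ℂ)‖ ≤
        ∏ p ∈ N.primeFactors, (1 - 1 / (p : ℝ))⁻¹ := by
      refine prod_le_prod (fun p h => norm_nonneg _) fun p h => ?_
      have h3 := norm_sub_le (1 : ℂ) (χ p * (p : ℂ) ^ (-1 : ℂ))
      rw [norm_one] at h3
      have h4 := hnorm p h
      refine (h3.trans (add_le_add le_rfl h4)).trans ?_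
      rw [le_inv_comm₀ (by positivity) (hp p h), inv_eq_one_div,
        le_div_iff₀ (by positivity)]
      nlinarith [sq_nonneg (1 / (p : ℝ))]
    refine h2.trans ?_
    rw [prod_inv_distrib]
    refine (inv_anti₀ (by positivity) hlow).trans (by simp)

lemma siegel_of_exceptional {q₁ : ℕ} [NeZero q₁] {χ₁ : DirichletCharacter ℂ q₁}
    (h1 : χ₁ ^ 2 = 1) (n1 : χ₁ ≠ 1) {β : ℝ} (hβ : 7 / 8 < β) (hβ1 : β < 1)
    (hz : χ₁.LFunction β = 0 ∨ ∀ (q : ℕ) [NeZero q] (χ : DirichletCharacter ℂ q), χ ^ 2 = 1 →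
      χ ≠ 1 → 0 < (χ.LFunction β).re)
    {η : ℝ} (h0 : 0 < η) (hη : η ≤ 1 / 2) :
    ∃ c : ℝ, 0 < c ∧ ∀ (q : ℕ) [NeZero q] (χ : DirichletCharacter ℂ q), χ ^ 2 = 1 → χ ≠ 1 →
      c * (q : ℝ) ^ (-(3 * η + 12 * (1 - β))) ≤ ‖χ.LFunction 1‖ := by
  set K' := Real.exp (2 + 4 * Real.log (8000 * 108 ^ 3)) with hK'
  have hK1 : 1 ≤ K' := by
    rw [hK']
    apply Real.one_le_exp
    have : 0 ≤ Real.log (8000 * 108 ^ 3) := Real.log_nonneg (by norm_num)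
    linarith
  have hL1 : 0 < ‖χ₁.LFunction 1‖ := norm_pos_iff.mpr
    (DirichletCharacter.LFunction_ne_zero_of_one_le_re χ₁ (Or.inl n1) (by simp))
  set c₀ := min ((1 - β) / 2) ‖χ₁.LFunction 1‖ with hc₀
  have hc₀p : 0 < c₀ := lt_min (by linarith) hL1
  set D := (2 / η + 20) ^ 3 * 2 ^ (3 * η) * K' * (q₁ : ℝ) ^ (3 * η + 12 * (1 - β)) with hD
  have hq1 : (1 : ℝ) ≤ q₁ := by exact_mod_cast Nat.pos_of_ne_zero (NeZero.ne q₁)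
  have hDp : 0 < D := by positivity
  refine ⟨c₀ / D, by positivity, fun q _ χ h2 n2 => ?_⟩
  have hq : (1 : ℝ) ≤ q := by exact_mod_cast Nat.pos_of_ne_zero (NeZero.ne q)
  have hN : 1 ≤ q₁ * q := Nat.pos_of_ne_zero (mul_ne_zero (NeZero.ne _) (NeZero.ne _))
  have : NeZero (q₁ * q) := ⟨by omega⟩
  set N := q₁ * q with hNd
  set M := (2 / η + 20) * ((N : ℝ) * (1 + 1)) ^ η with hM
  have hMlog := two_mul_log_add_one_le hN h0
  have hlog1 : 1 ≤ 2 * Real.log N + 1 := by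
    have := Real.log_natCast_nonneg N
    linarith
  have hM1 : 1 ≤ M := hlog1.trans hMlog
  have hN1 : (1 : ℝ) ≤ N := by exact_mod_cast hN
  have hNp : 1 ≤ (N : ℝ) ^ (12 * (1 - β)) := Real.one_le_rpow hN1 (by linarith)
  have hd₁ : q₁ ∣ N := Dvd.intro _ rfl
  have hd : q ∣ N := Dvd.intro_left _ rfl
  set ψ₁ := DirichletCharacter.changeLevel hd₁ χ₁ with hψ₁
  set ψ := DirichletCharacter.changeLevel hd χ with hψ
  have e1 : ψ₁ ^ 2 = 1 := by rw [hψ₁, ← map_pow, h1, map_one]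
  have e2 : ψ ^ 2 = 1 := by rw [hψ, ← map_pow, h2, map_one]
  have m1 : ψ₁ ≠ 1 := fun h => n1 ((DirichletCharacter.changeLevel_eq_one_iff hd₁).mp h)
  have m2 : ψ ≠ 1 := fun h => n2 ((DirichletCharacter.changeLevel_eq_one_iff hd).mp h)
  have hb : ∀ χ : DirichletCharacter ℂ N, χ ≠ 1 → ‖χ.LFunction 1‖ ≤ M := fun χ hχ => by
    have := norm_LFunction_le hχ h0 hη (s := 1) (by simp; linarith)
    simpa [hM] using this
  have hup := (norm_LFunction_changeLevel_one hd n2).2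
  have hlo := (norm_LFunction_changeLevel_one hd₁ n1).1
  have hL0 := norm_nonneg (χ.LFunction 1)
  have hψup : ‖ψ.LFunction 1‖ ≤ ‖χ.LFunction 1‖ * M :=
    hup.trans (mul_le_mul_of_nonneg_left hMlog hL0)
  have key : c₀ ≤ ‖χ.LFunction 1‖ * M ^ 3 * (K' * (N : ℝ) ^ (12 * (1 - β))) := by
    by_cases h12 : ψ₁ * ψ = 1
    · have heq : ψ = ψ₁ := by
        have : ψ₁ * ψ₁ = 1 := by rw [← sq, e1]
        exact mul_left_cancel (h12.trans this.symm)
      have h3 : ‖χ₁.LFunction 1‖ ≤ ‖χ.LFunction 1‖ * M * M := by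
        rw [div_le_iff₀ (by linarith)] at hlo
        refine hlo.trans ?_
        rw [← hψ₁, ← heq]
        exact mul_le_mul hψup hMlog (by linarith) (by positivity)
      calc c₀ ≤ ‖χ.LFunction 1‖ * M * M := (min_le_right _ _).trans h3
        _ = ‖χ.LFunction 1‖ * M ^ 2 * 1 := by ring
        _ ≤ _ := by
          gcongr
          · norm_num
          · exact one_le_mul_of_one_le_of_one_le hK1 hNp
    · obtain ⟨T, hT1, hT, hTb⟩ := exists_pow_le_rpow hN hβ hβ1
      have := estermann_pair e1 e2 m1 m2 h12 hβ hβ1 ?_ hT1 hT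
      · calc c₀ ≤ (1 - β) / 2 := min_le_left _ _
          _ ≤ _ := this
          _ ≤ M * (‖χ.LFunction 1‖ * M) * M * (K' * (N : ℝ) ^ (12 * (1 - β))) := by
            gcongr
            · exact pow_nonneg (by linarith) _
            · exact hb _ m1
            · exact hb _ h12
          _ = _ := by ring
      · rcases hz with hz | hz
        · have : ψ₁.LFunction β = 0 := by
            rw [hψ₁, DirichletCharacter.LFunction_changeLevel hd₁ χ₁ (Or.inl n1), hz, zero_mul]
          simp [this]
        · have e12 : (ψ₁ * ψ) ^ 2 = 1 := by rw [mul_pow, e1, e2, one_mul]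
          rw [LFunction_ofReal_eq_re e1 m1, LFunction_ofReal_eq_re e2 m2,
            LFunction_ofReal_eq_re e12 h12, ← ofReal_mul, ← ofReal_mul, re_mul_ofReal]
          exact mul_nonpos_of_nonpos_of_nonneg (re_riemannZeta_neg (by linarith) hβ1).le
            (mul_pos (mul_pos (hz _ _ e1 m1) (hz _ _ e2 m2)) (hz _ _ e12 h12)).le
  have hMD : M ^ 3 * (K' * (N : ℝ) ^ (12 * (1 - β))) =
      D * (q : ℝ) ^ (3 * η + 12 * (1 - β)) := by
    have e3 : (((N : ℝ) * (1 + 1)) ^ η) ^ 3 = (N : ℝ) ^ (3 * η) * 2 ^ (3 * η) := by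
      rw [← Real.rpow_natCast, ← Real.rpow_mul (by positivity),
        Real.mul_rpow (by positivity) (by positivity)]
      norm_num [mul_comm]
    have e4 : (N : ℝ) ^ (3 * η) * (N : ℝ) ^ (12 * (1 - β)) =
        (q₁ : ℝ) ^ (3 * η + 12 * (1 - β)) * (q : ℝ) ^ (3 * η + 12 * (1 - β)) := by
      rw [← Real.rpow_add (by linarith), hNd, Nat.cast_mul,
        Real.mul_rpow (by linarith) (by linarith)]
    rw [hM, mul_pow, e3, hD]
    calc _ = (2 / η + 20) ^ 3 * 2 ^ (3 * η) * K' *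
          ((N : ℝ) ^ (3 * η) * (N : ℝ) ^ (12 * (1 - β))) := by ring
      _ = _ := by rw [e4]; ring
  rw [mul_assoc, hMD] at key
  rw [Real.rpow_neg (by linarith), ← div_eq_mul_inv, div_div,
    div_le_iff₀ (by positivity)]
  exact key

/-- **Siegel's theorem**. -/
theorem siegel {ε : ℝ} (hε : 0 < ε) :
    ∃ c : ℝ, 0 < c ∧ ∀ (q : ℕ) [NeZero q] (χ : DirichletCharacter ℂ q), χ ^ 2 = 1 → χ ≠ 1 →
      c * (q : ℝ) ^ (-ε) ≤ ‖χ.LFunction 1‖ := by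
  set δ := min ε 1 with hδ
  have hδ0 : 0 < δ := lt_min hε one_pos
  have hδ1 : δ ≤ 1 := min_le_right _ _
  have hη : δ / 6 ≤ 1 / 2 := by linarith
  have finish : ∀ β : ℝ, 1 - δ / 24 ≤ β → (∃ c : ℝ, 0 < c ∧ ∀ (q : ℕ) [NeZero q]
      (χ : DirichletCharacter ℂ q), χ ^ 2 = 1 → χ ≠ 1 →
      c * (q : ℝ) ^ (-(3 * (δ / 6) + 12 * (1 - β))) ≤ ‖χ.LFunction 1‖) →
      ∃ c : ℝ, 0 < c ∧ ∀ (q : ℕ) [NeZero q] (χ : DirichletCharacter ℂ q), χ ^ 2 = 1 → χ ≠ 1 →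
      c * (q : ℝ) ^ (-ε) ≤ ‖χ.LFunction 1‖ := by
    rintro β hβ ⟨c, hc, h⟩
    refine ⟨c, hc, fun q _ χ h1 h2 => le_trans ?_ (h q χ h1 h2)⟩
    have hq : (1 : ℝ) ≤ q := by exact_mod_cast Nat.pos_of_ne_zero (NeZero.ne q)
    have : δ ≤ ε := min_le_left _ _
    gcongr
    linarith
  by_cases hA : ∃ (q : ℕ) (_ : NeZero q) (χ : DirichletCharacter ℂ q) (β : ℝ), χ ^ 2 = 1 ∧ χ ≠ 1 ∧
      1 - δ / 24 ≤ β ∧ β < 1 ∧ χ.LFunction β = 0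
  · obtain ⟨q₁, _, χ₁, β, h1, n1, hβ, hβ1, hz⟩ := hA
    exact finish β hβ (siegel_of_exceptional h1 n1 (by linarith) hβ1 (Or.inl hz)
      (by positivity) hη)
  · push Not at hA
    by_cases hB : ∃ (q : ℕ) (_ : NeZero q) (χ : DirichletCharacter ℂ q), χ ^ 2 = 1 ∧ χ ≠ 1
    · obtain ⟨q₁, _, χ₁, h1, n1⟩ := hB
      exact finish (1 - δ / 24) le_rfl (siegel_of_exceptional h1 n1 (by linarith) (by linarith)
        (Or.inr fun q _ χ h2 n2 => LFunction_re_pos h2 n2 fun σ hσ hσ1 =>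
          hA q inferInstance χ σ h2 n2 hσ hσ1) (by positivity) hη)
    · push Not at hB
      exact ⟨1, one_pos, fun q _ χ h2 n2 => absurd (hB q inferInstance χ h2) n2⟩

end Siegel

section LogDerivative

open Complex Metric

lemma diffContOnCl_ball {f : ℂ → ℂ} {s : ℂ} {r : ℝ} (h : DifferentiableOn ℂ f (closedBall s r)) :
    DiffContOnCl ℂ f (ball s r) :=
  (h.mono closure_ball_subset_closedBall).diffContOnCl

lemma norm_add_sub_le {f : ℂ → ℂ} {s y : ℂ} {η B : ℝ} (hη : 0 < η)
    (hd : ∀ x : ℝ, 0 ≤ x → x ≤ 1 → DifferentiableOn ℂ f (closedBall (s + x * y) η))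
    (hB : ∀ x : ℝ, 0 ≤ x → x ≤ 1 → ∀ z ∈ closedBall (s + x * y) η, ‖f z‖ ≤ B) :
    ‖f (s + y) - f s‖ ≤ B / η * ‖y‖ := by
  have key : ∀ z ∈ segment ℝ s (s + y), ∃ x : ℝ, 0 ≤ x ∧ x ≤ 1 ∧ z = s + x * y := by
    intro z hz
    rw [segment_eq_image'] at hz
    obtain ⟨θ, ⟨h0, h1⟩, rfl⟩ := hz
    exact ⟨θ, h0, h1, by simp⟩
  have := Convex.norm_image_sub_le_of_norm_deriv_le (f := f) (C := B / η) (x := s) (y := s + y)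
    (s := segment ℝ s (s + y)) ?_ ?_ (convex_segment _ _) (left_mem_segment ..)
    (right_mem_segment ..)
  · simpa using this
  · intro z hz
    obtain ⟨x, h0, h1, rfl⟩ := key z hz
    exact (hd x h0 h1).differentiableAt (closedBall_mem_nhds _ hη)
  · intro z hz
    obtain ⟨x, h0, h1, rfl⟩ := key z hz
    exact norm_deriv_le_of_forall_mem_sphere_norm_le hη (diffContOnCl_ball (hd x h0 h1))
      fun z hz => hB x h0 h1 z (sphere_subset_closedBall hz)

lemma lower_bound_of_three_four_one {f : ℂ → ℂ} {s : ℂ} {X : ℝ} (hX : 1 ≤ X) (hs : 1 < s.re)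
    (h1 : ∀ y : ℝ, 0 ≤ y → s.re + y ≤ 2 → ‖f (s + y) - f s‖ ≤ X * y)
    (h2 : ∀ y : ℝ, 0 ≤ y → s.re + y ≤ 2 → (s.re + y - 1) ^ 3 ≤ (X * ‖f (s + y)‖) ^ 4)
    (hs2 : s.re ≤ 2) : 1 / (16 * X ^ 7) ≤ ‖f s‖ := by
  set u : ℝ := 1 / (2 * X ^ 2) with hu
  have hX0 : 0 < X := by linarith
  have hu0 : 0 < u := by positivity
  have hu1 : u ≤ 1 / 2 := by
    rw [hu]; apply one_div_le_one_div_of_le (by norm_num); nlinarith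
  have hθ : u ^ 4 ≤ 1 := pow_le_one₀ hu0.le (by linarith)
  have step : ∀ y : ℝ, 0 ≤ y → s.re + y ≤ 2 → u ^ 4 ≤ s.re + y - 1 →
      u ^ 3 / X ≤ ‖f (s + y)‖ := by
    intro y hy hy2 h
    have h3 : (u ^ 3) ^ 4 ≤ (X * ‖f (s + y)‖) ^ 4 :=
      calc (u ^ 3) ^ 4 = (u ^ 4) ^ 3 := by ring
        _ ≤ (s.re + y - 1) ^ 3 := by gcongr
        _ ≤ _ := h2 y hy hy2
    have h4 := (pow_le_pow_iff_left₀ (by positivity) (by positivity) (by norm_num)).mp h3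
    rw [div_le_iff₀ hX0]; linarith
  have e : u ^ 3 / X - X * u ^ 4 = 1 / (16 * X ^ 7) := by
    rw [hu]; field_simp; norm_num
  rcases le_or_gt (u ^ 4) (s.re - 1) with h | h
  · have := step 0 le_rfl (by linarith) (by linarith)
    rw [ofReal_zero, add_zero] at this
    have : 0 ≤ X * u ^ 4 := by positivity
    linarith
  · have h5 := step (u ^ 4 - (s.re - 1)) (by linarith) (by linarith) (by linarith)
    have h6 := h1 (u ^ 4 - (s.re - 1)) (by linarith) (by linarith)
    have h7 := norm_sub_norm_le (f (s + (u ^ 4 - (s.re - 1) : ℝ))) (f s)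
    have h8 : X * (u ^ 4 - (s.re - 1)) ≤ X * u ^ 4 := by gcongr; linarith
    linarith

/-- The logarithmic derivative of a bounded function is controlled near a point where the
function is not small. -/
lemma logDeriv_bound_of_bound {f : ℂ → ℂ} {s : ℂ} {η B δ : ℝ} (hη : 0 < η) (hδ : 0 < δ)
    (hd : DifferentiableOn ℂ f (closedBall s η)) (hB : ∀ z ∈ closedBall s η, ‖f z‖ ≤ B)
    (hs : δ ≤ ‖f s‖) :
    ∀ z ∈ closedBall s (η * δ / (4 * B)), f z ≠ 0 ∧ z ∈ closedBall s (η / 4) ∧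
      ‖deriv f z / f z‖ ≤ 4 * B / (η * δ) := by
  have hδB : δ ≤ B := hs.trans (hB s (mem_closedBall_self hη.le))
  have hB0 : 0 < B := by linarith
  have hr : η * δ / (4 * B) ≤ η / 4 := by
    rw [div_le_div_iff₀ (by positivity) (by norm_num)]
    nlinarith
  have hsub : ∀ z ∈ closedBall s (η / 4), closedBall z (η / 2) ⊆ closedBall s η := by
    intro z hz
    apply closedBall_subset_closedBall'
    rw [mem_closedBall] at hz
    linarith
  have hder : ∀ z ∈ closedBall s (η / 4), ‖deriv f z‖ ≤ B / (η / 2) := fun z hz =>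
    norm_deriv_le_of_forall_mem_sphere_norm_le (by positivity)
      (diffContOnCl_ball (hd.mono (hsub z hz)))
      fun w hw => hB w (hsub z hz (sphere_subset_closedBall hw))
  intro z hz
  have hz4 : z ∈ closedBall s (η / 4) := closedBall_subset_closedBall hr hz
  have hlip := Convex.norm_image_sub_le_of_norm_deriv_le (f := f) (C := B / (η / 2)) (x := s)
    (y := z) (s := closedBall s (η / 4))
    (fun w hw => hd.differentiableAt (Filter.mem_of_superset (closedBall_mem_nhds w
      (show 0 < η / 2 by positivity)) (hsub w hw))) hder (convex_closedBall _ _)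
    (mem_closedBall_self (by positivity)) hz4
  have hdist : ‖z - s‖ ≤ η * δ / (4 * B) := by rwa [mem_closedBall, dist_eq] at hz
  have h1 : B / (η / 2) * ‖z - s‖ ≤ δ / 2 := by
    calc _ ≤ B / (η / 2) * (η * δ / (4 * B)) := by gcongr
      _ = δ / 2 := by field_simp; norm_num
  have h2 : δ / 2 ≤ ‖f z‖ := by
    have := norm_sub_norm_le (f s) (f z)
    rw [norm_sub_rev] at this
    linarith
  refine ⟨fun h => by rw [h, norm_zero] at h2; linarith, hz4, ?_⟩
  rw [norm_div]
  calc _ ≤ B / (η / 2) / (δ / 2) := by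
        gcongr
        exact hder z hz4
    _ = _ := by field_simp; norm_num

end LogDerivative

section LowerBounds

open Complex Metric

variable {q : ℕ} [NeZero q] {χ : DirichletCharacter ℂ q}

lemma one_add_norm_rpow_le {η : ℝ} (h0 : 0 < η) (h1 : η ≤ 1 / 2) {s z : ℂ} {a : ℝ} (ha : 0 ≤ a)
    (hz : 1 + ‖z‖ ≤ 4 * (1 + ‖s‖)) : (a * (1 + ‖z‖)) ^ η ≤ 2 * (a * (1 + ‖s‖)) ^ η := by
  have h4 : (4 : ℝ) ^ η ≤ 2 := by
    calc (4 : ℝ) ^ η ≤ 4 ^ (1 / 2 : ℝ) := Real.rpow_le_rpow_of_exponent_le (by norm_num) h1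
      _ = 2 := by
        rw [← Real.sqrt_eq_rpow, show (4 : ℝ) = 2 ^ 2 by norm_num, Real.sqrt_sq (by norm_num)]
  calc (a * (1 + ‖z‖)) ^ η ≤ (4 * (a * (1 + ‖s‖))) ^ η := by
        apply Real.rpow_le_rpow (by positivity) _ h0.le
        nlinarith
    _ = 4 ^ η * (a * (1 + ‖s‖)) ^ η := Real.mul_rpow (by norm_num) (by positivity)
    _ ≤ _ := by gcongr

lemma three_four_one_of_bound {B X : ℝ} (hB : 1 ≤ B) (hX : 2 * B ≤ X) {s : ℂ} (hs : 1 < s.re)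
    (hs2 : s.re ≤ 2) (h0 : ‖(1 : DirichletCharacter ℂ q).LFunction s.re‖ ≤ B + 1 / (s.re - 1))
    (h2 : ‖(χ ^ 2).LFunction (s + s.im * I)‖ ≤ X) :
    (s.re - 1) ^ 3 ≤ (X * ‖χ.LFunction s‖) ^ 4 := by
  have hx : 0 < s.re - 1 := by linarith
  have := DirichletCharacter.norm_LFunction_product_ge_one χ hx s.im
  have e1 : (1 + ((s.re - 1 : ℝ) : ℂ)) = (s.re : ℂ) := by push_cast; ring
  have e2 : (s.re : ℂ) + I * s.im = s := by rw [mul_comm I]; exact re_add_im s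
  have e3 : (s.re : ℂ) + 2 * I * s.im = s + s.im * I := by linear_combination e2
  rw [e1, e2, e3, norm_mul, norm_mul, norm_pow, norm_pow] at this
  have h3 : ‖DirichletCharacter.LFunctionTrivChar q s.re‖ ≤ X / (s.re - 1) := by
    refine h0.trans ?_
    rw [le_div_iff₀ hx, add_mul, one_div_mul_cancel hx.ne']
    nlinarith
  have hX0 : 0 < X := by linarith
  have h4 : 1 ≤ (X / (s.re - 1)) ^ 3 * ‖χ.LFunction s‖ ^ 4 * X :=
    this.le.trans (by gcongr)
  rw [div_pow] at h4
  calc (s.re - 1) ^ 3 = (s.re - 1) ^ 3 * 1 := by ring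
    _ ≤ (s.re - 1) ^ 3 * (X ^ 3 / (s.re - 1) ^ 3 * ‖χ.LFunction s‖ ^ 4 * X) := by gcongr
    _ = _ := by field_simp


theorem le_norm_LFunction {η : ℝ} (h0 : 0 < η) (hη : η ≤ 1 / 2) :
    ∃ c : ℝ, 0 < c ∧ ∀ (q : ℕ) [NeZero q] (χ : DirichletCharacter ℂ q) (s : ℂ), χ ≠ 1 →
      1 < s.re → s.re ≤ 2 → c * (q * (1 + ‖s‖)) ^ (-(14 * η)) ≤ ‖χ.LFunction s‖ := by
  obtain ⟨cS, hcS, hsieg⟩ := siegel h0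
  set K := 2 * (2 / η + 20) with hK
  have hK0 : 0 < K := by positivity
  have hK1 : 1 ≤ K := by have : 0 < 2 / η := by positivity
                         linarith
  set D := K / η * (1 + 4 / cS) with hD
  have hD0 : 0 < D := by positivity
  refine ⟨min (1 / (16 * D ^ 7)) (cS / 2), lt_min (by positivity) (by positivity),
    fun q _ χ s hχ hs hs2 => ?_⟩
  have hq : (1 : ℝ) ≤ q := by exact_mod_cast Nat.pos_of_ne_zero (NeZero.ne q)
  set U := (q : ℝ) * (1 + ‖s‖) with hU
  have hqU : (q : ℝ) ≤ U := by rw [hU]; nlinarith [norm_nonneg s]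
  have hU1 : 1 ≤ U := by linarith
  have hUη : 1 ≤ U ^ η := Real.one_le_rpow hU1 h0.le
  set B := K * U ^ η with hB
  have hB1 : 1 ≤ B := one_le_mul_of_one_le_of_one_le hK1 hUη
  have hbd : ∀ ψ : DirichletCharacter ℂ q, ψ ≠ 1 → ∀ z : ℂ, 1 - η ≤ z.re →
      1 + ‖z‖ ≤ 4 * (1 + ‖s‖) → ‖ψ.LFunction z‖ ≤ B := by
    intro ψ hψ z hz hzs
    refine (norm_LFunction_le hψ h0 hη hz).trans ?_
    have := one_add_norm_rpow_le h0 hη (Nat.cast_nonneg q) hzs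
    calc _ ≤ (2 / η + 20) * (2 * U ^ η) := by gcongr
      _ = B := by rw [hB, hK]; ring
  have hbd1 : ∀ z : ℂ, 1 < z.re → 1 + ‖z‖ ≤ 4 * (1 + ‖s‖) →
      ‖(1 : DirichletCharacter ℂ q).LFunction z‖ ≤ B + 1 / ‖z - 1‖ := by
    intro z hz hzs
    refine (norm_LFunction_one_le hz h0 hη).trans ?_
    have := one_add_norm_rpow_le h0 hη (Nat.cast_nonneg q) hzs
    gcongr
    calc _ ≤ (2 / η + 20) * (2 * U ^ η) := by gcongr
      _ = B := by rw [hB, hK]; ring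
  set X := D * U ^ (2 * η) with hX
  have hU2 : U ^ η ≤ U ^ (2 * η) := Real.rpow_le_rpow_of_exponent_le hU1 (by linarith)
  have hcS4 : 0 < 4 / cS := by positivity
  have hBX : B / η ≤ X := by
    have : B / η = K / η * 1 * U ^ η := by rw [hB]; ring
    rw [this, hX, hD]
    gcongr
    linarith
  have hBη : 2 * B ≤ B / η := by
    rw [le_div_iff₀ h0]; nlinarith
  have hX1 : 1 ≤ X := by linarith
  have hd := DirichletCharacter.differentiable_LFunction hχ
  have hshift : ∀ y : ℝ, 0 ≤ y → s.re + y ≤ 2 → ‖s + y‖ ≤ ‖s‖ + 1 := by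
    intro y hy hy2
    refine (norm_add_le _ _).trans ?_
    rw [norm_real, Real.norm_of_nonneg hy]; linarith
  have main : (∀ y : ℝ, 0 ≤ y → s.re + y ≤ 2 →
      ‖(χ ^ 2).LFunction (s + y + s.im * I)‖ ≤ X) → 1 / (16 * X ^ 7) ≤ ‖χ.LFunction s‖ := by
    intro h2
    refine lower_bound_of_three_four_one hX1 hs (fun y hy hy2 => ?_) (fun y hy hy2 => ?_) hs2
    · have := norm_add_sub_le (f := χ.LFunction) (s := s) (y := y) (B := B) h0
        (fun x _ _ => hd.differentiableOn) (fun x hx hx1 z hz => ?_)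
      · rw [norm_real, Real.norm_of_nonneg hy] at this
        exact this.trans (by gcongr)
      · rw [mem_closedBall, dist_eq] at hz
        have hxy : x * y ≤ y := mul_le_of_le_one_left hy hx1
        have hxy0 : 0 ≤ x * y := by positivity
        apply hbd χ hχ
        · have h3 := (abs_le.mp ((abs_re_le_norm _).trans hz)).1
          simp at h3
          linarith
        · have h3 := norm_add_le (z - (s + x * y)) (s + (x * y : ℝ))
          have h4 := hshift (x * y) hxy0 (by linarith)
          push_cast at h3 h4
          rw [sub_add_cancel] at h3
          linarith [norm_nonneg s]
    · have h5 := hshift y hy hy2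
      have := three_four_one_of_bound (χ := χ) (s := s + y) (B := B) (X := X) hB1
        (by linarith) (by simp; linarith) (by simpa using hy2) ?_ (by simpa using h2 y hy hy2)
      · simpa using this
      · have h6 := abs_re_le_norm (s + y)
        rw [add_re, ofReal_re] at h6
        have h7 : ‖(((s + y).re : ℝ) : ℂ)‖ ≤ ‖s‖ + 1 := by
          rw [norm_real, add_re, ofReal_re]; exact h6.trans h5
        have := hbd1 ((s + y).re : ℝ) (by simp; linarith) (by linarith [norm_nonneg s])
        have e : ‖(((s + y).re : ℝ) : ℂ) - 1‖ = (s + y).re - 1 := by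
          rw [← ofReal_one, ← ofReal_sub, norm_real, Real.norm_of_nonneg]
          simp; linarith
        rwa [e] at this
  have hconv : 1 / (16 * D ^ 7) * U ^ (-(14 * η)) = 1 / (16 * X ^ 7) := by
    rw [hX, mul_pow D, ← Real.rpow_natCast (U ^ (2 * η)), ← Real.rpow_mul (by linarith),
      Real.rpow_neg (by linarith)]
    have : 2 * η * ((7 : ℕ) : ℝ) = 14 * η := by push_cast; ring
    rw [this]
    field_simp
  have hfar : (∀ y : ℝ, 0 ≤ y → s.re + y ≤ 2 →
      ‖(χ ^ 2).LFunction (s + y + s.im * I)‖ ≤ X) →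
      min (1 / (16 * D ^ 7)) (cS / 2) * U ^ (-(14 * η)) ≤ ‖χ.LFunction s‖ := by
    intro h
    refine le_trans ?_ (main h)
    rw [← hconv]
    gcongr
    exact min_le_left _ _
  have hz2 : ∀ y : ℝ, 0 ≤ y → s.re + y ≤ 2 → 1 + ‖s + y + s.im * I‖ ≤ 4 * (1 + ‖s‖) := by
    intro y hy hy2
    have h3 := norm_add_le (s + y) (s.im * I)
    rw [norm_mul, norm_I, mul_one, norm_real, Real.norm_eq_abs] at h3
    have := abs_im_le_norm s
    linarith [hshift y hy hy2, norm_nonneg s]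
  by_cases hχ2 : χ ^ 2 = 1
  swap
  · refine hfar fun y hy hy2 => (hbd _ hχ2 _ ?_ (hz2 y hy hy2)).trans (by linarith)
    simp; linarith
  have hL1 := hsieg q χ hχ2 hχ
  have hL1p : 0 < ‖χ.LFunction 1‖ := lt_of_lt_of_le (by positivity) hL1
  set Y := 4 * (B / η) / ‖χ.LFunction 1‖ with hY
  have hY0 : 0 < Y := by positivity
  have hYX : B + Y ≤ X := by
    have h3 : Y ≤ K / η * (4 / cS) * U ^ (2 * η) := by
      calc Y ≤ 4 * (B / η) / (cS * (q : ℝ) ^ (-η)) := by rw [hY]; gcongr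
        _ = K / η * (4 / cS) * (U ^ η * (q : ℝ) ^ η) := by
          rw [Real.rpow_neg (by linarith), hB]; field_simp
        _ ≤ K / η * (4 / cS) * (U ^ η * U ^ η) := by gcongr
        _ = _ := by rw [← Real.rpow_add (by linarith)]; ring_nf
    have h4 : B / η ≤ K / η * U ^ (2 * η) := by
      rw [hB, mul_div_right_comm]; gcongr
    rw [hX, hD]
    nlinarith
  by_cases hnear : s.re - 1 < 1 / Y ∧ |s.im| < 1 / Y
  swap
  · refine hfar fun y hy hy2 => ?_
    rw [hχ2]
    refine (hbd1 _ (by simp; linarith) (hz2 y hy hy2)).trans (le_trans ?_ hYX)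
    gcongr
    have h3 : 1 / Y ≤ ‖s + y + s.im * I - 1‖ := by
      by_cases h4 : s.re - 1 < 1 / Y
      · have h5 : 1 / Y ≤ |s.im| := not_lt.mp fun h => hnear ⟨h4, h⟩
        have h6 := abs_im_le_norm (s + y + s.im * I - 1)
        have h7 : (s + y + s.im * I - 1).im = 2 * s.im := by simp; ring
        rw [h7, abs_mul, abs_two] at h6
        linarith [abs_nonneg s.im]
      · have h6 := re_le_norm (s + y + s.im * I - 1)
        simp at h6
        have h7 := not_lt.mp h4
        rw [one_div] at h7 ⊢
        linarith
    exact (one_div_le (lt_of_lt_of_le (by positivity) h3) hY0).mpr h3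
  · have h3 : ‖s - 1‖ ≤ 2 * (1 / Y) := by
      refine (norm_le_abs_re_add_abs_im _).trans ?_
      have : |(s - 1).re| = s.re - 1 := by
        rw [sub_re, one_re, abs_of_pos (by linarith)]
      rw [this, sub_im, one_im, sub_zero]
      linarith [hnear.1, hnear.2]
    have h4 := norm_add_sub_le (f := χ.LFunction) (s := 1) (y := s - 1) (B := B) h0
        (fun x _ _ => hd.differentiableOn) (fun x hx hx1 z hz => ?_)
    · rw [add_sub_cancel] at h4
      have h5 : B / η * ‖s - 1‖ ≤ ‖χ.LFunction 1‖ / 2 := by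
        calc _ ≤ B / η * (2 * (1 / Y)) := by gcongr
          _ = _ := by rw [hY]; field_simp; norm_num
      have h6 := norm_sub_norm_le (χ.LFunction 1) (χ.LFunction s)
      rw [norm_sub_rev] at h6
      have h7 : U ^ (-(14 * η)) ≤ (q : ℝ) ^ (-η) := by
        calc U ^ (-(14 * η)) ≤ U ^ (-η) := Real.rpow_le_rpow_of_exponent_le hU1 (by linarith)
          _ ≤ _ := Real.rpow_le_rpow_of_nonpos (by linarith) hqU (by linarith)
      calc _ ≤ cS / 2 * (q : ℝ) ^ (-η) := by
            gcongr
            exact min_le_right _ _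
        _ ≤ _ := by linarith
    · rw [mem_closedBall, dist_eq] at hz
      apply hbd χ hχ
      · have h3 := (abs_le.mp ((abs_re_le_norm _).trans hz)).1
        simp at h3
        nlinarith
      · have h3 := norm_add_le (z - (1 + x * (s - 1))) ((1 - x : ℝ) + x * s)
        have e : z - (1 + x * (s - 1)) + ((1 - x : ℝ) + x * s) = z := by push_cast; ring
        rw [e] at h3
        have h5 := norm_add_le ((1 - x : ℝ) : ℂ) (x * s)
        rw [norm_real, norm_mul, norm_real, Real.norm_of_nonneg hx,
          Real.norm_of_nonneg (by linarith)] at h5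
        have : x * ‖s‖ ≤ ‖s‖ := mul_le_of_le_one_left (norm_nonneg _) hx1
        linarith [norm_nonneg s]

/-- Derivatives of the logarithmic derivative of an `L`-function to the right of the line
`Re s = 1`. -/
theorem norm_iteratedDeriv_logDeriv_LFunction_le (k : ℕ) :
    ∃ C : ℝ, 0 < C ∧ ∀ (q : ℕ) [NeZero q] (χ : DirichletCharacter ℂ q) (s : ℂ), χ ≠ 1 →
      1 < s.re → s.re ≤ 2 →
      ‖iteratedDeriv k (fun z => deriv χ.LFunction z / χ.LFunction z) s‖ ≤
        C * (q * (1 + ‖s‖)) ^ (1 / 2 : ℝ) := by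
  set η : ℝ := 1 / (30 * (k + 1)) with hη
  have h0 : 0 < η := by positivity
  have h1 : η ≤ 1 / 2 := by
    rw [hη]; apply one_div_le_one_div_of_le (by norm_num)
    have : (0 : ℝ) ≤ k := Nat.cast_nonneg k
    linarith
  obtain ⟨c, hc, hlow⟩ := le_norm_LFunction h0 h1
  set K := 2 * (2 / η + 20) with hK
  have hK0 : 0 < K := by positivity
  refine ⟨k.factorial * (4 * K / (η * c)) ^ (k + 1), by positivity, fun q _ χ s hχ hs hs2 => ?_⟩
  have hq : (1 : ℝ) ≤ q := by exact_mod_cast Nat.pos_of_ne_zero (NeZero.ne q)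
  have hd := DirichletCharacter.differentiable_LFunction hχ
  have hl := hlow q χ s hχ hs hs2
  set U := (q : ℝ) * (1 + ‖s‖) with hU
  have hU1 : 1 ≤ U := by rw [hU]; nlinarith [norm_nonneg s]
  set B := K * U ^ η with hB
  have hB0 : 0 < B := by positivity
  set δ := c * U ^ (-(14 * η)) with hδ
  have hδ0 : 0 < δ := by positivity
  have hbd : ∀ z ∈ closedBall s η, ‖χ.LFunction z‖ ≤ B := by
    intro z hz
    rw [mem_closedBall, dist_eq] at hz
    have hre := (abs_le.mp ((abs_re_le_norm _).trans hz)).1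
    rw [sub_re] at hre
    have hn := norm_add_le (z - s) s
    rw [sub_add_cancel] at hn
    refine (norm_LFunction_le hχ h0 h1 (by linarith)).trans ?_
    have := one_add_norm_rpow_le h0 h1 (Nat.cast_nonneg q) (s := s) (z := z)
      (by linarith [norm_nonneg s])
    calc _ ≤ (2 / η + 20) * (2 * U ^ η) := by gcongr
      _ = B := by rw [hB, hK]; ring
  have key := logDeriv_bound_of_bound h0 hδ0 hd.differentiableOn hbd hl
  have hr : 0 < η * δ / (4 * B) := by positivity
  have := norm_iteratedDeriv_le_of_forall_mem_sphere_norm_le (c := s)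
    (f := fun z => deriv χ.LFunction z / χ.LFunction z) k hr
    (diffContOnCl_ball (DifferentiableOn.div hd.deriv.differentiableOn hd.differentiableOn
      fun z hz => (key z hz).1)) (fun z hz => (key z (sphere_subset_closedBall hz)).2.2)
  refine this.trans (le_of_eq ?_)
  have e1 : 4 * B / (η * δ) = 4 * K / (η * c) * U ^ (15 * η) := by
    rw [hB, hδ, Real.rpow_neg (by linarith)]
    have : U ^ (15 * η) = U ^ η * U ^ (14 * η) := by
      rw [← Real.rpow_add (by linarith)]; ring_nf
    rw [this]
    field_simp
  have e2 : k.factorial * (4 * B / (η * δ)) / (η * δ / (4 * B)) ^ k =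
      k.factorial * (4 * B / (η * δ)) ^ (k + 1) := by
    rw [pow_succ, ← one_div_div (η * δ) (4 * B), one_div_pow]
    field_simp
  have e3 : 15 * η * ((k + 1 : ℕ) : ℝ) = 1 / 2 := by
    rw [hη]; push_cast; field_simp; norm_num
  rw [e2, e1, mul_pow _ (U ^ (15 * η)), ← Real.rpow_natCast (U ^ (15 * η)),
    ← Real.rpow_mul (by linarith), e3, mul_assoc]

end LowerBounds

section Zeta

open Complex Metric

lemma norm_riemannZeta_le_of_far {η : ℝ} (h0 : 0 < η) (h1 : η ≤ 1 / 2) {s z : ℂ}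
    (hz : 1 - η ≤ z.re) (hz1 : 1 / 2 ≤ ‖z - 1‖) (hzs : 1 + ‖z‖ ≤ 4 * (1 + ‖s‖)) :
    ‖riemannZeta z‖ ≤ 2 * (2 / η + 24) * (1 + ‖s‖) ^ η := by
  have hne : z ≠ 1 := fun h => by simp [h] at hz1; linarith
  refine (norm_riemannZeta_le h0 h1 hz hne).trans ?_
  have := one_add_norm_rpow_le h0 h1 zero_le_one hzs
  simp only [one_mul] at this
  have h2 : 2 * (1 + ‖z‖) ^ η / ‖z - 1‖ ≤ 4 * (1 + ‖z‖) ^ η := by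
    rw [div_le_iff₀ (by linarith)]
    have : 0 ≤ (1 + ‖z‖) ^ η := by positivity
    nlinarith
  have h3 : 0 < 2 / η := by positivity
  calc _ ≤ (2 / η + 20) * (1 + ‖z‖) ^ η + 4 * (1 + ‖z‖) ^ η := by gcongr
    _ = (2 / η + 24) * (1 + ‖z‖) ^ η := by ring
    _ ≤ (2 / η + 24) * (2 * (1 + ‖s‖) ^ η) := by gcongr
    _ = _ := by ring

lemma le_norm_riemannZeta {η : ℝ} (h0 : 0 < η) (hη : η ≤ 1 / 2) :
    ∃ c : ℝ, 0 < c ∧ ∀ s : ℂ, 1 < s.re → s.re ≤ 2 → 1 ≤ |s.im| →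
      c * (1 + ‖s‖) ^ (-(7 * η)) ≤ ‖riemannZeta s‖ := by
  set K := 2 * (2 / η + 24) with hK
  have hK0 : 0 < K := by positivity
  have hK1 : 1 ≤ K := by have : 0 < 2 / η := by positivity
                         linarith
  set D := K / η with hD
  have hD0 : 0 < D := by positivity
  refine ⟨1 / (16 * D ^ 7), by positivity, fun s hs hs2 ht => ?_⟩
  set U := 1 + ‖s‖ with hU
  have hU1 : 1 ≤ U := by linarith [norm_nonneg s]
  have hUη : 1 ≤ U ^ η := Real.one_le_rpow hU1 h0.le
  set B := K * U ^ η with hB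
  have hB1 : 1 ≤ B := one_le_mul_of_one_le_of_one_le hK1 hUη
  set X := D * U ^ η with hX
  have hBX : B / η = X := by rw [hB, hX, hD]; ring
  have hBη : 2 * B ≤ X := by
    rw [← hBX, le_div_iff₀ h0]; nlinarith
  have hX1 : 1 ≤ X := by linarith
  have him : ∀ z : ℂ, 1 / 2 ≤ |z.im| → 1 / 2 ≤ ‖z - 1‖ := fun z hz => by
    have := abs_im_le_norm (z - 1)
    simp at this
    linarith
  have hshift : ∀ y : ℝ, 0 ≤ y → s.re + y ≤ 2 → ‖s + y‖ ≤ ‖s‖ + 1 := by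
    intro y hy hy2
    refine (norm_add_le _ _).trans ?_
    rw [norm_real, Real.norm_of_nonneg hy]; linarith
  have main : 1 / (16 * X ^ 7) ≤ ‖riemannZeta s‖ := by
    refine lower_bound_of_three_four_one hX1 hs (fun y hy hy2 => ?_) (fun y hy hy2 => ?_) hs2
    · have hball : ∀ x : ℝ, 0 ≤ x → x ≤ 1 → ∀ z ∈ closedBall (s + x * (y : ℂ)) η,
          1 - η ≤ z.re ∧ 1 / 2 ≤ ‖z - 1‖ ∧ 1 + ‖z‖ ≤ 4 * (1 + ‖s‖) := by
        intro x hx hx1 z hz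
        rw [mem_closedBall, dist_eq] at hz
        have hxy : x * y ≤ y := mul_le_of_le_one_left hy hx1
        have hxy0 : 0 ≤ x * y := by positivity
        refine ⟨?_, him z ?_, ?_⟩
        · have h3 := (abs_le.mp ((abs_re_le_norm _).trans hz)).1
          simp at h3
          linarith
        · have h3 := (abs_im_le_norm _).trans hz
          simp at h3
          have := abs_sub_abs_le_abs_sub s.im z.im
          rw [abs_sub_comm] at this
          linarith
        · have h3 := norm_add_le (z - (s + x * y)) (s + (x * y : ℝ))
          have h4 := hshift (x * y) hxy0 (by linarith)
          push_cast at h3 h4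
          rw [sub_add_cancel] at h3
          linarith [norm_nonneg s]
      have := norm_add_sub_le (f := riemannZeta) (s := s) (y := y) (B := B) h0
        (fun x hx hx1 z hz => (differentiableAt_riemannZeta fun h => by
          have := (hball x hx hx1 z hz).2.1
          simp [h] at this
          linarith).differentiableWithinAt) (fun x hx hx1 z hz => ?_)
      · rw [norm_real, Real.norm_of_nonneg hy, hBX] at this
        exact this
      · obtain ⟨h3, h4, h5⟩ := hball x hx hx1 z hz
        exact norm_riemannZeta_le_of_far h0 hη h3 h4 h5
    · have h5 := hshift y hy hy2
      have := three_four_one_of_bound (q := 1) (χ := 1) (s := s + y) (B := B) (X := X) hB1 hBη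
        (by simp; linarith) (by simpa using hy2) ?_ ?_
      · simpa [DirichletCharacter.LFunction_modOne_eq] using this
      · have h6 := abs_re_le_norm (s + y)
        rw [add_re, ofReal_re] at h6
        have h7 : ‖(((s + y).re : ℝ) : ℂ)‖ ≤ ‖s‖ + 1 := by
          rw [norm_real, add_re, ofReal_re]; exact h6.trans h5
        refine (norm_LFunction_one_le (s := ((s + y).re : ℝ)) (by simp; linarith) h0 hη).trans ?_
        have e : ‖(((s + y).re : ℝ) : ℂ) - 1‖ = (s + y).re - 1 := by
          rw [← ofReal_one, ← ofReal_sub, norm_real, Real.norm_of_nonneg]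
          simp; linarith
        rw [e]
        gcongr
        have := one_add_norm_rpow_le h0 hη zero_le_one (s := s) (z := ((s + y).re : ℝ))
          (by linarith [norm_nonneg s])
        rw [one_mul (1 + ‖s‖)] at this
        rw [Nat.cast_one]
        calc _ ≤ (2 / η + 20) * (2 * U ^ η) := by gcongr
          _ ≤ (2 / η + 24) * (2 * U ^ η) := by gcongr; norm_num
          _ = B := by rw [hB, hK]; ring
      · rw [one_pow, DirichletCharacter.LFunction_modOne_eq]
        refine (norm_riemannZeta_le_of_far (s := s) h0 hη ?_ (him _ ?_) ?_).trans ?_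
        · simp; linarith
        · have : (s + y + ((s + y).im : ℂ) * I).im = 2 * s.im := by simp; ring
          rw [this, abs_mul, abs_two]; linarith
        · have h3 := norm_add_le (s + y) (((s + y).im : ℂ) * I)
          rw [norm_mul, norm_I, mul_one, norm_real, Real.norm_eq_abs] at h3
          have := abs_im_le_norm (s + y)
          linarith [norm_nonneg s]
        · change B ≤ X
          linarith
  refine le_trans (le_of_eq ?_) main
  rw [hX, mul_pow D, ← Real.rpow_natCast (U ^ η), ← Real.rpow_mul (by linarith),
      Real.rpow_neg (by linarith)]
  have : η * ((7 : ℕ) : ℝ) = 7 * η := by push_cast; ring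
  rw [this]
  field_simp

lemma norm_iteratedDeriv_logDeriv_zeta_le_of_far (k : ℕ) :
    ∃ C : ℝ, 0 < C ∧ ∀ s : ℂ, 1 < s.re → s.re ≤ 2 → 1 ≤ |s.im| →
      ‖iteratedDeriv k (fun z => -(deriv riemannZeta z / riemannZeta z) - riemannZeta z) s‖ ≤
        C * (1 + ‖s‖) ^ (1 / 2 : ℝ) := by
  set η : ℝ := 1 / (16 * (k + 1)) with hη
  have h0 : 0 < η := by positivity
  have h1 : η ≤ 1 / 2 := by
    rw [hη]; apply one_div_le_one_div_of_le (by norm_num)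
    have : (0 : ℝ) ≤ k := Nat.cast_nonneg k
    linarith
  obtain ⟨c, hc, hlow⟩ := le_norm_riemannZeta h0 h1
  set K := 2 * (2 / η + 24) with hK
  have hK0 : 0 < K := by positivity
  set W := 4 * K / (η * c) with hW
  have hW0 : 0 < W := by positivity
  refine ⟨k.factorial * ((W + K) * W ^ k), by positivity, fun s hs hs2 ht => ?_⟩
  have hl := hlow s hs hs2 ht
  set U := 1 + ‖s‖ with hU
  have hU1 : 1 ≤ U := by linarith [norm_nonneg s]
  set B := K * U ^ η with hB
  have hB0 : 0 < B := by positivity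
  set δ := c * U ^ (-(7 * η)) with hδ
  have hδ0 : 0 < δ := by positivity
  have hball : ∀ z ∈ closedBall s η,
      1 - η ≤ z.re ∧ 1 / 2 ≤ ‖z - 1‖ ∧ 1 + ‖z‖ ≤ 4 * (1 + ‖s‖) := by
    intro z hz
    rw [mem_closedBall, dist_eq] at hz
    have hre := (abs_le.mp ((abs_re_le_norm _).trans hz)).1
    rw [sub_re] at hre
    have hn := norm_add_le (z - s) s
    rw [sub_add_cancel] at hn
    refine ⟨by linarith, ?_, by linarith [norm_nonneg s]⟩
    have h3 := (abs_im_le_norm _).trans hz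
    rw [sub_im, abs_sub_comm] at h3
    have h4 := abs_sub_abs_le_abs_sub s.im z.im
    have h5 := abs_im_le_norm (z - 1)
    simp at h5
    linarith
  have hbd : ∀ z ∈ closedBall s η, ‖riemannZeta z‖ ≤ B := fun z hz =>
    norm_riemannZeta_le_of_far h0 h1 (hball z hz).1 (hball z hz).2.1 (hball z hz).2.2
  have hne : ∀ z ∈ closedBall s η, z ≠ 1 := fun z hz h => by
    have := (hball z hz).2.1
    simp [h] at this
    linarith
  have hd : DifferentiableOn ℂ riemannZeta (closedBall s η) := fun z hz =>
    (differentiableAt_riemannZeta (hne z hz)).differentiableWithinAt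
  have hd' : DifferentiableOn ℂ (deriv riemannZeta) (closedBall s η) := by
    have : DifferentiableOn ℂ riemannZeta {1}ᶜ := fun z hz =>
      (differentiableAt_riemannZeta hz).differentiableWithinAt
    exact (this.deriv isOpen_compl_singleton).mono hne
  have key := logDeriv_bound_of_bound h0 hδ0 hd hbd hl
  have hr : 0 < η * δ / (4 * B) := by positivity
  have hsub : closedBall s (η * δ / (4 * B)) ⊆ closedBall s η := fun z hz =>
    closedBall_subset_closedBall (by linarith) (key z hz).2.1
  have e1 : 4 * B / (η * δ) = W * U ^ (8 * η) := by
    rw [hB, hδ, hW, Real.rpow_neg (by linarith)]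
    have : U ^ (8 * η) = U ^ η * U ^ (7 * η) := by
      rw [← Real.rpow_add (by linarith)]; ring_nf
    rw [this]
    field_simp
  have := norm_iteratedDeriv_le_of_forall_mem_sphere_norm_le (c := s) (C := (W + K) * U ^ (8 * η))
    (f := fun z => -(deriv riemannZeta z / riemannZeta z) - riemannZeta z) k hr
    (diffContOnCl_ball (((hd'.mono hsub).div (hd.mono hsub)
      fun z hz => (key z hz).1).neg.sub (hd.mono hsub))) (fun z hz => by
      have hz' := sphere_subset_closedBall hz
      have h3 := (key z hz').2.2
      have h4 := hbd z (hsub hz')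
      refine (norm_sub_le _ _).trans ?_
      rw [norm_neg, add_mul, ← e1]
      refine add_le_add h3 (h4.trans ?_)
      rw [hB]
      gcongr
      linarith)
  refine this.trans (le_of_eq ?_)
  have e2 : η * δ / (4 * B) = (W * U ^ (8 * η))⁻¹ := by rw [← e1, inv_div]
  have e3 : U ^ (1 / 2 : ℝ) = U ^ (8 * η) * (U ^ (8 * η)) ^ k := by
    rw [← pow_succ', ← Real.rpow_natCast, ← Real.rpow_mul (by linarith)]
    congr 1
    rw [hη]; push_cast; field_simp; norm_num
  rw [e2, e3, inv_pow, div_inv_eq_mul, mul_pow]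
  ring

lemma norm_iteratedDeriv_logDeriv_zeta_le_of_near (k : ℕ) :
    ∃ C : ℝ, 0 < C ∧ ∀ s : ℂ, 1 < s.re → s.re ≤ 2 → |s.im| ≤ 1 →
      ‖iteratedDeriv k (fun z => -(deriv riemannZeta z / riemannZeta z) - riemannZeta z) s‖ ≤ C := by
  set E := DirichletCharacter.LFunctionTrivChar₁ 1 with hE
  have hE1 : E 1 = 1 := by simp [hE, DirichletCharacter.LFunctionTrivChar₁]
  have hEs : ∀ s, s ≠ 1 → E s = (s - 1) * riemannZeta s := fun s hs => by
    simp only [hE, DirichletCharacter.LFunctionTrivChar₁, Function.update_of_ne hs,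
      DirichletCharacter.LFunctionTrivChar, DirichletCharacter.LFunction_modOne_eq]
  have hEd : Differentiable ℂ E := DirichletCharacter.differentiable_LFunctionTrivChar₁ 1
  have hE0 : ∀ s : ℂ, 1 ≤ s.re → E s ≠ 0 := by
    intro s hs
    rcases eq_or_ne s 1 with rfl | h
    · rw [hE1]; exact one_ne_zero
    · rw [hEs s h]
      exact mul_ne_zero (sub_ne_zero.mpr h) (riemannZeta_ne_zero_of_one_le_re hs)
  set G : ℂ → ℂ := fun z => -(deriv E z / E z) - dslope E 1 z with hG
  have hSd : Differentiable ℂ (dslope E 1) := by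
    rw [← differentiableOn_univ, Complex.differentiableOn_dslope Filter.univ_mem]
    exact hEd.differentiableOn
  have hO : IsOpen {z | E z ≠ 0} := isOpen_ne_fun hEd.continuous continuous_const
  have hGd : DifferentiableOn ℂ G {z | E z ≠ 0} :=
    ((hEd.deriv.differentiableOn.div hEd.differentiableOn fun z hz => hz).neg).sub
      hSd.differentiableOn
  have hGa : ContinuousOn (iteratedDeriv k G) {z | E z ≠ 0} := by
    rw [iteratedDeriv_eq_iterate]
    exact ((hGd.analyticOnNhd hO).iterated_deriv k).continuousOn
  have hcomp : IsCompact (Set.Icc (1 : ℝ) 2 ×ℂ Set.Icc (-1 : ℝ) 1) :=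
    isCompact_Icc.reProdIm isCompact_Icc
  obtain ⟨C, hC⟩ := hcomp.exists_bound_of_continuousOn
    (hGa.mono fun z hz => hE0 z (mem_reProdIm.mp hz).1.1)
  refine ⟨max C 1, by positivity, fun s hs hs2 ht => le_trans ?_
    ((hC s (mem_reProdIm.mpr ⟨⟨hs.le, hs2⟩, abs_le.mp ht⟩)).trans (le_max_left _ _))⟩
  apply le_of_eq
  congr 1
  apply Filter.EventuallyEq.iteratedDeriv_eq
  have hs1 : s ≠ 1 := fun h => by simp [h] at hs
  filter_upwards [hO.mem_nhds (hE0 s hs.le), isOpen_compl_singleton.mem_nhds hs1] with z hz hz1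
  have hz1' : z ≠ 1 := hz1
  have hz2 : z - 1 ≠ 0 := sub_ne_zero.mpr hz1'
  have hζ : riemannZeta z ≠ 0 := fun h => hz (by rw [hEs z hz1', h, mul_zero])
  have hd : deriv E z = (z - 1) * deriv riemannZeta z + riemannZeta z := by
    have : E =ᶠ[nhds z] fun w => (w - 1) * riemannZeta w := by
      filter_upwards [isOpen_compl_singleton.mem_nhds hz1] with w hw using hEs w hw
    rw [this.deriv_eq]
    have h2 := (((hasDerivAt_id z).sub_const 1).mul
      (differentiableAt_riemannZeta hz1').hasDerivAt).deriv
    simp only [id] at h2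
    rw [add_comm]
    simpa [Pi.mul_def] using h2
  rw [hG]
  simp only
  rw [dslope_of_ne _ hz1', slope_def_field, hE1, hd, hEs z hz1']
  field_simp
  ring

/-- Derivatives of `-ζ'/ζ - ζ` to the right of the line `Re s = 1`. -/
theorem norm_iteratedDeriv_logDeriv_zeta_le (k : ℕ) :
    ∃ C : ℝ, 0 < C ∧ ∀ s : ℂ, 1 < s.re → s.re ≤ 2 →
      ‖iteratedDeriv k (fun z => -(deriv riemannZeta z / riemannZeta z) - riemannZeta z) s‖ ≤
        C * (1 + ‖s‖) ^ (1 / 2 : ℝ) := by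
  obtain ⟨C₁, h1, hC₁⟩ := norm_iteratedDeriv_logDeriv_zeta_le_of_far k
  obtain ⟨C₂, h2, hC₂⟩ := norm_iteratedDeriv_logDeriv_zeta_le_of_near k
  refine ⟨max C₁ C₂, by positivity, fun s hs hs2 => ?_⟩
  have hU : 1 ≤ (1 + ‖s‖) ^ (1 / 2 : ℝ) :=
    Real.one_le_rpow (by linarith [norm_nonneg s]) (by norm_num)
  rcases le_total 1 |s.im| with h | h
  · exact (hC₁ s hs hs2 h).trans (by gcongr; exact le_max_left _ _)
  · refine (hC₂ s hs hs2 h).trans ?_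
    calc C₂ ≤ max C₁ C₂ * 1 := by rw [mul_one]; exact le_max_right _ _
      _ ≤ _ := by gcongr

end Zeta

section Perron

open Complex MeasureTheory

/-- The truncated linear weight `max (1 - u) 0` for `u > 0`. -/
noncomputable def rampWeight (u : ℝ) : ℂ :=
  (Set.Ioc (0 : ℝ) 1).indicator (fun _ => (1 : ℂ)) u -
    (Set.Ioc (0 : ℝ) 1).indicator (fun t => (t : ℂ) ^ (1 : ℂ)) u

lemma rampWeight_eq {u : ℝ} (hu : 0 < u) : rampWeight u = (max (1 - u) 0 : ℝ) := by
  unfold rampWeight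
  by_cases h : u ≤ 1
  · simp [Set.indicator, hu, h]
  · have : 1 - u ≤ 0 := by linarith
    simp [Set.indicator, hu, h, this]

lemma hasMellin_rampWeight {s : ℂ} (hs : 0 < s.re) :
    HasMellin rampWeight s (1 / (s * (s + 1))) := by
  have h1 := hasMellin_one_Ioc hs
  have h2 := hasMellin_cpow_Ioc 1 (s := s) (by simp; linarith)
  have h := hasMellin_sub h1.1 h2.1
  rw [h1.2, h2.2] at h
  have hs0 : s ≠ 0 := fun h => by simp [h] at hs
  have hs1 : s + 1 ≠ 0 := fun h => by
    have := congrArg re h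
    simp at this
    linarith
  have he : 1 / (s * (s + 1)) = 1 / s - 1 / (s + 1) := by
    field_simp
    ring
  rw [he]
  exact h

lemma norm_one_div_mul_le {σ : ℝ} (hσ : 1 ≤ σ) (t : ℝ) :
    ‖1 / ((σ + t * I) * (σ + t * I + 1))‖ * (1 + ‖(σ + t * I : ℂ)‖) ^ (1 / 2 : ℝ) ≤
      2 * (1 + ‖t‖ ^ 2) ^ (-(3 / 2 : ℝ) / 2) := by
  set s : ℂ := σ + t * I with hs
  have hre : s.re = σ := by simp [hs]
  have him : s.im = t := by simp [hs]
  have h1 : 1 ≤ ‖s‖ := by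
    have := re_le_norm s
    linarith
  have h2 : ‖s‖ ≤ ‖s + 1‖ := by
    rw [Complex.norm_eq_sqrt_sq_add_sq, Complex.norm_eq_sqrt_sq_add_sq]
    apply Real.sqrt_le_sqrt
    simp [hre, him]
    linarith
  have h3 : 1 + ‖t‖ ^ 2 ≤ ‖s‖ ^ 2 := by
    rw [Complex.sq_norm, normSq_apply, hre, him, Real.norm_eq_abs, sq_abs]
    nlinarith
  have hs0 : 0 < ‖s‖ := by linarith
  rw [norm_div, norm_one, norm_mul]
  calc 1 / (‖s‖ * ‖s + 1‖) * (1 + ‖s‖) ^ (1 / 2 : ℝ)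
      ≤ 1 / (‖s‖ * ‖s‖) * (2 * ‖s‖ ^ (1 / 2 : ℝ)) := by
        gcongr
        calc (1 + ‖s‖) ^ (1 / 2 : ℝ) ≤ (4 * ‖s‖) ^ (1 / 2 : ℝ) := by gcongr; linarith
          _ = 4 ^ (1 / 2 : ℝ) * ‖s‖ ^ (1 / 2 : ℝ) := Real.mul_rpow (by norm_num) hs0.le
          _ = _ := by
            rw [← Real.sqrt_eq_rpow, show (4 : ℝ) = 2 ^ 2 by norm_num, Real.sqrt_sq (by norm_num)]
    _ = 2 * (‖s‖ ^ 2) ^ (-(3 / 2 : ℝ) / 2) := by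
        rw [← Real.rpow_natCast, ← Real.rpow_mul hs0.le]
        have : ((2 : ℕ) : ℝ) * (-(3 / 2) / 2) = 1 / 2 - 2 := by norm_num
        rw [this, Real.rpow_sub hs0, Real.rpow_two]
        field_simp
    _ ≤ _ := by
        gcongr 2 * ?_
        exact Real.rpow_le_rpow_of_nonpos (by positivity) h3 (by norm_num)

lemma integrable_majorant : Integrable fun t : ℝ => 2 * (1 + ‖t‖ ^ 2) ^ (-(3 / 2 : ℝ) / 2) :=
  (integrable_rpow_neg_one_add_norm_sq (by norm_num)).const_mul 2

lemma integrable_one_div_mul {σ : ℝ} (hσ : 1 ≤ σ) :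
    Integrable fun t : ℝ => 1 / (((σ : ℂ) + t * I) * (σ + t * I + 1)) := by
  refine integrable_majorant.mono' (Continuous.aestronglyMeasurable ?_) (ae_of_all _ fun t => ?_)
  · refine continuous_const.div (by fun_prop) fun t => mul_ne_zero ?_ ?_
    · intro h
      have := congrArg re h
      simp at this
      linarith
    · intro h
      have := congrArg re h
      simp at this
      linarith
  · refine le_trans ?_ (norm_one_div_mul_le hσ t)
    exact le_mul_of_one_le_right (norm_nonneg _)
      (Real.one_le_rpow (by linarith [norm_nonneg ((σ : ℂ) + t * I)]) (by norm_num))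

lemma rampWeight_eq_integral {σ : ℝ} (hσ : 1 ≤ σ) {u : ℝ} (hu : 0 < u) :
    ∫ t : ℝ, (u : ℂ) ^ (-(σ + t * I) : ℂ) * (1 / ((σ + t * I) * (σ + t * I + 1))) =
      2 * Real.pi * rampWeight u := by
  have hm : ∀ t : ℝ, mellin rampWeight (σ + t * I) = 1 / ((σ + t * I) * (σ + t * I + 1)) :=
    fun t => (hasMellin_rampWeight (by simp; linarith)).2
  have hcont : ContinuousAt rampWeight u := by
    have h1 : Continuous fun u : ℝ => ((max (1 - u) 0 : ℝ) : ℂ) := by fun_prop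
    refine h1.continuousAt.congr ?_
    filter_upwards [lt_mem_nhds hu] with v hv using (rampWeight_eq hv).symm
  have := mellinInv_mellin_eq σ rampWeight hu
    (hasMellin_rampWeight (by simp; linarith)).1 (by
      unfold VerticalIntegrable
      simp_rw [hm]
      exact integrable_one_div_mul hσ) hcont
  unfold mellinInv at this
  simp_rw [hm, smul_eq_mul] at this
  have hpi : (Real.pi : ℂ) ≠ 0 := by exact_mod_cast Real.pi_ne_zero
  rw [← this, real_smul]
  push_cast
  rw [← mul_assoc, mul_one_div_cancel (mul_ne_zero two_ne_zero hpi), one_mul]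

lemma norm_sum_mul_sub_le {b : ℕ → ℂ} {σ M : ℝ} (hσ : 1 ≤ σ) (hM : 0 ≤ M)
    (hb : LSeriesSummable b σ)
    (hF : ∀ t : ℝ, ‖LSeries b (σ + t * I)‖ ≤ M * (1 + ‖(σ + t * I : ℂ)‖) ^ (1 / 2 : ℝ))
    {N : ℕ} (hN : 1 ≤ N) :
    ‖∑ n ∈ Icc 1 N, b n * (N - n)‖ ≤
      M * (∫ t : ℝ, 2 * (1 + ‖t‖ ^ 2) ^ (-(3 / 2 : ℝ) / 2)) * (N : ℝ) ^ (σ + 1) := by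
  have hN0 : (0 : ℝ) < N := by exact_mod_cast hN
  have hNc : (N : ℂ) ≠ 0 := by exact_mod_cast hN0.ne'
  set k : ℝ → ℂ := fun t => 1 / (((σ : ℂ) + t * I) * (σ + t * I + 1)) with hk
  set G : ℕ → ℝ → ℂ := fun n t => LSeries.term b (σ + t * I) n * (N : ℂ) ^ (σ + t * I : ℂ) * k t
  have hnormterm : ∀ n (t : ℝ), ‖LSeries.term b (σ + t * I) n‖ = ‖LSeries.term b σ n‖ := by
    intro n t
    rw [LSeries.norm_term_eq, LSeries.norm_term_eq]
    simp
  have hnormN : ∀ t : ℝ, ‖(N : ℂ) ^ (σ + t * I : ℂ)‖ = (N : ℝ) ^ σ := fun t => by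
    rw [norm_natCast_cpow_of_pos hN]; simp
  have hGeq : ∀ n ≠ 0, ∀ t : ℝ, G n t = b n * (((n / N : ℝ) : ℂ) ^ (-(σ + t * I) : ℂ) * k t) := by
    intro n hn t
    simp only [G]
    have h1 : ((n / N : ℝ) : ℂ) * N = n := by
      push_cast
      exact div_mul_cancel₀ _ hNc
    have hz : ∀ z : ℂ, ((n / N : ℝ) : ℂ) ^ z * (N : ℂ) ^ z = (n : ℂ) ^ z := fun z => by
      have := mul_cpow_ofReal_nonneg (a := (n / N : ℝ)) (b := N) (by positivity) hN0.le z
      rw [ofReal_natCast, h1] at this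
      exact this.symm
    have hNs : (N : ℂ) ^ (σ + t * I : ℂ) ≠ 0 := by rw [Ne, cpow_eq_zero_iff]; simp [hNc]
    have hns : (n : ℂ) ^ (σ + t * I : ℂ) ≠ 0 := by rw [Ne, cpow_eq_zero_iff]; simp [hn]
    have hz1 := hz (σ + t * I)
    have hq : ((n / N : ℝ) : ℂ) ^ (σ + t * I : ℂ) ≠ 0 := fun h => hns (by rw [← hz1, h, zero_mul])
    rw [LSeries.term_of_ne_zero hn, cpow_neg, ← hz1]
    field_simp
  have hGn : ∀ n t, ‖G n t‖ = ‖LSeries.term b σ n‖ * (N : ℝ) ^ σ * ‖k t‖ := fun n t => by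
    simp only [G]
    rw [norm_mul, norm_mul, hnormterm, hnormN]
  have hki : Integrable k := integrable_one_div_mul hσ
  have hGi : ∀ n, Integrable (G n) := by
    intro n
    have hc : Continuous fun t : ℝ => LSeries.term b (σ + t * I) n * (N : ℂ) ^ (σ + t * I : ℂ) := by
      refine Continuous.mul ?_ (Continuous.const_cpow (by fun_prop) (Or.inl hNc))
      rcases eq_or_ne n 0 with rfl | hn
      · simpa using continuous_const
      · simp_rw [LSeries.term_of_ne_zero hn]
        exact continuous_const.div (Continuous.const_cpow (by fun_prop)
          (Or.inl (by exact_mod_cast hn))) fun t => by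
            rw [Ne, cpow_eq_zero_iff]; simp [hn]
    refine (hki.norm.const_mul (‖LSeries.term b σ n‖ * (N : ℝ) ^ σ)).mono'
      (hc.aestronglyMeasurable.mul hki.1) (ae_of_all _ fun t => (hGn n t).le)
  have hsum : Summable fun n => ∫ t, ‖G n t‖ := by
    simp_rw [hGn, integral_const_mul]
    exact (hb.norm.mul_right _).mul_right _
  have hS := hasSum_integral_of_summable_integral_norm hGi hsum
  have h_integral : ∀ n, ∫ t, G n t = if n ∈ Icc 1 N then 2 * Real.pi * (b n * (N - n) / N) else 0 := by
    intro n
    rcases Nat.eq_zero_or_pos n with rfl | hn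
    · simp [G]
    · have hn0 : (0 : ℝ) < n := by exact_mod_cast hn
      simp_rw [hGeq n hn.ne', integral_const_mul]
      rw [rampWeight_eq_integral hσ (by positivity), rampWeight_eq (by positivity)]
      split_ifs with h
      · rw [mem_Icc] at h
        have h2 : (n : ℝ) ≤ N := by exact_mod_cast h.2
        rw [max_eq_left (by rw [sub_nonneg, div_le_one hN0]; exact h2)]
        push_cast
        field_simp
      · have h2 : (N : ℝ) ≤ n := by
          rw [mem_Icc, not_and_or] at h
          exact_mod_cast (by omega : N ≤ n)
        rw [max_eq_right (by rw [sub_nonpos, one_le_div hN0]; exact h2)]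
        simp
  simp_rw [h_integral] at hS
  have hfin := hasSum_sum_of_ne_finset_zero (L := SummationFilter.unconditional ℕ) (f := fun n : ℕ => if n ∈ Icc 1 N then
    2 * (Real.pi : ℂ) * (b n * (N - n) / N) else 0) (s := Icc 1 N) (fun n hn => by simp [hn])
  have heq := hS.unique hfin
  have htsum : ∀ t : ℝ, ∑' n, G n t =
      LSeries b (σ + t * I) * (N : ℂ) ^ (σ + t * I : ℂ) * k t := fun t => by
    simp only [G, LSeries]
    rw [tsum_mul_right, tsum_mul_right]
  have hle : ‖∫ t : ℝ, ∑' n, G n t‖ ≤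
      ∫ t : ℝ, M * (N : ℝ) ^ σ * (2 * (1 + ‖t‖ ^ 2) ^ (-(3 / 2 : ℝ) / 2)) := by
    refine norm_integral_le_of_norm_le (integrable_majorant.const_mul _) (ae_of_all _ fun t => ?_)
    rw [htsum, norm_mul, norm_mul, hnormN]
    calc _ ≤ M * (1 + ‖(σ + t * I : ℂ)‖) ^ (1 / 2 : ℝ) * (N : ℝ) ^ σ * ‖k t‖ := by
          gcongr; exact hF t
      _ = M * (N : ℝ) ^ σ * (‖k t‖ * (1 + ‖(σ + t * I : ℂ)‖) ^ (1 / 2 : ℝ)) := by ring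
      _ ≤ _ := by
          exact mul_le_mul_of_nonneg_left (norm_one_div_mul_le hσ t) (by positivity)
  rw [heq, integral_const_mul] at hle
  have hs2 : ∑ n ∈ Icc 1 N, (if n ∈ Icc 1 N then 2 * (Real.pi : ℂ) * (b n * (N - n) / N) else 0) =
      (2 * Real.pi / N : ℝ) * ∑ n ∈ Icc 1 N, b n * ((N : ℂ) - n) := by
    rw [mul_sum]
    refine sum_congr rfl fun n hn => ?_
    rw [if_pos hn]
    push_cast
    ring
  rw [hs2, norm_mul, norm_real, Real.norm_of_nonneg (by positivity)] at hle
  have hpi : 1 ≤ 2 * Real.pi := by linarith [Real.pi_gt_three]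
  rw [Real.rpow_add hN0, Real.rpow_one]
  set J := ∫ t : ℝ, 2 * (1 + ‖t‖ ^ 2) ^ (-(3 / 2 : ℝ) / 2)
  set S := ‖∑ n ∈ Icc 1 N, b n * ((N : ℂ) - n)‖
  have h1 : 1 / N * S ≤ 2 * Real.pi / N * S := by gcongr
  have h2 := h1.trans hle
  rw [one_div, inv_mul_le_iff₀ hN0] at h2
  linarith

end Perron

section SmoothedToSharp

lemma one_le_log_add_two {N : ℕ} (hN : 1 ≤ N) : 1 ≤ Real.log (N + 2) := by
  rw [Real.le_log_iff_exp_le (by positivity)]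
  have : (1 : ℝ) ≤ N := by exact_mod_cast hN
  linarith [Real.exp_one_lt_d9]

lemma exists_log_pow_le_rpow (j : ℕ) {ε : ℝ} (hε : 0 < ε) :
    ∃ C : ℝ, 0 < C ∧ ∀ N : ℕ, 1 ≤ N → Real.log (N + 2) ^ j ≤ C * (N : ℝ) ^ ε := by
  set δ := ε / (j + 1) with hδ
  have hδ0 : 0 < δ := by positivity
  refine ⟨(3 : ℝ) ^ ε / δ ^ j, by positivity, fun N hN => ?_⟩
  have hN1 : (1 : ℝ) ≤ N := by exact_mod_cast hN
  have hL := one_le_log_add_two hN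
  calc Real.log (N + 2) ^ j ≤ (((N : ℝ) + 2) ^ δ / δ) ^ j :=
        pow_le_pow_left₀ (by linarith) (Real.log_le_rpow_div (by positivity) hδ0) j
    _ = ((N : ℝ) + 2) ^ (δ * j) / δ ^ j := by
        rw [div_pow, Real.rpow_mul (by positivity), Real.rpow_natCast]
    _ ≤ (3 * N : ℝ) ^ ε / δ ^ j := by
        gcongr ?_ / _
        calc ((N : ℝ) + 2) ^ (δ * j) ≤ ((N : ℝ) + 2) ^ ε := by
              apply Real.rpow_le_rpow_of_exponent_le (by linarith)
              rw [hδ, div_mul_eq_mul_div, div_le_iff₀ (by positivity)]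
              nlinarith
          _ ≤ _ := by
              apply Real.rpow_le_rpow (by positivity) _ hε.le
              linarith
    _ = _ := by
        rw [Real.mul_rpow (by norm_num) (by positivity)]
        ring

lemma norm_sum_Ioc_mul_le {b : ℕ → ℂ} {g : ℕ → ℝ} {K : ℝ} {m N : ℕ} (hmN : m < N)
    (hg0 : ∀ n, m < n → n ≤ N → 0 ≤ g n) (hg : ∀ n, m < n → n < N → g (n + 1) ≤ g n)
    (hS : ∀ n, m ≤ n → n ≤ N → ‖∑ i ∈ Icc 1 n, b i‖ ≤ K) :
    ‖∑ n ∈ Ioc m N, (g n : ℂ) * b n‖ ≤ 2 * K * g (m + 1) := by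
  set S : ℕ → ℂ := fun n => ∑ i ∈ Icc 1 n, b i with hSdef
  have hSs : ∀ n, S (n + 1) = S n + b (n + 1) := fun n => sum_Icc_succ_top (by omega) _
  have key : ∀ n, m + 1 ≤ n → n ≤ N →
      ‖∑ i ∈ Ioc m n, (g i : ℂ) * b i - g n * S n‖ ≤ K * (2 * g (m + 1) - g n) := by
    intro n hn
    induction n, hn using Nat.le_induction with
    | base =>
      intro hN
      have : ∑ i ∈ Ioc m (m + 1), (g i : ℂ) * b i - g (m + 1) * S (m + 1) = -(g (m + 1) * S m) := by
        simp [hSs]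
        ring
      rw [this, norm_neg, norm_mul, Complex.norm_real,
        Real.norm_of_nonneg (hg0 _ (by omega) hN)]
      nlinarith [hS m le_rfl hmN.le, hg0 (m + 1) (by omega) hN]
    | succ n hn ih =>
      intro hN
      have : ∑ i ∈ Ioc m (n + 1), (g i : ℂ) * b i - g (n + 1) * S (n + 1) =
          (∑ i ∈ Ioc m n, (g i : ℂ) * b i - g n * S n) + ((g n - g (n + 1) : ℝ) : ℂ) * S n := by
        rw [sum_Ioc_succ_top (by omega), hSs]
        push_cast
        ring
      rw [this]
      refine (norm_add_le _ _).trans ?_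
      have h1 := ih (by omega)
      have h2 : 0 ≤ g n - g (n + 1) := sub_nonneg.mpr (hg n (by omega) (by omega))
      rw [norm_mul, Complex.norm_real, Real.norm_of_nonneg h2]
      nlinarith [hS n (by omega) (by omega)]
  have h1 := key N hmN le_rfl
  have h2 : ‖(g N : ℂ) * S N‖ ≤ g N * K := by
    rw [norm_mul, Complex.norm_real, Real.norm_of_nonneg (hg0 N hmN le_rfl)]
    exact mul_le_mul_of_nonneg_left (hS N hmN.le le_rfl) (hg0 N hmN le_rfl)
  have h3 := norm_le_norm_sub_add (∑ i ∈ Ioc m N, (g i : ℂ) * b i) (g N * S N)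
  linarith

lemma sum_mul_sub_split (b : ℕ → ℂ) (N H : ℕ) :
    ∑ n ∈ Icc 1 (N + H), b n * ((N + H : ℕ) - n : ℂ) =
      ∑ n ∈ Icc 1 N, b n * (N - n : ℂ) + H * ∑ n ∈ Icc 1 N, b n +
        ∑ n ∈ Ioc N (N + H), b n * ((N + H : ℕ) - n : ℂ) := by
  have h : ∑ n ∈ Icc 1 (N + H), b n * ((N + H : ℕ) - n : ℂ) =
      ∑ n ∈ Icc 1 N, b n * ((N + H : ℕ) - n : ℂ) +
        ∑ n ∈ Ioc N (N + H), b n * ((N + H : ℕ) - n : ℂ) := by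
    rw [← sum_union (disjoint_left.mpr fun a ha hb => by
      rw [mem_Icc] at ha; rw [mem_Ioc] at hb; omega)]
    congr 1
    ext a
    simp only [mem_union, mem_Icc, mem_Ioc]
    omega
  rw [h, mul_sum, ← sum_add_distrib]
  congr 1
  refine sum_congr rfl fun n _ => ?_
  push_cast
  ring

lemma norm_sum_le_of_smoothed (j : ℕ) : ∃ C : ℝ, 0 < C ∧ ∀ (b : ℕ → ℂ) (M : ℝ), 1 ≤ M →
    (∀ n, 1 ≤ n → ‖b n‖ ≤ 2 * Real.log (n + 2) ^ (2 * j)) →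
    (∀ N : ℕ, 1 ≤ N → ‖∑ n ∈ Icc 1 N, b n * (N - n : ℂ)‖ ≤ M * (N : ℝ) ^ 2) →
    ∀ N : ℕ, 1 ≤ N → ‖∑ n ∈ Icc 1 N, b n‖ ≤ C * M * N * Real.log (N + 2) ^ j := by
  obtain ⟨C₁, hC₁, hlog⟩ := exists_log_pow_le_rpow j one_pos
  refine ⟨5 + 2 * 2 ^ (2 * j) * (1 + C₁), by positivity, fun b M hM hb hT N hN => ?_⟩
  set L := Real.log (N + 2) with hL
  have hL1 : 1 ≤ L := one_le_log_add_two hN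
  have hN1 : (1 : ℝ) ≤ N := by exact_mod_cast hN
  have hLj : 1 ≤ L ^ j := one_le_pow₀ hL1
  have hLN : L ^ j ≤ C₁ * N := by simpa using hlog N hN
  set H := ⌈(N : ℝ) / L ^ j⌉₊ with hH
  have hH1 : (N : ℝ) / L ^ j ≤ H := Nat.le_ceil _
  have hH2 : (H : ℝ) < N / L ^ j + 1 := Nat.ceil_lt_add_one (by positivity)
  have hHN : H ≤ N := by
    rw [hH, Nat.ceil_le]
    exact div_le_self (by linarith) hLj
  have hHN' : (H : ℝ) ≤ N := by exact_mod_cast hHN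
  have hHpos : 0 < (H : ℝ) := lt_of_lt_of_le (by positivity) hH1
  have hlog2 : ∀ n ∈ Ioc N (N + H), ‖b n * ((N + H : ℕ) - n : ℂ)‖ ≤
      2 * (2 * L) ^ (2 * j) * H := by
    intro n hn
    rw [mem_Ioc] at hn
    have hn1 : (N : ℝ) < n := by exact_mod_cast hn.1
    have hn2 : (n : ℝ) ≤ N + H := by exact_mod_cast hn.2
    have hnorm : ‖((N + H : ℕ) - n : ℂ)‖ ≤ H := by
      have : ((N + H : ℕ) - n : ℂ) = ((N + H - n : ℝ) : ℂ) := by push_cast; ring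
      rw [this, Complex.norm_real, Real.norm_of_nonneg (by linarith)]
      linarith
    rw [norm_mul]
    have hln : Real.log (n + 2) ≤ 2 * L := by
      have : Real.log ((n : ℝ) + 2) ≤ Real.log (((N : ℝ) + 2) ^ 2) := by
        apply Real.log_le_log (by positivity)
        nlinarith
      rwa [Real.log_pow, Nat.cast_ofNat] at this
    have h0 : 0 ≤ Real.log ((n : ℝ) + 2) := Real.log_nonneg (by linarith)
    calc ‖b n‖ * _ ≤ (2 * Real.log (n + 2) ^ (2 * j)) * H := by
          gcongr
          exact hb n (by omega)
      _ ≤ _ := by gcongr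
  have htail : ‖∑ n ∈ Ioc N (N + H), b n * ((N + H : ℕ) - n : ℂ)‖ ≤
      H * (2 * (2 * L) ^ (2 * j) * H) := by
    refine (norm_sum_le_of_le _ hlog2).trans ?_
    simp
  have hT1 := hT N hN
  have hT2 := hT (N + H) (by omega)
  have hT3 : M * ((N + H : ℕ) : ℝ) ^ 2 ≤ 4 * M * N ^ 2 := by
    push_cast
    have : ((N : ℝ) + H) ^ 2 ≤ (2 * N) ^ 2 := by gcongr; linarith
    nlinarith
  have hsplit := sum_mul_sub_split b N H
  have hmain : (H : ℝ) * ‖∑ n ∈ Icc 1 N, b n‖ ≤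
      5 * M * N ^ 2 + H * (2 * (2 * L) ^ (2 * j) * H) := by
    have : (H : ℂ) * ∑ n ∈ Icc 1 N, b n = ∑ n ∈ Icc 1 (N + H), b n * ((N + H : ℕ) - n : ℂ) -
        ∑ n ∈ Icc 1 N, b n * (N - n : ℂ) -
        ∑ n ∈ Ioc N (N + H), b n * ((N + H : ℕ) - n : ℂ) := by
      rw [hsplit]; ring
    have h2 := congrArg norm this
    rw [norm_mul, Complex.norm_natCast] at h2
    rw [h2]
    refine (norm_sub_le _ _).trans ?_
    have := norm_sub_le (∑ n ∈ Icc 1 (N + H), b n * ((N + H : ℕ) - n : ℂ))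
      (∑ n ∈ Icc 1 N, b n * (N - n : ℂ))
    linarith
  have hH3 : (H : ℝ) * L ^ j ≤ (1 + C₁) * N := by
    have : (N : ℝ) / L ^ j * L ^ j = N := div_mul_cancel₀ _ (by positivity)
    nlinarith
  have hH4 : (N : ℝ) ≤ H * L ^ j := by rwa [div_le_iff₀ (by positivity)] at hH1
  have hfin : (H : ℝ) * ‖∑ n ∈ Icc 1 N, b n‖ ≤
      H * ((5 + 2 * 2 ^ (2 * j) * (1 + C₁)) * M * N * L ^ j) := by
    refine hmain.trans ?_
    have e1 : 5 * M * (N : ℝ) ^ 2 ≤ 5 * M * N * (H * L ^ j) := by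
      have : 5 * M * (N : ℝ) ^ 2 = 5 * M * N * N := by ring
      rw [this]
      gcongr
    have e2 : (H : ℝ) * (2 * (2 * L) ^ (2 * j) * H) ≤
        H * (2 * 2 ^ (2 * j) * L ^ j * ((1 + C₁) * N)) := by
      have : 2 * (2 * L) ^ (2 * j) * (H : ℝ) = 2 * 2 ^ (2 * j) * L ^ j * (H * L ^ j) := by
        rw [mul_pow, two_mul j, pow_add L]; ring
      rw [this]
      gcongr
    have e3 : (H : ℝ) * (2 * 2 ^ (2 * j) * L ^ j * ((1 + C₁) * N)) ≤
        M * (H * (2 * 2 ^ (2 * j) * L ^ j * ((1 + C₁) * N))) :=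
      le_mul_of_one_le_left (by positivity) hM
    nlinarith
  exact le_of_mul_le_mul_left hfin hHpos

lemma norm_sum_le_of_smoothed_log (j : ℕ) : ∃ C : ℝ, 0 < C ∧ ∀ (c : ℕ → ℂ) (M : ℝ), 1 ≤ M →
    (∀ n, 1 ≤ n → ‖c n‖ ≤ 2 * Real.log (n + 2)) →
    (∀ N : ℕ, 1 ≤ N → ‖∑ n ∈ Icc 1 N, ((Real.log n ^ (2 * j + 1) : ℝ) * c n) * (N - n : ℂ)‖ ≤
      M * (N : ℝ) ^ 2) →
    ∀ N : ℕ, 1 ≤ N → ‖∑ n ∈ Icc 1 N, c n‖ ≤ C * M * N / Real.log (N + 2) ^ j := by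
  obtain ⟨C₁, hC₁, h1⟩ := norm_sum_le_of_smoothed (j + 1)
  obtain ⟨C₂, hC₂, h2⟩ := exists_log_pow_le_rpow (j + 1) (ε := 1 / 2) (by norm_num)
  refine ⟨2 * C₂ + 2 * C₁ * 4 ^ (2 * j + 1), by positivity, fun c M hM hc hT N hN => ?_⟩
  set b : ℕ → ℂ := fun n => (Real.log n ^ (2 * j + 1) : ℝ) * c n with hb
  have hbn : ∀ n, 1 ≤ n → ‖b n‖ ≤ 2 * Real.log (n + 2) ^ (2 * (j + 1)) := by
    intro n hn
    have hn1 : (1 : ℝ) ≤ n := by exact_mod_cast hn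
    have h0 : 0 ≤ Real.log n := Real.log_nonneg hn1
    have h3 : Real.log n ≤ Real.log (n + 2) := Real.log_le_log (by linarith) (by linarith)
    rw [hb, norm_mul, Complex.norm_real, Real.norm_of_nonneg (by positivity)]
    calc Real.log n ^ (2 * j + 1) * ‖c n‖
        ≤ Real.log (n + 2) ^ (2 * j + 1) * (2 * Real.log (n + 2)) := by
          have := hc n hn
          have := h0.trans h3
          gcongr
      _ = _ := by ring
  have hS := h1 b M hM hbn hT
  set L := Real.log (N + 2) with hL
  have hL1 : 1 ≤ L := one_le_log_add_two hN
  have hN1 : (1 : ℝ) ≤ N := by exact_mod_cast hN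
  set m := Nat.sqrt N with hm
  have hm1 : 1 ≤ m := Nat.sqrt_pos.mpr hN
  have hmN : m ≤ N := Nat.sqrt_le_self N
  have hmsq : (m : ℝ) ^ 2 ≤ N := by exact_mod_cast Nat.sqrt_le' N
  have hmlt : (N : ℝ) + 1 ≤ (m + 1) ^ 2 := by exact_mod_cast Nat.succ_le_succ_sqrt' N
  have hlogm : L ≤ 4 * Real.log (m + 1) := by
    have : L ≤ Real.log (((m : ℝ) + 1) ^ 4) := by
      apply Real.log_le_log (by positivity)
      nlinarith
    rwa [Real.log_pow, Nat.cast_ofNat] at this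
  have hsplit : ∑ n ∈ Icc 1 N, c n = ∑ n ∈ Icc 1 m, c n + ∑ n ∈ Ioc m N, c n := by
    rw [← sum_union (disjoint_left.mpr fun a ha hb => by
      rw [mem_Icc] at ha; rw [mem_Ioc] at hb; omega)]
    congr 1
    ext a
    simp only [mem_union, mem_Icc, mem_Ioc]
    omega
  have hfirst : ‖∑ n ∈ Icc 1 m, c n‖ ≤ 2 * C₂ * N / L ^ j := by
    have hle : ∀ n ∈ Icc 1 m, ‖c n‖ ≤ 2 * L := fun n hn => by
      rw [mem_Icc] at hn
      refine (hc n hn.1).trans ?_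
      have : (n : ℝ) ≤ N := by exact_mod_cast hn.2.trans hmN
      rw [hL]
      gcongr
    refine (norm_sum_le_of_le _ hle).trans ?_
    rw [sum_const, Nat.card_Icc, nsmul_eq_mul, Nat.add_sub_cancel, le_div_iff₀ (by positivity)]
    have hmr : (m : ℝ) ≤ (N : ℝ) ^ (1 / 2 : ℝ) := by
      rw [← Real.sqrt_eq_rpow]
      exact Real.le_sqrt_of_sq_le hmsq
    have hNN : (N : ℝ) ^ (1 / 2 : ℝ) * (N : ℝ) ^ (1 / 2 : ℝ) = N := by
      rw [← Real.rpow_add (by linarith)]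
      norm_num
    calc (m : ℝ) * (2 * L) * L ^ j = 2 * (m * L ^ (j + 1)) := by ring
      _ ≤ 2 * ((N : ℝ) ^ (1 / 2 : ℝ) * (C₂ * (N : ℝ) ^ (1 / 2 : ℝ))) := by
          gcongr
          exact h2 N hN
      _ = 2 * C₂ * ((N : ℝ) ^ (1 / 2 : ℝ) * (N : ℝ) ^ (1 / 2 : ℝ)) := by ring
      _ = _ := by rw [hNN]
  have hsecond : ‖∑ n ∈ Ioc m N, c n‖ ≤ 2 * C₁ * 4 ^ (2 * j + 1) * M * N / L ^ j := by
    rcases hmN.eq_or_lt with h | hlt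
    · rw [h, Ioc_self, sum_empty, norm_zero]
      positivity
    have hlogpos : ∀ n : ℕ, m < n → 0 < Real.log n := fun n hn =>
      Real.log_pos (by exact_mod_cast (by omega : 1 < n))
    have hcb : ∑ n ∈ Ioc m N, c n =
        ∑ n ∈ Ioc m N, ((1 / Real.log n ^ (2 * j + 1) : ℝ) : ℂ) * b n := by
      refine sum_congr rfl fun n hn => ?_
      rw [mem_Ioc] at hn
      have := (hlogpos n hn.1).ne'
      have hne : ((Real.log n ^ (2 * j + 1) : ℝ) : ℂ) ≠ 0 := by
        exact_mod_cast pow_ne_zero _ this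
      rw [hb]
      simp only
      rw [Complex.ofReal_div, Complex.ofReal_one]
      field_simp
    rw [hcb]
    have hA := norm_sum_Ioc_mul_le (b := b) (g := fun n => 1 / Real.log n ^ (2 * j + 1))
      (K := C₁ * M * N * L ^ (j + 1)) hlt
      (fun n hn _ => by have := hlogpos n hn; positivity)
      (fun n hn _ => by
        have h0 := hlogpos n hn
        have : Real.log n ≤ Real.log ((n + 1 : ℕ) : ℝ) :=
          Real.log_le_log (by exact_mod_cast (by omega : 0 < n)) (by push_cast; linarith)
        gcongr)
      (fun n hn hnN => by
        refine (hS n (hm1.trans hn)).trans ?_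
        have h3 : (n : ℝ) ≤ N := by exact_mod_cast hnN
        have h4 : Real.log (n + 2) ≤ L := Real.log_le_log (by positivity) (by linarith)
        have h5 : 0 ≤ Real.log ((n : ℝ) + 2) :=
          Real.log_nonneg (by linarith [(Nat.cast_nonneg n : (0 : ℝ) ≤ n)])
        gcongr)
    refine hA.trans ?_
    have hg : 1 / Real.log ((m + 1 : ℕ) : ℝ) ^ (2 * j + 1) ≤ (4 / L) ^ (2 * j + 1) := by
      rw [← one_div_pow]
      have := hlogpos (m + 1) (by omega)
      refine pow_le_pow_left₀ (by positivity) ?_ _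
      push_cast at this ⊢
      rw [div_le_div_iff₀ this (by linarith)]
      linarith
    calc 2 * (C₁ * M * N * L ^ (j + 1)) * (1 / Real.log ((m + 1 : ℕ) : ℝ) ^ (2 * j + 1))
        ≤ 2 * (C₁ * M * N * L ^ (j + 1)) * (4 / L) ^ (2 * j + 1) := by gcongr
      _ = _ := by
        rw [div_pow]
        field_simp
        ring
  rw [hsplit]
  refine (norm_add_le _ _).trans ((add_le_add hfirst hsecond).trans ?_)
  rw [← add_div]
  gcongr
  have : 2 * C₂ * (N : ℝ) ≤ 2 * C₂ * M * N := by
    have : 0 ≤ 2 * C₂ * (N : ℝ) := by positivity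
    nlinarith
  linarith

end SmoothedToSharp

section PrimeCharacterSums

open Complex

lemma logMul_iterate_apply (f : ℕ → ℂ) (k n : ℕ) :
    (LSeries.logMul^[k] f) n = (Real.log n ^ k : ℝ) * f n := by
  induction k with
  | zero => simp
  | succ k ih =>
    rw [Function.iterate_succ_apply', LSeries.logMul, ih, ← natCast_log]
    push_cast
    ring

lemma norm_sum_le_of_LSeries (j : ℕ) : ∃ C : ℝ, 0 < C ∧ ∀ (c : ℕ → ℂ) (M : ℝ), 1 ≤ M →
    (∀ n, 1 ≤ n → ‖c n‖ ≤ 2 * Real.log (n + 2)) → LSeries.abscissaOfAbsConv c ≤ 1 →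
    (∀ s : ℂ, 1 < s.re → s.re ≤ 2 →
      ‖iteratedDeriv (2 * j + 1) (LSeries c) s‖ ≤ M * (1 + ‖s‖) ^ (1 / 2 : ℝ)) →
    ∀ N : ℕ, 1 ≤ N → ‖∑ n ∈ Icc 1 N, c n‖ ≤ C * M * N / Real.log (N + 2) ^ j := by
  obtain ⟨C₁, hC₁, h1⟩ := norm_sum_le_of_smoothed_log j
  set J := ∫ t : ℝ, 2 * (1 + ‖t‖ ^ 2) ^ (-(3 / 2 : ℝ) / 2) with hJ
  have hJ0 : 0 ≤ J := MeasureTheory.integral_nonneg fun t => by positivity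
  refine ⟨C₁ * ((J + 1) * 3), by positivity, fun c M hM hc habs hD N hN => ?_⟩
  have := h1 c (M * ((J + 1) * 3)) (by nlinarith) hc (fun N hN => ?_) N hN
  · refine this.trans_eq ?_
    ring
  have hL1 := one_le_log_add_two hN
  set L := Real.log (N + 2) with hL
  have hN1 : (1 : ℝ) ≤ N := by exact_mod_cast hN
  set σ := 1 + 1 / L with hσ
  have hσ1 : 1 < σ := by
    have : 0 < 1 / L := by positivity
    linarith
  have hσ2 : σ ≤ 2 := by
    have : 1 / L ≤ 1 := by rw [div_le_one (by linarith)]; exact hL1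
    linarith
  set b := LSeries.logMul^[2 * j + 1] c with hb
  have habsσ : ∀ s : ℂ, 1 < s.re → LSeries.abscissaOfAbsConv c < s.re := fun s hs =>
    habs.trans_lt (by exact_mod_cast hs)
  have hsum : LSeriesSummable b σ := by
    apply LSeriesSummable_of_abscissaOfAbsConv_lt_re
    rw [hb, LSeries.absicssaOfAbsConv_logPowMul]
    exact habsσ _ (by simpa using hσ1)
  have hP := norm_sum_mul_sub_le hσ1.le (by linarith) hsum (M := M) (fun t => ?_) hN
  · have he : ∀ n ∈ Icc 1 N, ((Real.log n ^ (2 * j + 1) : ℝ) * c n) * (N - n : ℂ) =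
        b n * (N - n) := fun n _ => by rw [hb, logMul_iterate_apply]
    rw [sum_congr rfl he]
    refine hP.trans ?_
    have hpow : (N : ℝ) ^ (σ + 1) ≤ 3 * (N : ℝ) ^ 2 := by
      have : σ + 1 = 1 / L + 2 := by rw [hσ]; ring
      rw [this, Real.rpow_add (by linarith), Real.rpow_two]
      gcongr
      calc (N : ℝ) ^ (1 / L) ≤ Real.exp 1 := by
            rw [Real.rpow_def_of_pos (by linarith), Real.exp_le_exp, mul_one_div,
              div_le_one (by linarith)]
            exact Real.log_le_log (by linarith) (by linarith)
        _ ≤ 3 := Real.exp_one_lt_three.le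
    calc M * J * (N : ℝ) ^ (σ + 1) ≤ M * (J + 1) * (3 * (N : ℝ) ^ 2) := by
          gcongr
          linarith
      _ = _ := by ring
  · have hre : (σ + t * I : ℂ).re = σ := by simp
    have h2 := hD (σ + t * I) (by rw [hre]; exact hσ1) (by rw [hre]; exact hσ2)
    rw [LSeries_iteratedDeriv _ (habsσ _ (by rw [hre]; exact hσ1)), norm_mul, norm_pow, norm_neg,
      norm_one, one_pow, one_mul] at h2
    exact h2

lemma vonMangoldt_le_log_add_two (n : ℕ) :
    ArithmeticFunction.vonMangoldt n ≤ Real.log (n + 2) := by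
  rcases Nat.eq_zero_or_pos n with rfl | hn
  · simpa using Real.log_nonneg (by norm_num)
  · exact ArithmeticFunction.vonMangoldt_le_log.trans
      (Real.log_le_log (by exact_mod_cast hn) (by linarith))

lemma norm_sum_char_mul_vonMangoldt_le (j : ℕ) : ∃ C : ℝ, 0 < C ∧ ∀ (q : ℕ) [NeZero q]
    (χ : DirichletCharacter ℂ q), χ ≠ 1 → ∀ N : ℕ, 1 ≤ N →
    ‖∑ n ∈ Icc 1 N, χ n * (ArithmeticFunction.vonMangoldt n : ℂ)‖ ≤
      C * (q : ℝ) ^ (1 / 2 : ℝ) * N / Real.log (N + 2) ^ j := by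
  obtain ⟨C₁, hC₁, h1⟩ := norm_iteratedDeriv_logDeriv_LFunction_le (2 * j + 1)
  obtain ⟨C₂, hC₂, h2⟩ := norm_sum_le_of_LSeries j
  refine ⟨C₂ * (C₁ + 1), by positivity, fun q _ χ hχ N hN => ?_⟩
  have hq : (1 : ℝ) ≤ (q : ℝ) ^ (1 / 2 : ℝ) :=
    Real.one_le_rpow (by exact_mod_cast NeZero.one_le) (by norm_num)
  set c : ℕ → ℂ := (fun n : ℕ => χ n) * fun n : ℕ => (ArithmeticFunction.vonMangoldt n : ℂ) with hc
  have := h2 c ((C₁ + 1) * (q : ℝ) ^ (1 / 2 : ℝ)) (by nlinarith) (fun n hn => ?_) ?_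
    (fun s hs hs2 => ?_) N hN
  · refine (le_of_eq ?_).trans (this.trans_eq ?_)
    · simp [hc]
    · ring
  · rw [hc, Pi.mul_apply, norm_mul, norm_real,
      Real.norm_of_nonneg ArithmeticFunction.vonMangoldt_nonneg]
    have h3 := χ.norm_le_one n
    have h4 := vonMangoldt_le_log_add_two n
    have h5 : 0 ≤ ArithmeticFunction.vonMangoldt n := ArithmeticFunction.vonMangoldt_nonneg
    nlinarith [norm_nonneg (χ n)]
  · refine LSeries.abscissaOfAbsConv_le_of_forall_lt_LSeriesSummable fun y hy => ?_
    exact DirichletCharacter.LSeriesSummable_twist_vonMangoldt χ (by simpa using hy)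
  · have heq : LSeries c =ᶠ[nhds s] fun z => -(deriv χ.LFunction z / χ.LFunction z) := by
      have hopen : IsOpen {z : ℂ | 1 < z.re} := isOpen_lt continuous_const continuous_re
      filter_upwards [hopen.mem_nhds hs] with z hz
      rw [hc, DirichletCharacter.LSeries_twist_vonMangoldt_eq χ hz,
        DirichletCharacter.LFunction_eq_LSeries χ hz,
        DirichletCharacter.deriv_LFunction_eq_deriv_LSeries χ hz, neg_div]
    rw [heq.iteratedDeriv_eq]
    have hneg : iteratedDeriv (2 * j + 1) (fun z => -(deriv χ.LFunction z / χ.LFunction z)) s =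
        -iteratedDeriv (2 * j + 1) (fun z => deriv χ.LFunction z / χ.LFunction z) s :=
      iteratedDeriv_fun_neg _ _ _
    rw [hneg, norm_neg]
    refine (h1 q χ s hχ hs hs2).trans ?_
    rw [Real.mul_rpow (by positivity) (by positivity), ← mul_assoc]
    gcongr
    linarith

lemma abs_sum_vonMangoldt_sub_le (j : ℕ) : ∃ C : ℝ, 0 < C ∧ ∀ N : ℕ, 1 ≤ N →
    |∑ n ∈ Icc 1 N, ArithmeticFunction.vonMangoldt n - N| ≤ C * N / Real.log (N + 2) ^ j := by
  obtain ⟨C₁, hC₁, h1⟩ := norm_iteratedDeriv_logDeriv_zeta_le (2 * j + 1)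
  obtain ⟨C₂, hC₂, h2⟩ := norm_sum_le_of_LSeries j
  refine ⟨C₂ * (C₁ + 1), by positivity, fun N hN => ?_⟩
  set c : ℕ → ℂ := (fun n : ℕ => (ArithmeticFunction.vonMangoldt n : ℂ)) - 1 with hc
  have hsummable : ∀ s : ℂ, 1 < s.re →
      LSeriesSummable (fun n => (ArithmeticFunction.vonMangoldt n : ℂ)) s ∧
        LSeriesSummable 1 s := fun s hs =>
    ⟨ArithmeticFunction.LSeriesSummable_vonMangoldt hs, LSeriesSummable_one_iff.mpr hs⟩
  have := h2 c (C₁ + 1) (by linarith) (fun n hn => ?_) ?_ (fun s hs hs2 => ?_) N hN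
  · refine (le_of_eq ?_).trans this
    have : ∑ n ∈ Icc 1 N, c n =
        ((∑ n ∈ Icc 1 N, ArithmeticFunction.vonMangoldt n - N : ℝ) : ℂ) := by
      simp [hc]
    rw [this, norm_real, Real.norm_eq_abs]
  · have h4 := vonMangoldt_le_log_add_two n
    have h5 : 0 ≤ ArithmeticFunction.vonMangoldt n := ArithmeticFunction.vonMangoldt_nonneg
    have h6 := one_le_log_add_two hn
    refine (norm_sub_le _ _).trans ?_
    rw [norm_real, Real.norm_of_nonneg h5, Pi.one_apply, norm_one]
    linarith
  · refine LSeries.abscissaOfAbsConv_le_of_forall_lt_LSeriesSummable fun y hy => ?_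
    have h3 := hsummable (y : ℂ) (by simpa using hy)
    exact h3.1.sub h3.2
  · have heq : LSeries c =ᶠ[nhds s]
        fun z => -(deriv riemannZeta z / riemannZeta z) - riemannZeta z := by
      have hopen : IsOpen {z : ℂ | 1 < z.re} := isOpen_lt continuous_const continuous_re
      filter_upwards [hopen.mem_nhds hs] with z hz
      have h3 := hsummable z hz
      rw [hc, LSeries_sub h3.1 h3.2, LSeries_one_eq_riemannZeta hz,
        ArithmeticFunction.LSeries_vonMangoldt_eq_deriv_riemannZeta_div hz, neg_div]
    rw [heq.iteratedDeriv_eq]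
    refine (h1 s hs hs2).trans ?_
    gcongr
    linarith

end PrimeCharacterSums

section SiegelWalfisz

open scoped ArithmeticFunction.vonMangoldt

lemma sum_vonMangoldt_not_coprime_le {N q : ℕ} (hN : 1 ≤ N) (hq : 1 ≤ q) :
    ∑ n ∈ (Icc 1 N).filter (fun n => ¬ n.Coprime q), Λ n ≤
      3 * #q.primeFactors * Real.log (N + 2) ^ 2 := by
  set L := Real.log (N + 2) with hL
  have hL1 : 1 ≤ L := one_le_log_add_two hN
  have hN1 : (1 : ℝ) ≤ N := by exact_mod_cast hN
  set T := (q.primeFactors ×ˢ range (Nat.log 2 N + 1)).image fun x => x.1 ^ x.2 with hT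
  have hcard : (#T : ℝ) ≤ #q.primeFactors * (3 * L) := by
    have h1 : #T ≤ #q.primeFactors * (Nat.log 2 N + 1) := by
      refine card_image_le.trans ?_
      rw [card_product, card_range]
    have h2 : ((Nat.log 2 N : ℕ) : ℝ) ≤ 2 * L := by
      refine (Real.natLog_le_logb N 2).trans ?_
      rw [Real.logb, Nat.cast_ofNat, div_le_iff₀ (Real.log_pos (by norm_num))]
      have h3 : Real.log N ≤ L := Real.log_le_log (by linarith) (by linarith)
      nlinarith [Real.log_two_gt_d9]
    calc (#T : ℝ) ≤ #q.primeFactors * (Nat.log 2 N + 1) := by exact_mod_cast h1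
      _ ≤ _ := by gcongr; linarith
  have hsub : ∀ n ∈ (Icc 1 N).filter (fun n => ¬ n.Coprime q), n ∉ T → Λ n = 0 := by
    intro n hn hnT
    by_contra h0
    rw [← Ne, ArithmeticFunction.vonMangoldt_ne_zero_iff, isPrimePow_nat_iff] at h0
    obtain ⟨p, k, hp, hk, rfl⟩ := h0
    rw [mem_filter, mem_Icc] at hn
    refine hnT (mem_image.mpr ⟨(p, k), mem_product.mpr ⟨?_, ?_⟩, rfl⟩)
    · rw [Nat.mem_primeFactors]
      refine ⟨hp, ?_, by omega⟩
      by_contra hpq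
      exact hn.2 (((Nat.Prime.coprime_iff_not_dvd hp).mpr hpq).pow_left k)
    · rw [mem_range]
      have := Nat.le_log_of_pow_le one_lt_two ((Nat.pow_le_pow_left hp.two_le k).trans hn.1.2)
      simp only
      omega
  calc ∑ n ∈ (Icc 1 N).filter (fun n => ¬ n.Coprime q), Λ n
      = ∑ n ∈ ((Icc 1 N).filter (fun n => ¬ n.Coprime q)).filter (· ∈ T), Λ n := by
        refine (sum_filter_of_ne fun n hn h0 => ?_).symm
        by_contra h
        exact h0 (hsub n hn h)
    _ ≤ ∑ _n ∈ ((Icc 1 N).filter (fun n => ¬ n.Coprime q)).filter (· ∈ T), L := by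
        refine sum_le_sum fun n hn => ?_
        rw [mem_filter, mem_filter, mem_Icc] at hn
        have : (n : ℝ) ≤ N := by exact_mod_cast hn.1.1.2
        refine (vonMangoldt_le_log_add_two n).trans ?_
        rw [hL]
        gcongr
    _ ≤ #T * L := by
        rw [sum_const, nsmul_eq_mul]
        gcongr
        intro n hn
        exact (mem_filter.mp hn).2
    _ ≤ #q.primeFactors * (3 * L) * L := by gcongr
    _ = _ := by ring

lemma totient_mul_sum_residue_eq {q : ℕ} [NeZero q] {a : ℕ} (ha : a.Coprime q) (N : ℕ) :
    (q.totient : ℂ) * ∑ n ∈ (Icc 1 N).filter (fun n => n % q = a % q), (Λ n : ℂ) =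
      ∑ χ : DirichletCharacter ℂ q, χ (a : ZMod q)⁻¹ * ∑ n ∈ Icc 1 N, χ n * (Λ n : ℂ) := by
  simp_rw [mul_sum]
  rw [sum_comm, sum_filter]
  refine sum_congr rfl fun n _ => ?_
  simp_rw [← mul_assoc]
  rw [← sum_mul, DirichletCharacter.sum_char_inv_mul_char_eq ℂ
    ((ZMod.isUnit_iff_coprime a q).mpr ha)]
  by_cases h : n % q = a % q
  · rw [if_pos h, if_pos ((ZMod.natCast_eq_natCast_iff' _ _ _).mpr h.symm)]
  · rw [if_neg h, if_neg fun h2 => h ((ZMod.natCast_eq_natCast_iff' _ _ _).mp h2).symm, zero_mul]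

theorem siegel_walfisz (A : ℕ) : ∃ C : ℝ, 0 < C ∧ ∀ N : ℕ, 1 ≤ N → ∀ q a : ℕ, 1 ≤ q →
    (q : ℝ) ≤ (2 * Real.log (N + 2)) ^ A →
    |∑ n ∈ (Icc 1 N).filter (fun n => n % q = a % q), Λ n -
      if a.Coprime q then (N : ℝ) / q.totient else 0| ≤ C * N / Real.log (N + 2) ^ A := by
  obtain ⟨C₁, hC₁, h1⟩ := norm_sum_char_mul_vonMangoldt_le (2 * A)
  obtain ⟨C₂, hC₂, h2⟩ := abs_sum_vonMangoldt_sub_le A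
  obtain ⟨C₃, hC₃, h3⟩ := exists_log_pow_le_rpow (2 * A + 2) one_pos
  refine ⟨2 ^ A * C₁ + C₂ + 3 * 2 ^ A * C₃, by positivity, fun N hN q a hq hqL => ?_⟩
  have hL1 := one_le_log_add_two hN
  have hnc := sum_vonMangoldt_not_coprime_le hN hq
  have h1N := fun (χ : DirichletCharacter ℂ q) (h : χ ≠ 1) =>
    have : NeZero q := ⟨by omega⟩
    h1 q χ h N hN
  have h2N := h2 N hN
  have h3N := h3 N hN
  rw [Real.rpow_one] at h3N
  set L := Real.log (N + 2) with hL
  have hLA : 0 < L ^ A := by positivity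
  have hnc' : ∑ n ∈ (Icc 1 N).filter (fun n => ¬ n.Coprime q), Λ n ≤ 3 * 2 ^ A * C₃ * N / L ^ A := by
    refine hnc.trans ?_
    rw [le_div_iff₀ hLA]
    have hpf : (#q.primeFactors : ℝ) ≤ q := by
      have : #q.primeFactors ≤ #(Icc 1 q) := card_le_card fun p hp => by
        rw [Nat.mem_primeFactors] at hp
        exact mem_Icc.mpr ⟨hp.1.one_le, Nat.le_of_dvd hq hp.2.1⟩
      rw [Nat.card_Icc, Nat.add_sub_cancel] at this
      exact_mod_cast this
    calc 3 * (#q.primeFactors : ℝ) * L ^ 2 * L ^ A ≤ 3 * (2 * L) ^ A * L ^ 2 * L ^ A := by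
          gcongr
          exact hpf.trans hqL
      _ = 3 * 2 ^ A * L ^ (2 * A + 2) := by rw [mul_pow]; ring
      _ ≤ 3 * 2 ^ A * (C₃ * N) := by gcongr
      _ = _ := by ring
  have hsplitC : (2 ^ A * C₁ + C₂ + 3 * 2 ^ A * C₃) * N / L ^ A =
      2 ^ A * C₁ * N / L ^ A + C₂ * N / L ^ A + 3 * 2 ^ A * C₃ * N / L ^ A := by ring
  have p1 : 0 ≤ 2 ^ A * C₁ * N / L ^ A := by positivity
  have p2 : 0 ≤ C₂ * N / L ^ A := by positivity
  rw [hsplitC]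
  split_ifs with ha
  · have : NeZero q := ⟨by omega⟩
    have hφ : 0 < q.totient := Nat.totient_pos.mpr hq
    have hφr : (1 : ℝ) ≤ q.totient := by exact_mod_cast hφ
    set S := ∑ n ∈ (Icc 1 N).filter (fun n => n % q = a % q), Λ n with hS
    have horth := totient_mul_sum_residue_eq ha N
    rw [Fintype.sum_eq_add_sum_compl (1 : DirichletCharacter ℂ q)] at horth
    have hunit : IsUnit (a : ZMod q)⁻¹ := by
      have := (ZMod.isUnit_iff_coprime a q).mpr ha
      rw [← ZMod.coe_unitOfCoprime a ha, ZMod.inv_coe_unit]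
      exact Units.isUnit _
    have hprin : (1 : DirichletCharacter ℂ q) (a : ZMod q)⁻¹ *
        ∑ n ∈ Icc 1 N, (1 : DirichletCharacter ℂ q) n * (Λ n : ℂ) =
        ((∑ n ∈ Icc 1 N, Λ n - ∑ n ∈ (Icc 1 N).filter (fun n => ¬ n.Coprime q), Λ n : ℝ) : ℂ) := by
      rw [MulChar.one_apply hunit, one_mul,
        ← sum_filter_add_sum_filter_not (Icc 1 N) (fun n => n.Coprime q) Λ, add_sub_cancel_right,
        sum_filter]
      push_cast
      refine sum_congr rfl fun n _ => ?_
      by_cases h : n.Coprime q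
      · rw [if_pos h, MulChar.one_apply ((ZMod.isUnit_iff_coprime n q).mpr h), one_mul]
      · rw [if_neg h, MulChar.map_nonunit _ (fun h2 => h ((ZMod.isUnit_iff_coprime n q).mp h2)),
          zero_mul, Complex.ofReal_zero]
    have hrest : ‖∑ χ ∈ ({1} : Finset (DirichletCharacter ℂ q))ᶜ,
        χ (a : ZMod q)⁻¹ * ∑ n ∈ Icc 1 N, χ n * (Λ n : ℂ)‖ ≤
        q.totient * (2 ^ A * C₁ * N / L ^ A) := by
      have hle : ∀ χ ∈ ({1} : Finset (DirichletCharacter ℂ q))ᶜ,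
          ‖χ (a : ZMod q)⁻¹ * ∑ n ∈ Icc 1 N, χ n * (Λ n : ℂ)‖ ≤ 2 ^ A * C₁ * N / L ^ A := by
        intro χ hχ
        rw [mem_compl, mem_singleton] at hχ
        rw [norm_mul]
        have hq1 : (q : ℝ) ^ (1 / 2 : ℝ) ≤ (2 * L) ^ A := by
          refine le_trans ?_ hqL
          have : (1 : ℝ) ≤ q := by exact_mod_cast hq
          calc (q : ℝ) ^ (1 / 2 : ℝ) ≤ (q : ℝ) ^ (1 : ℝ) :=
                Real.rpow_le_rpow_of_exponent_le this (by norm_num)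
            _ = q := Real.rpow_one _
        calc _ ≤ 1 * (C₁ * (q : ℝ) ^ (1 / 2 : ℝ) * N / L ^ (2 * A)) :=
              mul_le_mul (χ.norm_le_one _) (h1N χ hχ) (norm_nonneg _) zero_le_one
          _ ≤ C₁ * (2 * L) ^ A * N / L ^ (2 * A) := by
              rw [one_mul]
              gcongr
          _ = _ := by
              rw [two_mul A, pow_add, mul_pow]
              field_simp
      refine (norm_sum_le_of_le _ hle).trans ?_
      rw [sum_const, nsmul_eq_mul]
      gcongr
      refine (card_le_univ _).trans ?_
      rw [← Nat.card_eq_fintype_card]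
      exact (DirichletCharacter.card_eq_totient_of_hasEnoughRootsOfUnity ℂ q).le
    rw [hprin] at horth
    set D := ∑ n ∈ (Icc 1 N).filter (fun n => ¬ n.Coprime q), Λ n with hD
    have hD0 : 0 ≤ D := sum_nonneg fun n _ => ArithmeticFunction.vonMangoldt_nonneg
    have hkey : ‖((q.totient * (S - N / q.totient) : ℝ) : ℂ)‖ ≤
        C₂ * N / L ^ A + 3 * 2 ^ A * C₃ * N / L ^ A + q.totient * (2 ^ A * C₁ * N / L ^ A) := by
      have he : ((q.totient * (S - N / q.totient) : ℝ) : ℂ) =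
          ((∑ n ∈ Icc 1 N, Λ n - N : ℝ) : ℂ) - ((D : ℝ) : ℂ) +
            ∑ χ ∈ ({1} : Finset (DirichletCharacter ℂ q))ᶜ,
              χ (a : ZMod q)⁻¹ * ∑ n ∈ Icc 1 N, χ n * (Λ n : ℂ) := by
        have e1 : (q.totient * (S - N / q.totient) : ℝ) = q.totient * S - N := by
          field_simp
        have e2 : ((S : ℝ) : ℂ) = ∑ n ∈ (Icc 1 N).filter (fun n => n % q = a % q), (Λ n : ℂ) := by
          rw [hS]; push_cast; rfl
        rw [e1, Complex.ofReal_sub, Complex.ofReal_mul, Complex.ofReal_natCast, e2, horth]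
        push_cast
        ring
      rw [he]
      refine (norm_add_le _ _).trans (add_le_add ((norm_sub_le _ _).trans (add_le_add ?_ ?_)) hrest)
      · rw [Complex.norm_real, Real.norm_eq_abs]
        exact h2N
      · rw [Complex.norm_real, Real.norm_of_nonneg hD0]
        exact hnc'
    rw [Complex.norm_real, Real.norm_eq_abs, abs_mul, Nat.abs_cast] at hkey
    have p3 : 0 ≤ C₂ * N / L ^ A + 3 * 2 ^ A * C₃ * N / L ^ A := by positivity
    have : (q.totient : ℝ) * |S - N / q.totient| ≤
        q.totient * (2 ^ A * C₁ * N / L ^ A + C₂ * N / L ^ A + 3 * 2 ^ A * C₃ * N / L ^ A) := by nlinarith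
    exact le_of_mul_le_mul_left this (by linarith)
  · rw [sub_zero, abs_of_nonneg (sum_nonneg fun n _ => ArithmeticFunction.vonMangoldt_nonneg)]
    have : ∑ n ∈ (Icc 1 N).filter (fun n => n % q = a % q), Λ n ≤
        ∑ n ∈ (Icc 1 N).filter (fun n => ¬ n.Coprime q), Λ n := by
      refine sum_le_sum_of_subset_of_nonneg (fun n hn => ?_)
        fun n _ _ => ArithmeticFunction.vonMangoldt_nonneg
      rw [mem_filter] at hn ⊢
      refine ⟨hn.1, fun h => ha ?_⟩
      rw [Nat.Coprime, Nat.gcd_comm, Nat.gcd_rec] at h ⊢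
      rwa [← hn.2]
    linarith

end SiegelWalfisz

section PrimeSums

open scoped ArithmeticFunction.vonMangoldt

lemma sum_vonMangoldt_le_mul_log {M N : ℕ} (hMN : M ≤ N) :
    ∑ n ∈ Icc 1 M, Λ n ≤ M * Real.log (N + 2) := by
  have : ∀ n ∈ Icc 1 M, Λ n ≤ Real.log (N + 2) := fun n hn => by
    refine (vonMangoldt_le_log_add_two n).trans ?_
    have : (n : ℝ) ≤ N := by exact_mod_cast (mem_Icc.mp hn).2.trans hMN
    gcongr
  refine (sum_le_sum this).trans ?_
  simp

theorem siegel_walfisz_uniform (A : ℕ) : ∃ C : ℝ, 0 < C ∧ ∀ N : ℕ, 1 ≤ N → ∀ M ≤ N,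
    ∀ q a : ℕ, 1 ≤ q → (q : ℝ) ≤ Real.log (N + 2) ^ A →
    |∑ n ∈ (Icc 1 M).filter (fun n => n % q = a % q), Λ n -
      if a.Coprime q then (M : ℝ) / q.totient else 0| ≤ C * N / Real.log (N + 2) ^ A := by
  obtain ⟨C₁, hC₁, h1⟩ := siegel_walfisz A
  obtain ⟨C₂, hC₂, h2⟩ := exists_log_pow_le_rpow (A + 1) (ε := 1 / 2) (by norm_num)
  refine ⟨C₁ * 2 ^ A + C₂, by positivity, fun N hN M hMN q a hq hqL => ?_⟩
  have hL1 := one_le_log_add_two hN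
  have h2N := h2 N hN
  set L := Real.log (N + 2) with hL
  have hN1 : (1 : ℝ) ≤ N := by exact_mod_cast hN
  have hMN' : (M : ℝ) ≤ N := by exact_mod_cast hMN
  have hLA : 0 < L ^ A := by positivity
  have hsum : (C₁ * 2 ^ A + C₂) * N / L ^ A = C₁ * 2 ^ A * N / L ^ A + C₂ * N / L ^ A := by ring
  have p1 : 0 ≤ C₁ * 2 ^ A * N / L ^ A := by positivity
  have p2 : 0 ≤ C₂ * N / L ^ A := by positivity
  rw [hsum]
  by_cases hM : N ≤ M ^ 2
  · have hM1 : 1 ≤ M := by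
      by_contra h
      simp only [not_le, Nat.lt_one_iff] at h
      rw [h] at hM
      omega
    set ℓ := Real.log (M + 2) with hℓ
    have hℓ1 : 1 ≤ ℓ := one_le_log_add_two hM1
    have hLℓ : L ≤ 2 * ℓ := by
      have : L ≤ Real.log (((M : ℝ) + 2) ^ 2) := by
        apply Real.log_le_log (by positivity)
        have : (N : ℝ) ≤ M ^ 2 := by exact_mod_cast hM
        nlinarith
      rwa [Real.log_pow, Nat.cast_ofNat] at this
    refine (h1 M hM1 q a hq (hqL.trans (by gcongr))).trans ?_
    have : C₁ * M / ℓ ^ A ≤ C₁ * 2 ^ A * N / L ^ A := by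
      rw [div_le_div_iff₀ (by positivity) hLA]
      calc C₁ * M * L ^ A ≤ C₁ * N * (2 * ℓ) ^ A := by gcongr
        _ = _ := by rw [mul_pow]; ring
    linarith
  · have hMs : (M : ℝ) ≤ (N : ℝ) ^ (1 / 2 : ℝ) := by
      rw [← Real.sqrt_eq_rpow]
      apply Real.le_sqrt_of_sq_le
      exact_mod_cast (not_le.mp hM).le
    have hNN : (N : ℝ) ^ (1 / 2 : ℝ) * (N : ℝ) ^ (1 / 2 : ℝ) = N := by
      rw [← Real.rpow_add (by linarith)]
      norm_num
    have hML : (M : ℝ) * L ≤ C₂ * N / L ^ A := by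
      rw [le_div_iff₀ hLA]
      calc (M : ℝ) * L * L ^ A = M * L ^ (A + 1) := by ring
        _ ≤ (N : ℝ) ^ (1 / 2 : ℝ) * (C₂ * (N : ℝ) ^ (1 / 2 : ℝ)) := by gcongr
        _ = C₂ * ((N : ℝ) ^ (1 / 2 : ℝ) * (N : ℝ) ^ (1 / 2 : ℝ)) := by ring
        _ = _ := by rw [hNN]
    have e1 : 0 ≤ ∑ n ∈ (Icc 1 M).filter (fun n => n % q = a % q), Λ n :=
      sum_nonneg fun n _ => ArithmeticFunction.vonMangoldt_nonneg
    have e2 : ∑ n ∈ (Icc 1 M).filter (fun n => n % q = a % q), Λ n ≤ M * L :=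
      (sum_le_sum_of_subset_of_nonneg (filter_subset _ _)
        fun n _ _ => ArithmeticFunction.vonMangoldt_nonneg).trans (sum_vonMangoldt_le_mul_log hMN)
    have e3 : 0 ≤ if a.Coprime q then (M : ℝ) / q.totient else 0 := by
      split_ifs <;> positivity
    have e4 : (if a.Coprime q then (M : ℝ) / q.totient else 0) ≤ M * L := by
      have hM0 : (0 : ℝ) ≤ M := by positivity
      split_ifs
      · refine (div_le_self hM0 ?_).trans (le_mul_of_one_le_right hM0 hL1)
        exact_mod_cast Nat.totient_pos.mpr hq
      · positivity
    rw [abs_le]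
    constructor <;> linarith

lemma abs_sum_vonMangoldt_sub_le_uniform (A : ℕ) : ∃ C : ℝ, 0 < C ∧ ∀ N : ℕ, 1 ≤ N → ∀ M ≤ N,
    |∑ n ∈ Icc 1 M, Λ n - M| ≤ C * N / Real.log (N + 2) ^ A := by
  obtain ⟨C, hC, h⟩ := siegel_walfisz_uniform A
  refine ⟨C, hC, fun N hN M hM => ?_⟩
  have := h N hN M hM 1 0 le_rfl (by
    rw [Nat.cast_one]
    exact one_le_pow₀ (one_le_log_add_two hN))
  simpa [Nat.mod_one] using this

lemma exists_sum_vonMangoldt_le : ∃ C : ℝ, 0 < C ∧ ∀ N : ℕ, ∑ n ∈ Icc 1 N, Λ n ≤ C * N := by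
  obtain ⟨C, hC, h⟩ := abs_sum_vonMangoldt_sub_le 0
  refine ⟨C + 1, by positivity, fun N => ?_⟩
  rcases Nat.eq_zero_or_pos N with rfl | hN
  · simp
  · have := (abs_le.mp (h N hN)).2
    rw [pow_zero, div_one] at this
    linarith

lemma abs_sum_log_sub_le {N : ℕ} (hN : 1 ≤ N) :
    |∑ n ∈ Icc 1 N, Real.log n - (N * Real.log N - N)| ≤ Real.log N + 1 := by
  have key : 0 ≤ ∑ n ∈ Icc 1 N, Real.log n - (N * Real.log N - N) ∧
      ∑ n ∈ Icc 1 N, Real.log n - (N * Real.log N - N) ≤ Real.log N + 1 := by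
    induction N, hN using Nat.le_induction with
    | base => simp
    | succ n hn ih =>
      have hn0 : (0 : ℝ) < n := by exact_mod_cast hn
      rw [sum_Icc_succ_top (by omega)]
      push_cast
      have h1 : Real.log ((n + 1) / n) ≤ (n + 1) / n - 1 := Real.log_le_sub_one_of_pos (by positivity)
      have h2 : Real.log (n / (n + 1)) ≤ n / (n + 1) - 1 := Real.log_le_sub_one_of_pos (by positivity)
      rw [Real.log_div (by positivity) (by positivity)] at h1 h2
      have h3 : n * (((n : ℝ) + 1) / n - 1) = 1 := by field_simp; ring
      have h4 : ((n : ℝ) + 1) * (n / (n + 1) - 1) = -1 := by field_simp; ring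
      have h5 : (n : ℝ) * (Real.log (n + 1) - Real.log n) ≤ 1 :=
        (mul_le_mul_of_nonneg_left h1 hn0.le).trans_eq h3
      have h6 : ((n : ℝ) + 1) * (Real.log n - Real.log (n + 1)) ≤ -1 :=
        (mul_le_mul_of_nonneg_left h2 (by positivity)).trans_eq h4
      constructor <;> nlinarith [ih.1, ih.2]
  rw [abs_of_nonneg key.1]
  exact key.2

lemma sum_not_prime_le {N : ℕ} (hN : 1 ≤ N) :
    ∑ n ∈ (Icc 1 N).filter (fun n => ¬ n.Prime), Λ n ≤
      3 * (N : ℝ) ^ (1 / 2 : ℝ) * Real.log (N + 2) ^ 2 := by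
  set L := Real.log (N + 2) with hL
  have hL1 : 1 ≤ L := one_le_log_add_two hN
  have hN1 : (1 : ℝ) ≤ N := by exact_mod_cast hN
  set T := (Icc 1 (Nat.sqrt N) ×ˢ range (Nat.log 2 N + 1)).image fun x => x.1 ^ x.2 with hT
  have hcard : (#T : ℝ) ≤ (N : ℝ) ^ (1 / 2 : ℝ) * (3 * L) := by
    have h1 : #T ≤ Nat.sqrt N * (Nat.log 2 N + 1) := by
      refine card_image_le.trans ?_
      rw [card_product, card_range, Nat.card_Icc, Nat.add_sub_cancel]
    have h2 : ((Nat.log 2 N : ℕ) : ℝ) ≤ 2 * L := by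
      refine (Real.natLog_le_logb N 2).trans ?_
      rw [Real.logb, Nat.cast_ofNat, div_le_iff₀ (Real.log_pos (by norm_num))]
      have h3 : Real.log N ≤ L := Real.log_le_log (by linarith) (by linarith)
      nlinarith [Real.log_two_gt_d9]
    have h3 : (Nat.sqrt N : ℝ) ≤ (N : ℝ) ^ (1 / 2 : ℝ) := by
      rw [← Real.sqrt_eq_rpow]
      exact Real.nat_sqrt_le_real_sqrt
    calc (#T : ℝ) ≤ Nat.sqrt N * (Nat.log 2 N + 1) := by exact_mod_cast h1
      _ ≤ _ := by gcongr; linarith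
  have hsub : ∀ n ∈ (Icc 1 N).filter (fun n => ¬ n.Prime), n ∉ T → Λ n = 0 := by
    intro n hn hnT
    by_contra h0
    rw [← Ne, ArithmeticFunction.vonMangoldt_ne_zero_iff, isPrimePow_nat_iff] at h0
    obtain ⟨p, k, hp, hk, rfl⟩ := h0
    rw [mem_filter, mem_Icc] at hn
    refine hnT (mem_image.mpr ⟨(p, k), mem_product.mpr ⟨?_, ?_⟩, rfl⟩)
    · refine mem_Icc.mpr ⟨hp.one_le, Nat.le_sqrt'.mpr (le_trans ?_ hn.1.2)⟩
      refine Nat.pow_le_pow_right hp.pos ?_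
      by_contra h
      have : k = 1 := by omega
      exact hn.2 (by rwa [this, pow_one])
    · rw [mem_range]
      have := Nat.le_log_of_pow_le one_lt_two ((Nat.pow_le_pow_left hp.two_le k).trans hn.1.2)
      simp only
      omega
  calc ∑ n ∈ (Icc 1 N).filter (fun n => ¬ n.Prime), Λ n
      = ∑ n ∈ ((Icc 1 N).filter (fun n => ¬ n.Prime)).filter (· ∈ T), Λ n := by
        refine (sum_filter_of_ne fun n hn h0 => ?_).symm
        by_contra h
        exact h0 (hsub n hn h)
    _ ≤ ∑ _n ∈ ((Icc 1 N).filter (fun n => ¬ n.Prime)).filter (· ∈ T), L := by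
        refine sum_le_sum fun n hn => ?_
        rw [mem_filter, mem_filter, mem_Icc] at hn
        have : (n : ℝ) ≤ N := by exact_mod_cast hn.1.1.2
        refine (vonMangoldt_le_log_add_two n).trans ?_
        rw [hL]
        gcongr
    _ ≤ #T * L := by
        rw [sum_const, nsmul_eq_mul]
        gcongr
        intro n hn
        exact (mem_filter.mp hn).2
    _ ≤ (N : ℝ) ^ (1 / 2 : ℝ) * (3 * L) * L := by gcongr
    _ = _ := by ring

lemma abs_sum_vonMangoldt_mul_log_sub_le (A : ℕ) : ∃ C : ℝ, 0 < C ∧ ∀ N : ℕ, 1 ≤ N →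
    |∑ n ∈ Icc 1 N, Λ n * Real.log n - (N * Real.log N - N)| ≤
      C * N / Real.log (N + 2) ^ A := by
  obtain ⟨C₁, hC₁, h1⟩ := abs_sum_vonMangoldt_sub_le_uniform (A + 1)
  obtain ⟨C₂, hC₂, h2⟩ := exists_log_pow_le_rpow (A + 1) one_pos
  refine ⟨3 * C₁ + 2 * C₂, by positivity, fun N hN => ?_⟩
  have hL1 := one_le_log_add_two hN
  have h1N := h1 N hN
  have h2N := h2 N hN
  have hN1 : (1 : ℝ) ≤ N := by exact_mod_cast hN
  have hlog0 : 0 ≤ Real.log N := Real.log_nonneg hN1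
  have hlogL : Real.log N ≤ Real.log (N + 2) := Real.log_le_log (by linarith) (by linarith)
  have hst := abs_sum_log_sub_le hN
  set L := Real.log (N + 2) with hL
  rw [Real.rpow_one] at h2N
  set K := C₁ * N / L ^ (A + 1) with hK
  have hK0 : 0 ≤ K := by positivity
  have habel := norm_sum_Ioc_mul_le (b := fun n => ((Λ n - 1 : ℝ) : ℂ))
    (g := fun n => Real.log N - Real.log n) (K := K) (m := 0) (N := N) (by omega)
    (fun n hn hnN => sub_nonneg.mpr
      (Real.log_le_log (by exact_mod_cast hn) (by exact_mod_cast hnN)))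
    (fun n hn hnN => by
      have : Real.log n ≤ Real.log ((n + 1 : ℕ) : ℝ) :=
        Real.log_le_log (by exact_mod_cast hn) (by push_cast; linarith)
      linarith)
    (fun n hn hnN => by
      have := h1N n hnN
      rw [← Complex.ofReal_sum, Complex.norm_real, Real.norm_eq_abs, sum_sub_distrib]
      simpa using this)
  have hre : ∑ n ∈ Ioc 0 N, ((Real.log N - Real.log n : ℝ) : ℂ) * ((Λ n - 1 : ℝ) : ℂ) =
      ((∑ n ∈ Icc 1 N, (Real.log N - Real.log n) * (Λ n - 1) : ℝ) : ℂ) := by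
    push_cast
    rfl
  rw [hre, Complex.norm_real, Real.norm_eq_abs] at habel
  simp only [zero_add, Nat.cast_one, Real.log_one, sub_zero] at habel
  have hexp : ∑ n ∈ Icc 1 N, (Real.log N - Real.log n) * (Λ n - 1) =
      Real.log N * (∑ n ∈ Icc 1 N, Λ n - N) -
        (∑ n ∈ Icc 1 N, Λ n * Real.log n - ∑ n ∈ Icc 1 N, Real.log n) := by
    have : ∀ n ∈ Icc 1 N, (Real.log N - Real.log n) * (Λ n - 1) =
        Real.log N * Λ n - Real.log N - (Λ n * Real.log n - Real.log n) := fun n _ => by ring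
    rw [sum_congr rfl this, sum_sub_distrib, sum_sub_distrib, sum_sub_distrib, ← mul_sum]
    simp
    ring
  rw [hexp] at habel
  have hP := h1N N le_rfl
  have hP2 : |Real.log N * (∑ n ∈ Icc 1 N, Λ n - N)| ≤ Real.log N * K := by
    rw [abs_mul, abs_of_nonneg hlog0]
    gcongr
  have hKL : K * L = C₁ * N / L ^ A := by
    rw [hK, pow_succ]
    field_simp
  have hKL2 : K * Real.log N ≤ C₁ * N / L ^ A := hKL ▸ by gcongr
  have hlogfin : Real.log N + 1 ≤ 2 * C₂ * N / L ^ A := by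
    rw [le_div_iff₀ (by positivity)]
    calc (Real.log N + 1) * L ^ A ≤ (2 * L) * L ^ A := by gcongr; linarith
      _ = 2 * L ^ (A + 1) := by ring
      _ ≤ _ := by linarith
  have hfin : (3 * C₁ + 2 * C₂) * N / L ^ A = 3 * (C₁ * N / L ^ A) + 2 * C₂ * N / L ^ A := by ring
  rw [hfin]
  rw [abs_le] at habel hP2 hst ⊢
  constructor <;> linarith [habel.1, habel.2, hP2.1, hP2.2, hst.1, hst.2]

lemma abs_sum_vonMangoldt_sq_sub_le (A : ℕ) : ∃ C : ℝ, 0 < C ∧ ∀ N : ℕ, 1 ≤ N →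
    |∑ n ∈ Icc 1 N, Λ n ^ 2 - (N * Real.log N - N)| ≤ C * N / Real.log (N + 2) ^ A := by
  obtain ⟨C₁, hC₁, h1⟩ := abs_sum_vonMangoldt_mul_log_sub_le A
  obtain ⟨C₂, hC₂, h2⟩ := exists_log_pow_le_rpow (A + 3) (ε := 1 / 2) (by norm_num)
  refine ⟨C₁ + 3 * C₂, by positivity, fun N hN => ?_⟩
  have hL1 := one_le_log_add_two hN
  have h1N := h1 N hN
  have h2N := h2 N hN
  have hnp := sum_not_prime_le hN
  have hN1 : (1 : ℝ) ≤ N := by exact_mod_cast hN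
  have hNN : (N : ℝ) ^ (1 / 2 : ℝ) * (N : ℝ) ^ (1 / 2 : ℝ) = N := by
    rw [← Real.rpow_add (by linarith)]
    norm_num
  set L := Real.log (N + 2) with hL
  have hd : ∑ n ∈ Icc 1 N, Λ n * Real.log n - ∑ n ∈ Icc 1 N, Λ n ^ 2 =
      ∑ n ∈ (Icc 1 N).filter (fun n => ¬ n.Prime), Λ n * (Real.log n - Λ n) := by
    rw [← sum_sub_distrib, sum_filter]
    refine sum_congr rfl fun n _ => ?_
    split_ifs with h
    · rw [ArithmeticFunction.vonMangoldt_apply_prime h]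
      ring
    · ring
  have hd0 : 0 ≤ ∑ n ∈ (Icc 1 N).filter (fun n => ¬ n.Prime), Λ n * (Real.log n - Λ n) :=
    sum_nonneg fun n _ => mul_nonneg ArithmeticFunction.vonMangoldt_nonneg
      (sub_nonneg.mpr ArithmeticFunction.vonMangoldt_le_log)
  have hd1 : ∑ n ∈ (Icc 1 N).filter (fun n => ¬ n.Prime), Λ n * (Real.log n - Λ n) ≤
      3 * C₂ * N / L ^ A := by
    rw [le_div_iff₀ (by positivity)]
    calc (∑ n ∈ (Icc 1 N).filter (fun n => ¬ n.Prime), Λ n * (Real.log n - Λ n)) * L ^ A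
        ≤ (∑ n ∈ (Icc 1 N).filter (fun n => ¬ n.Prime), Λ n * L) * L ^ A := by
          gcongr with n hn
          rw [mem_filter, mem_Icc] at hn
          have h3 : (n : ℝ) ≤ N := by exact_mod_cast hn.1.2
          have h4 : (0 : ℝ) < n := by exact_mod_cast hn.1.1
          have h5 : Real.log n ≤ L := Real.log_le_log h4 (by linarith)
          have : 0 ≤ Λ n := ArithmeticFunction.vonMangoldt_nonneg
          linarith
      _ ≤ 3 * (N : ℝ) ^ (1 / 2 : ℝ) * L ^ 2 * L * L ^ A := by
          rw [← sum_mul]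
          gcongr
      _ = 3 * (N : ℝ) ^ (1 / 2 : ℝ) * L ^ (A + 3) := by ring
      _ ≤ 3 * (N : ℝ) ^ (1 / 2 : ℝ) * (C₂ * (N : ℝ) ^ (1 / 2 : ℝ)) := by gcongr
      _ = 3 * C₂ * ((N : ℝ) ^ (1 / 2 : ℝ) * (N : ℝ) ^ (1 / 2 : ℝ)) := by ring
      _ = _ := by rw [hNN]
  have hfin : (C₁ + 3 * C₂) * N / L ^ A = C₁ * N / L ^ A + 3 * C₂ * N / L ^ A := by ring
  rw [hfin]
  rw [abs_le] at h1N ⊢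
  constructor <;> linarith [h1N.1, h1N.2]

end PrimeSums

section LargeSieve

open Complex

/-- `expPhase t = exp(2πit)`. -/
noncomputable def expPhase (t : ℝ) : ℂ := exp (2 * Real.pi * t * I)

lemma norm_expPhase (t : ℝ) : ‖expPhase t‖ = 1 := by
  have := norm_exp_ofReal_mul_I (2 * Real.pi * t)
  push_cast at this
  exact this

lemma expPhase_add (s t : ℝ) : expPhase (s + t) = expPhase s * expPhase t := by
  rw [expPhase, expPhase, expPhase, ← exp_add]
  congr 1
  push_cast
  ring

lemma expPhase_int (k : ℤ) : expPhase k = 1 := by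
  rw [expPhase, exp_eq_one_iff]
  exact ⟨k, by push_cast; ring⟩

lemma conj_expPhase (t : ℝ) : starRingEnd ℂ (expPhase t) = expPhase (-t) := by
  rw [expPhase, expPhase, ← exp_conj]
  congr 1
  simp only [map_mul, conj_I, conj_ofReal, map_ofNat]
  push_cast
  ring

lemma expPhase_natCast_mul (n : ℕ) (t : ℝ) : expPhase (n * t) = expPhase t ^ n := by
  rw [expPhase, expPhase, ← exp_nat_mul]
  congr 1
  push_cast
  ring

/-- The Dirichlet kernel `∑_{n ≤ N} exp(2πint)`. -/
noncomputable def dirichletKernel (N : ℕ) (t : ℝ) : ℂ := ∑ n ∈ Icc 1 N, expPhase (n * t)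

lemma norm_dirichletKernel_le (N : ℕ) (t : ℝ) : ‖dirichletKernel N t‖ ≤ N := by
  refine (norm_sum_le _ _).trans ?_
  simp [norm_expPhase]

lemma norm_dirichletKernel_neg (N : ℕ) (t : ℝ) :
    ‖dirichletKernel N (-t)‖ = ‖dirichletKernel N t‖ := by
  have : dirichletKernel N (-t) = starRingEnd ℂ (dirichletKernel N t) := by
    rw [dirichletKernel, dirichletKernel, map_sum]
    refine sum_congr rfl fun n _ => ?_
    rw [conj_expPhase, mul_neg]
  rw [this, norm_conj]

lemma dirichletKernel_sub_int (N : ℕ) (t : ℝ) (k : ℤ) :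
    dirichletKernel N (t - k) = dirichletKernel N t := by
  refine sum_congr rfl fun n _ => ?_
  have : (n : ℝ) * (t - k) = n * t + ((-(n * k) : ℤ) : ℝ) := by push_cast; ring
  rw [this, expPhase_add, expPhase_int, mul_one]

lemma norm_dirichletKernel_le_inv (N : ℕ) {u : ℝ} (hu : 0 < u) (hu2 : u ≤ 1 / 2) :
    ‖dirichletKernel N u‖ ≤ 1 / (2 * u) := by
  have hsin : 4 * u ≤ ‖expPhase u - 1‖ := by
    have h1 : expPhase u = exp (I * ((2 * Real.pi * u : ℝ) : ℂ)) := by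
      rw [expPhase]
      congr 1
      push_cast
      ring
    rw [h1, norm_exp_I_mul_ofReal_sub_one, Real.norm_eq_abs]
    refine le_trans ?_ (le_abs_self _)
    have h2 := Real.mul_le_sin (x := 2 * Real.pi * u / 2) (by positivity)
      (by nlinarith [Real.pi_pos])
    have h3 : 2 / Real.pi * (2 * Real.pi * u / 2) = 2 * u := by
      field_simp
    linarith
  have hne : expPhase u - 1 ≠ 0 := fun h => by
    rw [h, norm_zero] at hsin
    linarith
  have hgeom : dirichletKernel N u * (expPhase u - 1) =
      expPhase u * (expPhase u ^ N - 1) := by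
    rw [← geom_sum_mul, ← mul_assoc, mul_sum]
    congr 1
    rw [dirichletKernel, range_eq_Ico, sum_Ico_eq_sum_range, Nat.sub_zero,
      ← Ico_add_one_right_eq_Icc, sum_Ico_eq_sum_range]
    refine sum_congr (by simp) fun n _ => ?_
    rw [expPhase_natCast_mul, pow_add, pow_one, zero_add]
  have hb : ‖dirichletKernel N u‖ * ‖expPhase u - 1‖ ≤ 2 := by
    rw [← norm_mul, hgeom, norm_mul, norm_expPhase, one_mul]
    refine (norm_sub_le _ _).trans ?_
    rw [norm_pow, norm_expPhase, one_pow, norm_one]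
    norm_num
  rw [le_div_iff₀ (by positivity)]
  nlinarith [norm_nonneg (dirichletKernel N u)]

lemma sum_inv_le_one_add_log (J : ℕ) : ∑ j ∈ Icc 1 J, (1 : ℝ) / j ≤ 1 + Real.log J := by
  have h := harmonic_le_one_add_log J
  rw [harmonic_eq_sum_Icc] at h
  push_cast at h
  simpa [one_div] using h

lemma sum_kernel_half_le {ι : Type*} (P : Finset ι) (u : ι → ℝ) {N J : ℕ} (hJ : 1 ≤ J)
    (hu0 : ∀ p ∈ P, 0 ≤ u p) (hu1 : ∀ p ∈ P, u p ≤ 1 / 2)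
    (hsp : ∀ p ∈ P, ∀ p' ∈ P, p ≠ p' → 1 / J ≤ |u p - u p'|) :
    ∑ p ∈ P, ‖dirichletKernel N (u p)‖ ≤ N + J / 2 * (1 + Real.log J) := by
  have hJ0 : (0 : ℝ) < J := by exact_mod_cast hJ
  set f : ι → ℕ := fun p => ⌊u p * J⌋₊ with hf
  set B : ℕ → ℝ := fun j => if j = 0 then (N : ℝ) else J / 2 * (1 / j) with hB
  have hB0 : ∀ j, 0 ≤ B j := fun j => by
    rw [hB]
    simp only
    split_ifs <;> positivity
  have hle : ∀ p ∈ P, ‖dirichletKernel N (u p)‖ ≤ B (f p) := by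
    intro p hp
    rw [hB]
    simp only
    split_ifs with h
    · exact norm_dirichletKernel_le N _
    · have hfl : (f p : ℝ) ≤ u p * J := Nat.floor_le (mul_nonneg (hu0 p hp) hJ0.le)
      have hf1 : (0 : ℝ) < f p := by exact_mod_cast Nat.pos_of_ne_zero h
      have hup : 0 < u p := by
        by_contra hc
        nlinarith [hu0 p hp]
      refine (norm_dirichletKernel_le_inv N hup (hu1 p hp)).trans ?_
      rw [div_mul_div_comm, mul_one, div_le_div_iff₀ (by positivity) (by positivity)]
      linarith
  have hinj : Set.InjOn f P := by
    intro p hp p' hp' h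
    by_contra hne
    have h1 := hsp p hp p' hp' hne
    have e1 := Nat.floor_le (mul_nonneg (hu0 p hp) hJ0.le)
    have e2 := Nat.lt_floor_add_one (u p * J)
    have e3 := Nat.floor_le (mul_nonneg (hu0 p' hp') hJ0.le)
    have e4 := Nat.lt_floor_add_one (u p' * J)
    simp only [hf] at h
    rw [h] at e1 e2
    have h2 : |u p - u p'| * J < 1 := by
      have h3 : |u p - u p'| * J = |(u p - u p') * J| := by rw [abs_mul, abs_of_pos hJ0]
      rw [h3, abs_lt, sub_mul]
      constructor <;> linarith
    rw [div_le_iff₀ hJ0] at h1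
    linarith
  calc ∑ p ∈ P, ‖dirichletKernel N (u p)‖ ≤ ∑ p ∈ P, B (f p) := sum_le_sum hle
    _ = ∑ j ∈ P.image f, B j := (sum_image hinj).symm
    _ ≤ ∑ j ∈ range (J + 1), B j := by
        refine sum_le_sum_of_subset_of_nonneg (fun j hj => ?_) fun j _ _ => hB0 j
        obtain ⟨p, hp, rfl⟩ := mem_image.mp hj
        rw [mem_range, Nat.lt_succ_iff, hf]
        simp only
        apply Nat.floor_le_of_le
        nlinarith [hu1 p hp]
    _ = N + J / 2 * ∑ j ∈ Icc 1 J, (1 : ℝ) / j := by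
        rw [sum_range_succ', add_comm, mul_sum, ← Ico_add_one_right_eq_Icc, sum_Ico_eq_sum_range]
        congr 1
        refine sum_congr (by simp) fun j _ => ?_
        simp only [hB]
        rw [if_neg (by omega), add_comm 1 j]
    _ ≤ _ := by
        gcongr
        exact sum_inv_le_one_add_log J

lemma sum_kernel_le {ι : Type*} [DecidableEq ι] (P : Finset ι) (α : ι → ℝ) {N J : ℕ} (hJ : 1 ≤ J)
    (hsp : ∀ p ∈ P, ∀ p' ∈ P, p ≠ p' → ∀ k : ℤ, 1 / J ≤ |α p - α p' - k|) (β : ℝ) :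
    ∑ p ∈ P, ‖dirichletKernel N (α p - β)‖ ≤ 2 * N + J * (1 + Real.log J) := by
  set u : ι → ℝ := fun p => α p - β - round (α p - β) with hu
  have hker : ∀ p, dirichletKernel N (u p) = dirichletKernel N (α p - β) := fun p =>
    dirichletKernel_sub_int N _ _
  have habs : ∀ p, |u p| ≤ 1 / 2 := fun p => abs_sub_round _
  have hspu : ∀ p ∈ P, ∀ p' ∈ P, p ≠ p' → 1 / J ≤ |u p - u p'| := by
    intro p hp p' hp' hne
    have := hsp p hp p' hp' hne (round (α p - β) - round (α p' - β))
    refine this.trans_eq ?_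
    congr 1
    simp only [hu]
    push_cast
    ring
  rw [← sum_filter_add_sum_filter_not P (fun p => 0 ≤ u p)]
  have h1 := sum_kernel_half_le (P.filter fun p => 0 ≤ u p) u (N := N) hJ
    (fun p hp => (mem_filter.mp hp).2) (fun p _ => (le_abs_self _).trans (habs p))
    (fun p hp p' hp' => hspu p (mem_filter.mp hp).1 p' (mem_filter.mp hp').1)
  have h2 := sum_kernel_half_le (P.filter fun p => ¬ 0 ≤ u p) (fun p => -u p) (N := N) hJ
    (fun p hp => by
      have := (mem_filter.mp hp).2
      linarith) (fun p _ => (neg_le_abs _).trans (habs p))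
    (fun p hp p' hp' hne => by
      have := hspu p (mem_filter.mp hp).1 p' (mem_filter.mp hp').1 hne
      rw [← abs_neg] at this
      refine this.trans_eq ?_
      congr 1
      ring)
  simp_rw [norm_dirichletKernel_neg] at h2
  simp_rw [hker] at h1 h2
  linarith

theorem large_sieve {ι : Type*} [DecidableEq ι] (P : Finset ι) (α : ι → ℝ) {N J : ℕ} (hJ : 1 ≤ J)
    (hsp : ∀ p ∈ P, ∀ p' ∈ P, p ≠ p' → ∀ k : ℤ, 1 / J ≤ |α p - α p' - k|) (a : ℕ → ℂ) :
    ∑ p ∈ P, ‖∑ n ∈ Icc 1 N, a n * expPhase (n * α p)‖ ^ 2 ≤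
      (2 * N + J * (1 + Real.log J)) * ∑ n ∈ Icc 1 N, ‖a n‖ ^ 2 := by
  set S : ι → ℂ := fun p => ∑ n ∈ Icc 1 N, a n * expPhase (n * α p) with hS
  set T : ℕ → ℂ := fun n => ∑ p ∈ P, starRingEnd ℂ (S p) * expPhase (n * α p) with hT
  set D : ℝ := 2 * N + J * (1 + Real.log J) with hD
  set X : ℝ := ∑ p ∈ P, ‖S p‖ ^ 2 with hX
  have hX0 : 0 ≤ X := sum_nonneg fun p _ => by positivity
  have hXT : (X : ℂ) = ∑ n ∈ Icc 1 N, a n * T n := by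
    simp only [hT, mul_sum]
    rw [sum_comm, hX]
    push_cast
    refine sum_congr rfl fun p _ => ?_
    rw [← conj_mul', hS]
    simp only
    rw [mul_sum]
    exact sum_congr rfl fun n _ => by ring
  have hTT : ∑ n ∈ Icc 1 N, ‖T n‖ ^ 2 ≤ D * X := by
    have h1 : ((∑ n ∈ Icc 1 N, ‖T n‖ ^ 2 : ℝ) : ℂ) =
        ∑ p ∈ P, ∑ p' ∈ P, starRingEnd ℂ (S p) * S p' * dirichletKernel N (α p - α p') := by
      push_cast
      have h2 : ∀ n ∈ Icc 1 N, (‖T n‖ : ℂ) ^ 2 = ∑ p ∈ P, ∑ p' ∈ P,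
          starRingEnd ℂ (S p) * S p' * expPhase (n * (α p - α p')) := by
        intro n _
        rw [← mul_conj']
        simp only [hT]
        rw [map_sum, sum_mul_sum]
        refine sum_congr rfl fun p _ => sum_congr rfl fun p' _ => ?_
        rw [map_mul, conj_conj, conj_expPhase, mul_sub, sub_eq_add_neg, expPhase_add]
        ring
      rw [sum_congr rfl h2, sum_comm]
      refine sum_congr rfl fun p _ => ?_
      rw [sum_comm]
      refine sum_congr rfl fun p' _ => ?_
      rw [dirichletKernel]
      exact (mul_sum _ _ _).symm
    have h3 : ∑ n ∈ Icc 1 N, ‖T n‖ ^ 2 ≤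
        ∑ p ∈ P, ∑ p' ∈ P, (‖S p‖ ^ 2 / 2 + ‖S p'‖ ^ 2 / 2) * ‖dirichletKernel N (α p - α p')‖ := by
      have h0 : 0 ≤ ∑ n ∈ Icc 1 N, ‖T n‖ ^ 2 := sum_nonneg fun n _ => by positivity
      rw [← Real.norm_of_nonneg h0, ← norm_real, h1]
      refine (norm_sum_le _ _).trans (sum_le_sum fun p _ => (norm_sum_le _ _).trans
        (sum_le_sum fun p' _ => ?_))
      rw [norm_mul, norm_mul, norm_conj]
      gcongr
      nlinarith [sq_nonneg (‖S p‖ - ‖S p'‖)]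
    refine h3.trans ?_
    simp_rw [add_mul, sum_add_distrib]
    have h4 : ∑ p ∈ P, ∑ p' ∈ P, ‖S p‖ ^ 2 / 2 * ‖dirichletKernel N (α p - α p')‖ ≤ D * X / 2 := by
      rw [hX, mul_sum, sum_div]
      refine sum_le_sum fun p _ => ?_
      rw [← mul_sum]
      have : ∑ p' ∈ P, ‖dirichletKernel N (α p - α p')‖ ≤ D := by
        have := sum_kernel_le P α (N := N) hJ hsp (α p)
        refine (sum_congr rfl fun p' _ => ?_).trans_le this
        rw [← norm_dirichletKernel_neg, neg_sub]
      have h5 : 0 ≤ ‖S p‖ ^ 2 / 2 := by positivity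
      nlinarith
    have h4' : ∑ p ∈ P, ∑ p' ∈ P, ‖S p'‖ ^ 2 / 2 * ‖dirichletKernel N (α p - α p')‖ ≤
        D * X / 2 := by
      rw [sum_comm, hX, mul_sum, sum_div]
      refine sum_le_sum fun p _ => ?_
      rw [← mul_sum]
      have := sum_kernel_le P α (N := N) hJ hsp (α p)
      have h5 : 0 ≤ ‖S p‖ ^ 2 / 2 := by positivity
      nlinarith
    linarith
  have hcs : X ^ 2 ≤ (∑ n ∈ Icc 1 N, ‖a n‖ ^ 2) * ∑ n ∈ Icc 1 N, ‖T n‖ ^ 2 := by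
    have h1 : X ≤ ∑ n ∈ Icc 1 N, ‖a n‖ * ‖T n‖ := by
      rw [← Real.norm_of_nonneg hX0, ← norm_real, hXT]
      refine (norm_sum_le _ _).trans_eq ?_
      simp_rw [norm_mul]
    calc X ^ 2 ≤ (∑ n ∈ Icc 1 N, ‖a n‖ * ‖T n‖) ^ 2 := by gcongr
      _ ≤ _ := sum_mul_sq_le_sq_mul_sq _ _ _
  have ha0 : 0 ≤ ∑ n ∈ Icc 1 N, ‖a n‖ ^ 2 := sum_nonneg fun n _ => by positivity
  rcases hX0.eq_or_lt with h | hpos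
  · rw [← h]
    have hJ1 : (1 : ℝ) ≤ J := by exact_mod_cast hJ
    have := Real.log_nonneg hJ1
    positivity
  · have : X * X ≤ D * (∑ n ∈ Icc 1 N, ‖a n‖ ^ 2) * X := by nlinarith
    exact le_of_mul_le_mul_right this hpos

/-- Reduced fractions `b / r` in `[0, 1)` with `r ≤ R`, as pairs `⟨r, b⟩`. -/
def fareyPairs (R : ℕ) : Finset (Σ _ : ℕ, ℕ) :=
  (Icc 1 R).sigma fun r => (range r).filter fun b => b.Coprime r

lemma farey_spacing {R : ℕ} {p p' : Σ _ : ℕ, ℕ} (hp : p ∈ fareyPairs R) (hp' : p' ∈ fareyPairs R)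
    (hne : p ≠ p') (k : ℤ) :
    1 / ((R ^ 2 : ℕ) : ℝ) ≤ |(p.2 : ℝ) / p.1 - (p'.2 : ℝ) / p'.1 - k| := by
  obtain ⟨r, b⟩ := p
  obtain ⟨r', b'⟩ := p'
  simp only [fareyPairs, mem_sigma, mem_Icc, mem_filter, mem_range] at hp hp'
  obtain ⟨⟨hr, hrR⟩, hbr, hcop⟩ := hp
  obtain ⟨⟨hr', hrR'⟩, hbr', hcop'⟩ := hp'
  have hr0 : (0 : ℝ) < r := by exact_mod_cast hr
  have hr0' : (0 : ℝ) < r' := by exact_mod_cast hr'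
  set m : ℤ := b * r' - b' * r - k * (r * r') with hm
  have hval : (b : ℝ) / r - (b' : ℝ) / r' - k = m / (r * r') := by
    rw [hm]
    push_cast
    field_simp
  have hm0 : m ≠ 0 := by
    intro h0
    have hk : k = 0 := by
      have h1 : (b : ℤ) * r' - b' * r = k * (r * r') := by linarith
      have h2 : (b : ℤ) * r' < r * r' := by
        have : b * r' < r * r' := Nat.mul_lt_mul_of_pos_right hbr (by omega)
        exact_mod_cast this
      have h3 : (b' : ℤ) * r < r * r' := by
        have : b' * r < r' * r := Nat.mul_lt_mul_of_pos_right hbr' (by omega)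
        rw [mul_comm (r : ℤ)]
        exact_mod_cast this
      have h4 : (0 : ℤ) ≤ b * r' := by positivity
      have h5 : (0 : ℤ) ≤ b' * r := by positivity
      have h6 : (0 : ℤ) < r * r' := by positivity
      have h7 : k < 1 := by
        by_contra h
        nlinarith
      have h8 : -1 < k := by
        by_contra h
        nlinarith
      omega
    have heq : b * r' = b' * r := by
      rw [hm, hk] at h0
      have : (b : ℤ) * r' = b' * r := by linarith
      exact_mod_cast this
    have hd1 : r ∣ r' := hcop.symm.dvd_of_dvd_mul_left ⟨b', by rw [heq, mul_comm]⟩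
    have hd2 : r' ∣ r := hcop'.symm.dvd_of_dvd_mul_left ⟨b, by rw [← heq, mul_comm]⟩
    have hrr : r = r' := Nat.dvd_antisymm hd1 hd2
    subst hrr
    have : b = b' := Nat.eq_of_mul_eq_mul_right (by omega) heq
    exact hne (by rw [this])
  rw [hval, abs_div, abs_of_pos (mul_pos hr0 hr0')]
  have hm1 : (1 : ℝ) ≤ |(m : ℝ)| := by exact_mod_cast Int.one_le_abs hm0
  have hrR1 : (r : ℝ) ≤ R := by exact_mod_cast hrR
  have hrR2 : (r' : ℝ) ≤ R := by exact_mod_cast hrR'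
  rw [Nat.cast_pow]
  gcongr
  nlinarith

theorem large_sieve_farey {R : ℕ} (hR : 1 ≤ R) (N : ℕ) (a : ℕ → ℂ) :
    ∑ r ∈ Icc 1 R, ∑ b ∈ (range r).filter (fun b => b.Coprime r),
        ‖∑ n ∈ Icc 1 N, a n * expPhase (n * (b / r))‖ ^ 2 ≤
      (2 * N + R ^ 2 * (1 + 2 * Real.log R)) * ∑ n ∈ Icc 1 N, ‖a n‖ ^ 2 := by
  have h := large_sieve (fareyPairs R) (fun p => (p.2 : ℝ) / p.1) (N := N)
    (Nat.one_le_pow 2 R hR) (fun p hp p' hp' hne k => farey_spacing hp hp' hne k) a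
  rw [fareyPairs, sum_sigma] at h
  rw [Nat.cast_pow, Real.log_pow] at h
  exact_mod_cast h

end LargeSieve

section TotientConvolution

/-- `sqfreeInvTotient d = μ²(d)/φ(d)`. -/
noncomputable def sqfreeInvTotient (d : ℕ) : ℝ := if Squarefree d then 1 / (d.totient : ℝ) else 0

lemma sqfreeInvTotient_nonneg (d : ℕ) : 0 ≤ sqfreeInvTotient d := by
  rw [sqfreeInvTotient]
  split_ifs <;> positivity

lemma sqfreeInvTotient_le (d : ℕ) : sqfreeInvTotient d ≤ 1 / (d.totient : ℝ) := by
  rw [sqfreeInvTotient]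
  split_ifs
  · exact le_rfl
  · positivity

lemma sqfreeInvTotient_mul {m n : ℕ} (h : m.Coprime n) :
    sqfreeInvTotient (m * n) = sqfreeInvTotient m * sqfreeInvTotient n := by
  simp only [sqfreeInvTotient, Nat.squarefree_mul h, Nat.totient_mul h]
  by_cases hm : Squarefree m <;> by_cases hn : Squarefree n <;> simp [hm, hn, mul_comm]

lemma sum_divisors_sqfreeInvTotient {n : ℕ} (hn : n ≠ 0) :
    ∑ d ∈ n.divisors, sqfreeInvTotient d = (n : ℝ) / n.totient := by
  induction n using Nat.recOnPosPrimePosCoprime with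
  | zero => exact absurd rfl hn
  | one => simp [sqfreeInvTotient]
  | prime_pow p k hp hk =>
    have h0 : (p : ℝ) - 1 ≠ 0 := by
      have : (1 : ℝ) < p := by exact_mod_cast hp.one_lt
      linarith
    have h1 : (p : ℝ) ≠ 0 := by exact_mod_cast hp.ne_zero
    rw [Nat.sum_divisors_prime_pow hp]
    obtain ⟨k, rfl⟩ : ∃ j, k = j + 1 := ⟨k - 1, by omega⟩
    rw [sum_range_succ', sum_range_succ']
    have h2 : ∀ i ∈ range k, sqfreeInvTotient (p ^ (i + 1 + 1)) = 0 := by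
      intro i _
      rw [sqfreeInvTotient, if_neg]
      rw [Nat.squarefree_pow_iff hp.ne_one (by omega)]
      omega
    rw [sum_eq_zero h2, Nat.totient_prime_pow hp (by omega)]
    simp only [sqfreeInvTotient, zero_add, pow_one, hp.prime.squarefree, if_true, pow_zero,
      squarefree_one, Nat.totient_one, Nat.totient_prime hp]
    push_cast [hp.one_le]
    field_simp
    ring
  | coprime a b ha hb hab iha ihb =>
    let f : ArithmeticFunction ℝ := ⟨sqfreeInvTotient, by simp [sqfreeInvTotient]⟩
    have hf : f.IsMultiplicative :=
      ⟨by simp [f, sqfreeInvTotient], fun h => sqfreeInvTotient_mul h⟩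
    have h := (hf.mul ArithmeticFunction.isMultiplicative_zeta.natCast).map_mul_of_coprime hab
    simp only [ArithmeticFunction.coe_mul_zeta_apply] at h
    change ∑ d ∈ (a * b).divisors, f d = _
    rw [h, Nat.totient_mul hab, Nat.cast_mul, Nat.cast_mul, mul_div_mul_comm]
    exact congrArg₂ _ (iha (by omega)) (ihb (by omega))

end TotientConvolution

section AdditiveCharacters

lemma sum_range_expPhase {q : ℕ} (hq : 1 ≤ q) (k : ℤ) :
    ∑ b ∈ range q, expPhase (k * (b / q)) = if (q : ℤ) ∣ k then (q : ℂ) else 0 := by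
  have hq0 : (q : ℝ) ≠ 0 := by positivity
  have h1 : ∀ b ∈ range q, expPhase (k * (b / q)) = expPhase (k / q) ^ b := by
    intro b _
    rw [← expPhase_natCast_mul]
    congr 1
    ring
  rw [sum_congr rfl h1]
  have hpow : expPhase (k / q) ^ q = 1 := by
    rw [← expPhase_natCast_mul, mul_div_cancel₀ _ hq0, expPhase_int]
  split_ifs with h
  · obtain ⟨c, rfl⟩ := h
    have : expPhase (((q * c : ℤ) : ℝ) / q) = 1 := by
      push_cast
      rw [mul_div_cancel_left₀ _ hq0, expPhase_int]
    simp only [this, one_pow, sum_const, card_range, nsmul_eq_mul, mul_one]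
  · have hne : expPhase (k / q) ≠ 1 := by
      intro h2
      rw [expPhase, Complex.exp_eq_one_iff] at h2
      obtain ⟨m, hm⟩ := h2
      have h3 : (k : ℂ) / q = m := by
        have h4 : (2 * Real.pi * Complex.I : ℂ) ≠ 0 := Complex.two_pi_I_ne_zero
        apply mul_right_cancel₀ h4
        rw [← hm]
        push_cast
        ring
      have hq0' : (q : ℂ) ≠ 0 := by exact_mod_cast hq0
      rw [div_eq_iff hq0'] at h3
      exact h ⟨m, by rw [mul_comm]; exact_mod_cast h3⟩
    rw [geom_sum_eq hne, hpow, sub_self, zero_div]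

lemma sum_range_div_eq_sum_divisors {q : ℕ} (hq : 1 ≤ q) (g : ℝ → ℝ) :
    ∑ b ∈ range q, g (b / q) =
      ∑ r ∈ q.divisors, ∑ b ∈ (range r).filter (fun b => b.Coprime r), g (b / r) := by
  rw [sum_sigma']
  refine sum_bij' (fun b _ => (⟨q / b.gcd q, b / b.gcd q⟩ : Σ _ : ℕ, ℕ))
    (fun p _ => p.2 * (q / p.1)) ?_ ?_ ?_ ?_ ?_
  · intro b hb
    have hg : 0 < b.gcd q := Nat.gcd_pos_of_pos_right _ hq
    rw [mem_range] at hb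
    simp only [mem_sigma, Nat.mem_divisors, mem_filter, mem_range]
    refine ⟨⟨Nat.div_dvd_of_dvd (Nat.gcd_dvd_right b q), by omega⟩, ?_,
      Nat.coprime_div_gcd_div_gcd hg⟩
    exact Nat.div_lt_div_of_lt_of_dvd (Nat.gcd_dvd_right b q) hb
  · rintro ⟨r, b⟩ hp
    simp only [mem_sigma, Nat.mem_divisors, mem_filter, mem_range] at hp ⊢
    obtain ⟨⟨⟨c, rfl⟩, -⟩, hb, -⟩ := hp
    have hr : 0 < r := by omega
    rw [Nat.mul_div_cancel_left _ hr]
    exact Nat.mul_lt_mul_of_pos_right hb (Nat.pos_of_mul_pos_left hq)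
  · intro b hb
    have hg : 0 < b.gcd q := Nat.gcd_pos_of_pos_right _ hq
    simp only
    rw [Nat.div_div_self (Nat.gcd_dvd_right b q) (by omega), Nat.div_mul_cancel (Nat.gcd_dvd_left b q)]
  · rintro ⟨r, b⟩ hp
    simp only [mem_sigma, Nat.mem_divisors, mem_filter, mem_range] at hp ⊢
    obtain ⟨⟨⟨c, rfl⟩, -⟩, hb, hc⟩ := hp
    have hr : 0 < r := by omega
    have hc0 : 0 < c := Nat.pos_of_mul_pos_left hq
    rw [Nat.mul_div_cancel_left _ hr]
    have : (b * c).gcd (r * c) = c := by rw [Nat.gcd_mul_right, hc.gcd_eq_one, one_mul]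
    rw [this, Nat.mul_div_cancel _ hc0, Nat.mul_div_cancel _ hc0]
  · intro b hb
    have hg : 0 < b.gcd q := Nat.gcd_pos_of_pos_right _ hq
    simp only
    congr 1
    rw [Nat.cast_div (Nat.gcd_dvd_left b q) (by positivity),
      Nat.cast_div (Nat.gcd_dvd_right b q) (by positivity)]
    field_simp

end AdditiveCharacters

section ResidueSecondMoment

open scoped ArithmeticFunction.vonMangoldt

/-- `∑ Λ(n)` over `n ≤ N` with `n ≡ a (mod q)`. -/
noncomputable def psiNat (N q a : ℕ) : ℝ :=
  ∑ n ∈ (Icc 1 N).filter (fun n => n % q = a % q), Λ n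

/-- The second moment over all residue classes modulo `q`. -/
noncomputable def residueMoment (N q : ℕ) : ℝ := ∑ n ∈ Icc 1 N, Λ n * psiNat N q n

/-- The second moment of `∑ Λ(n) e(nα)` over reduced fractions with denominator `r`. -/
noncomputable def reducedMoment (N r : ℕ) : ℝ :=
  ∑ b ∈ (range r).filter (fun b => b.Coprime r),
    ‖∑ n ∈ Icc 1 N, (Λ n : ℂ) * expPhase (n * (b / r))‖ ^ 2

lemma psiNat_nonneg (N q a : ℕ) : 0 ≤ psiNat N q a :=
  sum_nonneg fun _ _ => ArithmeticFunction.vonMangoldt_nonneg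

lemma reducedMoment_nonneg (N r : ℕ) : 0 ≤ reducedMoment N r :=
  sum_nonneg fun _ _ => by positivity

lemma mul_residueMoment_eq_sum_range {q : ℕ} (hq : 1 ≤ q) (N : ℕ) :
    (q : ℝ) * residueMoment N q =
      ∑ b ∈ range q, ‖∑ n ∈ Icc 1 N, (Λ n : ℂ) * expPhase (n * ((b : ℝ) / q))‖ ^ 2 := by
  rw [← Complex.ofReal_inj]
  push_cast
  have h1 : ∀ b ∈ range q,
      (‖∑ n ∈ Icc 1 N, (Λ n : ℂ) * expPhase (n * ((b : ℝ) / q))‖ : ℂ) ^ 2 =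
      ∑ n ∈ Icc 1 N, ∑ m ∈ Icc 1 N, (Λ n : ℂ) * Λ m *
        expPhase (((n : ℤ) - (m : ℤ) : ℤ) * ((b : ℝ) / q)) := by
    intro b _
    rw [← Complex.mul_conj', map_sum, sum_mul_sum]
    refine sum_congr rfl fun n _ => sum_congr rfl fun m _ => ?_
    rw [map_mul, conj_expPhase, Complex.conj_ofReal]
    push_cast
    rw [sub_mul, sub_eq_add_neg, expPhase_add]
    ring
  rw [sum_congr rfl h1, sum_comm, residueMoment]
  push_cast
  rw [mul_sum]
  refine sum_congr rfl fun n _ => ?_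
  rw [sum_comm, psiNat, sum_filter]
  push_cast
  rw [mul_sum, mul_sum]
  refine sum_congr rfl fun m _ => ?_
  have h2 := sum_range_expPhase hq ((n : ℤ) - m)
  push_cast at h2
  rw [← mul_sum, h2]
  have : ((q : ℤ) ∣ (n : ℤ) - m) ↔ m % q = n % q := by
    rw [← Nat.modEq_iff_dvd, Nat.ModEq]
  by_cases h : m % q = n % q
  · rw [if_pos h, if_pos (this.mpr h)]
    ring
  · rw [if_neg h, if_neg (fun h' => h (this.mp h'))]
    simp

lemma mul_residueMoment_eq {q : ℕ} (hq : 1 ≤ q) (N : ℕ) :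
    (q : ℝ) * residueMoment N q = ∑ r ∈ q.divisors, reducedMoment N r := by
  rw [mul_residueMoment_eq_sum_range hq, sum_range_div_eq_sum_divisors hq
    (fun t => ‖∑ n ∈ Icc 1 N, (Λ n : ℂ) * expPhase (n * t)‖ ^ 2)]
  rfl

end ResidueSecondMoment

section DivisorSums

lemma sum_Icc_filter_dvd {r : ℕ} (hr : 1 ≤ r) (Q : ℕ) (g : ℕ → ℝ) :
    ∑ q ∈ (Icc 1 Q).filter (fun q => r ∣ q), g q = ∑ k ∈ Icc 1 (Q / r), g (r * k) := by
  symm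
  refine sum_bij' (fun k _ => r * k) (fun q _ => q / r) ?_ ?_ ?_ ?_ ?_
  · intro k hk
    rw [mem_Icc] at hk
    rw [mem_filter, mem_Icc]
    refine ⟨⟨Nat.mul_pos hr hk.1, ?_⟩, dvd_mul_right _ _⟩
    exact (Nat.mul_le_mul_left r hk.2).trans (Nat.mul_div_le Q r)
  · intro q hq
    rw [mem_filter, mem_Icc] at hq
    rw [mem_Icc]
    exact ⟨Nat.div_pos (Nat.le_of_dvd hq.1.1 hq.2) hr, Nat.div_le_div_right hq.1.2⟩
  · intro k _
    exact Nat.mul_div_cancel_left k hr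
  · intro q hq
    exact Nat.mul_div_cancel' (mem_filter.mp hq).2
  · intro k _
    rfl

lemma sum_Icc_sum_divisors (Q : ℕ) (f : ℕ → ℕ → ℝ) :
    ∑ q ∈ Icc 1 Q, ∑ r ∈ q.divisors, f r q =
      ∑ r ∈ Icc 1 Q, ∑ k ∈ Icc 1 (Q / r), f r (r * k) := by
  have h1 : ∀ q ∈ Icc 1 Q, ∑ r ∈ q.divisors, f r q =
      ∑ r ∈ Icc 1 Q, if r ∣ q then f r q else 0 := by
    intro q hq
    rw [mem_Icc] at hq
    rw [← sum_filter]
    refine sum_congr ?_ fun _ _ => rfl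
    ext r
    simp only [Nat.mem_divisors, mem_filter, mem_Icc]
    constructor
    · rintro ⟨h, -⟩
      exact ⟨⟨Nat.pos_of_dvd_of_pos h hq.1, (Nat.le_of_dvd hq.1 h).trans hq.2⟩, h⟩
    · rintro ⟨-, h⟩
      exact ⟨h, by omega⟩
  rw [sum_congr rfl h1, sum_comm]
  refine sum_congr rfl fun r hr => ?_
  rw [← sum_filter, sum_Icc_filter_dvd (mem_Icc.mp hr).1]

lemma sum_Ioc_div_eq (a : ℕ → ℝ) {M Q : ℕ} (h : M ≤ Q) :
    ∑ r ∈ Ioc M Q, a r / r = (∑ r ∈ Ioc M Q, a r) / (Q + 1) +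
      ∑ k ∈ Ioc M Q, (∑ r ∈ Ioc M k, a r) / (k * (k + 1)) := by
  induction Q, h using Nat.le_induction with
  | base => simp
  | succ Q h ih =>
    rw [sum_Ioc_succ_top (by omega), ih, sum_Ioc_succ_top (by omega),
      sum_Ioc_succ_top (b := Q) (by omega)]
    push_cast
    have h1 : (Q : ℝ) + 1 ≠ 0 := by positivity
    have h2 : (Q : ℝ) + 1 + 1 ≠ 0 := by positivity
    rw [sum_Ioc_succ_top (by omega)]
    field_simp
    ring

lemma sum_Ioc_inv_mul_succ {M Q : ℕ} (h : M ≤ Q) :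
    ∑ k ∈ Ioc M Q, (1 : ℝ) / (k * (k + 1)) = 1 / (M + 1) - 1 / (Q + 1) := by
  induction Q, h using Nat.le_induction with
  | base => simp
  | succ Q h ih =>
    rw [sum_Ioc_succ_top (by omega), ih]
    push_cast
    field_simp
    ring

lemma sum_Ioc_div_le {a : ℕ → ℝ} {M Q : ℕ} {α β : ℝ} (hα : 0 ≤ α) (hβ : 0 ≤ β)
    (h : ∀ k ≤ Q, ∑ r ∈ Ioc M k, a r ≤ α + β * k ^ 2) :
    ∑ r ∈ Ioc M Q, a r / r ≤ α / (M + 1) + 2 * β * Q := by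
  rcases lt_or_ge Q M with hQM | hMQ
  · rw [Ioc_eq_empty (by omega), sum_empty]
    positivity
  rw [sum_Ioc_div_eq a hMQ]
  have h1 : (∑ r ∈ Ioc M Q, a r) / (Q + 1) ≤ α * (1 / (Q + 1)) + β * Q := by
    rw [div_le_iff₀ (by positivity)]
    refine (h Q le_rfl).trans ?_
    have : (α * (1 / ((Q : ℝ) + 1)) + β * Q) * (Q + 1) = α + β * Q ^ 2 + β * Q := by
      field_simp
      ring
    rw [this]
    have : 0 ≤ β * Q := by positivity
    linarith
  have h2 : ∑ k ∈ Ioc M Q, (∑ r ∈ Ioc M k, a r) / (k * (k + 1)) ≤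
      ∑ k ∈ Ioc M Q, (α * (1 / (k * (k + 1))) + β) := by
    refine sum_le_sum fun k hk => ?_
    rw [mem_Ioc] at hk
    have hk0 : (0 : ℝ) < k := by exact_mod_cast (show 0 < k by omega)
    rw [div_le_iff₀ (by positivity)]
    refine (h k hk.2).trans ?_
    have : (α * (1 / ((k : ℝ) * (k + 1))) + β) * (k * (k + 1)) = α + β * k ^ 2 + β * k := by
      field_simp
      ring
    rw [this]
    have : 0 ≤ β * k := by positivity
    linarith
  rw [sum_add_distrib, ← mul_sum, sum_Ioc_inv_mul_succ hMQ, sum_const, Nat.card_Ioc,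
    nsmul_eq_mul] at h2
  have h3 : ((Q - M : ℕ) : ℝ) * β ≤ Q * β := by
    gcongr
    exact Nat.sub_le Q M
  have h4 : α * (1 / ((M : ℝ) + 1) - 1 / (Q + 1)) = α / (M + 1) - α * (1 / (Q + 1)) := by ring
  linarith

end DivisorSums

section BarbanDavenportHalberstam

open scoped ArithmeticFunction.vonMangoldt

lemma exists_log_pow_le_mul (j : ℕ) :
    ∃ C : ℝ, 0 < C ∧ ∀ N : ℕ, 1 ≤ N → Real.log (N + 2) ^ j ≤ C * N := by
  obtain ⟨C, hC, h⟩ := exists_log_pow_le_rpow j one_pos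
  exact ⟨C, hC, fun N hN => by simpa using h N hN⟩

lemma exists_log_pow_le_div (j A : ℕ) :
    ∃ C : ℝ, 0 < C ∧ ∀ N : ℕ, 1 ≤ N → Real.log (N + 2) ^ j ≤ C * N / Real.log (N + 2) ^ A := by
  obtain ⟨C, hC, h⟩ := exists_log_pow_le_mul (j + A)
  refine ⟨C, hC, fun N hN => ?_⟩
  have hL := one_le_log_add_two hN
  rw [le_div_iff₀ (by positivity), ← pow_add]
  exact h N hN

lemma sum_vonMangoldt_not_coprime_le_log {N q : ℕ} (hN : 1 ≤ N) (hq : 1 ≤ q) :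
    ∑ n ∈ (Icc 1 N).filter (fun n => ¬ n.Coprime q), Λ n ≤
      6 * Real.log q * Real.log (N + 2) ^ 2 := by
  refine (sum_vonMangoldt_not_coprime_le hN hq).trans ?_
  have := card_primeFactors_le_two_mul_log (n := q) (by omega)
  have hL := one_le_log_add_two hN
  calc 3 * (#q.primeFactors : ℝ) * Real.log (N + 2) ^ 2 ≤
      3 * (2 * Real.log q) * Real.log (N + 2) ^ 2 := by gcongr
    _ = _ := by ring

lemma sum_vonMangoldt_coprime_eq (N q : ℕ) :
    ∑ n ∈ (Icc 1 N).filter (fun n => n.Coprime q), Λ n =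
      ∑ n ∈ Icc 1 N, Λ n - ∑ n ∈ (Icc 1 N).filter (fun n => ¬ n.Coprime q), Λ n := by
  rw [← sum_filter_add_sum_filter_not (Icc 1 N) (fun n => n.Coprime q)]
  ring

lemma abs_residueMoment_sub_le (A : ℕ) :
    ∃ C : ℝ, 0 < C ∧ ∀ N : ℕ, 1 ≤ N → ∀ q : ℕ, 1 ≤ q → (q : ℝ) ≤ Real.log (N + 2) ^ A →
      |residueMoment N q - (N : ℝ) ^ 2 / q.totient| ≤ C * N ^ 2 / Real.log (N + 2) ^ A := by
  obtain ⟨C₁, hC₁, h₁⟩ := siegel_walfisz_uniform A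
  obtain ⟨C₂, hC₂, h₂⟩ := abs_sum_vonMangoldt_sub_le_uniform A
  obtain ⟨C₃, hC₃, h₃⟩ := exists_log_pow_le_div (A + 2) A
  obtain ⟨C₄, hC₄, h₄⟩ := exists_sum_vonMangoldt_le
  refine ⟨C₁ * C₄ + C₂ + 6 * C₃, by positivity, fun N hN q hq hqL => ?_⟩
  have hL := one_le_log_add_two hN
  set L : ℝ := Real.log (N + 2) with hLdef
  have hφ : (1 : ℝ) ≤ q.totient := by exact_mod_cast Nat.totient_pos.mpr hq
  have hN0 : (0 : ℝ) < N := by exact_mod_cast hN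
  have e1 : residueMoment N q - (N : ℝ) ^ 2 / q.totient =
      ∑ n ∈ Icc 1 N, Λ n * (psiNat N q n - if n.Coprime q then (N : ℝ) / q.totient else 0) +
      N / q.totient * (∑ n ∈ (Icc 1 N).filter (fun n => n.Coprime q), Λ n - N) := by
    have : ∑ n ∈ Icc 1 N, Λ n * (if n.Coprime q then (N : ℝ) / q.totient else 0) =
        N / q.totient * ∑ n ∈ (Icc 1 N).filter (fun n => n.Coprime q), Λ n := by
      rw [sum_filter, mul_sum]
      refine sum_congr rfl fun n _ => ?_
      split_ifs <;> ring
    simp only [mul_sub, sum_sub_distrib]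
    rw [this, residueMoment]
    ring
  have e2 : |∑ n ∈ Icc 1 N, Λ n * (psiNat N q n - if n.Coprime q then (N : ℝ) / q.totient else 0)|
      ≤ C₁ * C₄ * N ^ 2 / L ^ A := by
    calc _ ≤ ∑ n ∈ Icc 1 N, Λ n * (C₁ * N / L ^ A) := by
          refine (abs_sum_le_sum_abs _ _).trans (sum_le_sum fun n _ => ?_)
          rw [abs_mul, abs_of_nonneg ArithmeticFunction.vonMangoldt_nonneg]
          exact mul_le_mul_of_nonneg_left (h₁ N hN N le_rfl q n hq hqL)
            ArithmeticFunction.vonMangoldt_nonneg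
      _ = (∑ n ∈ Icc 1 N, Λ n) * (C₁ * N / L ^ A) := by rw [sum_mul]
      _ ≤ C₄ * N * (C₁ * N / L ^ A) := by
          gcongr
          exact h₄ N
      _ = _ := by ring
  have e3 : |∑ n ∈ (Icc 1 N).filter (fun n => n.Coprime q), Λ n - N| ≤
      (C₂ + 6 * C₃) * N / L ^ A := by
    rw [sum_vonMangoldt_coprime_eq]
    have a1 := h₂ N hN N le_rfl
    have a2 := sum_vonMangoldt_not_coprime_le_log hN hq
    have a3 : 0 ≤ ∑ n ∈ (Icc 1 N).filter (fun n => ¬ n.Coprime q), Λ n :=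
      sum_nonneg fun _ _ => ArithmeticFunction.vonMangoldt_nonneg
    have a4 : Real.log q ≤ L ^ A := by
      have := Real.log_le_sub_one_of_pos (x := q) (by positivity)
      linarith
    have a5 : 6 * Real.log q * L ^ 2 ≤ 6 * (C₃ * N / L ^ A) := by
      calc 6 * Real.log q * L ^ 2 ≤ 6 * L ^ A * L ^ 2 := by gcongr
        _ = 6 * L ^ (A + 2) := by ring
        _ ≤ _ := by gcongr; exact h₃ N hN
    have a6 : (C₂ + 6 * C₃) * N / L ^ A = C₂ * N / L ^ A + 6 * (C₃ * N / L ^ A) := by ring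
    rw [a6, abs_le]
    rw [abs_le] at a1
    have : 0 ≤ 6 * (C₃ * N / L ^ A) := by positivity
    constructor <;> linarith
  rw [e1]
  refine (abs_add_le _ _).trans ?_
  have e4 : |(N : ℝ) / q.totient * (∑ n ∈ (Icc 1 N).filter (fun n => n.Coprime q), Λ n - N)| ≤
      N * ((C₂ + 6 * C₃) * N / L ^ A) := by
    rw [abs_mul, abs_of_nonneg (by positivity)]
    gcongr
    exact div_le_self hN0.le hφ
  calc _ ≤ C₁ * C₄ * N ^ 2 / L ^ A + N * ((C₂ + 6 * C₃) * N / L ^ A) := add_le_add e2 e4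
    _ = _ := by ring

/-- The deviation of the moment over reduced fractions from its expected value. -/
noncomputable def reducedDeviation (N r : ℕ) : ℝ :=
  reducedMoment N r - (N : ℝ) ^ 2 * sqfreeInvTotient r

lemma sum_divisors_reducedDeviation {q : ℕ} (hq : 1 ≤ q) (N : ℕ) :
    ∑ r ∈ q.divisors, reducedDeviation N r =
      q * (residueMoment N q - (N : ℝ) ^ 2 / q.totient) := by
  simp only [reducedDeviation, sum_sub_distrib]
  rw [← mul_residueMoment_eq hq, ← mul_sum, sum_divisors_sqfreeInvTotient (by omega)]
  ring

lemma abs_reducedDeviation_le_sum {r : ℕ} (hr : 1 ≤ r) (N : ℕ) :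
    |reducedDeviation N r| ≤
      ∑ d ∈ r.divisors, d * |residueMoment N d - (N : ℝ) ^ 2 / d.totient| := by
  have h := (ArithmeticFunction.sum_eq_iff_sum_mul_moebius_eq (R := ℝ)
    (f := reducedDeviation N)
    (g := fun q => q * (residueMoment N q - (N : ℝ) ^ 2 / q.totient))).mp
    (fun q hq => sum_divisors_reducedDeviation hq N) r hr
  rw [← h, Nat.sum_divisorsAntidiagonal' (f := fun x y =>
    (ArithmeticFunction.moebius x : ℝ) * (y * (residueMoment N y - (N : ℝ) ^ 2 / y.totient)))]
  refine (abs_sum_le_sum_abs _ _).trans (sum_le_sum fun d _ => ?_)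
  rw [abs_mul, abs_mul, Nat.abs_cast]
  refine mul_le_of_le_one_left (by positivity) ?_
  have := ArithmeticFunction.abs_moebius_le_one (n := r / d)
  exact_mod_cast this

lemma abs_reducedDeviation_le (N r : ℕ) :
    |reducedDeviation N r| ≤ reducedMoment N r + (N : ℝ) ^ 2 * sqfreeInvTotient r := by
  have h1 := reducedMoment_nonneg N r
  have h2 : 0 ≤ (N : ℝ) ^ 2 * sqfreeInvTotient r :=
    mul_nonneg (by positivity) (sqfreeInvTotient_nonneg r)
  rw [reducedDeviation, abs_le]
  constructor <;> linarith

lemma sum_abs_residueMoment_sub_le_sum {N Q : ℕ} :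
    ∑ q ∈ Icc 1 Q, |residueMoment N q - (N : ℝ) ^ 2 / q.totient| ≤
      (1 + Real.log Q) * ∑ r ∈ Icc 1 Q, |reducedDeviation N r| / r := by
  have h1 : ∀ q ∈ Icc 1 Q, |residueMoment N q - (N : ℝ) ^ 2 / q.totient| ≤
      ∑ r ∈ q.divisors, |reducedDeviation N r| / q := by
    intro q hq
    rw [mem_Icc] at hq
    have hq0 : (0 : ℝ) < q := by exact_mod_cast hq.1
    rw [← sum_div, le_div_iff₀ hq0]
    calc |residueMoment N q - (N : ℝ) ^ 2 / q.totient| * q =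
        |∑ r ∈ q.divisors, reducedDeviation N r| := by
          rw [sum_divisors_reducedDeviation hq.1, abs_mul, Nat.abs_cast, mul_comm]
      _ ≤ _ := abs_sum_le_sum_abs _ _
  refine (sum_le_sum h1).trans ?_
  rw [sum_Icc_sum_divisors Q (fun r q => |reducedDeviation N r| / q), mul_sum]
  refine sum_le_sum fun r hr => ?_
  rw [mem_Icc] at hr
  have hr0 : (0 : ℝ) < r := by exact_mod_cast hr.1
  have h2 : ∀ k ∈ Icc 1 (Q / r), |reducedDeviation N r| / ((r * k : ℕ) : ℝ) =
      |reducedDeviation N r| / r * (1 / k) := by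
    intro k _
    push_cast
    ring
  rw [sum_congr rfl h2, ← mul_sum, mul_comm]
  refine mul_le_mul_of_nonneg_right ?_ (by positivity)
  refine (sum_inv_le_one_add_log _).trans ?_
  have h3 : 0 < Q / r := Nat.div_pos hr.2 hr.1
  gcongr
  exact Nat.div_le_self Q r

lemma exists_sum_vonMangoldt_sq_le :
    ∃ C : ℝ, 0 < C ∧ ∀ N : ℕ, ∑ n ∈ Icc 1 N, Λ n ^ 2 ≤ C * N * Real.log (N + 2) := by
  obtain ⟨C, hC, h⟩ := exists_sum_vonMangoldt_le
  refine ⟨C, hC, fun N => ?_⟩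
  calc ∑ n ∈ Icc 1 N, Λ n ^ 2 ≤ ∑ n ∈ Icc 1 N, Λ n * Real.log (N + 2) := by
        refine sum_le_sum fun n hn => ?_
        rw [sq]
        refine mul_le_mul_of_nonneg_left ?_ ArithmeticFunction.vonMangoldt_nonneg
        refine (vonMangoldt_le_log_add_two n).trans (Real.log_le_log (by positivity) ?_)
        have : (n : ℝ) ≤ N := by exact_mod_cast (mem_Icc.mp hn).2
        linarith
    _ = (∑ n ∈ Icc 1 N, Λ n) * Real.log (N + 2) := by rw [sum_mul]
    _ ≤ _ := mul_le_mul_of_nonneg_right (h N) (Real.log_nonneg (by linarith [N.cast_nonneg (α := ℝ)]))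

lemma log_le_log_add_two {k N : ℕ} (h : k ≤ N) : Real.log k ≤ Real.log (N + 2) := by
  rcases Nat.eq_zero_or_pos k with rfl | hk
  · simpa using Real.log_nonneg (by linarith [N.cast_nonneg (α := ℝ)] : (1 : ℝ) ≤ N + 2)
  · have : (k : ℝ) ≤ N := by exact_mod_cast h
    exact Real.log_le_log (by exact_mod_cast hk) (by linarith)

lemma inv_totient_le {N r : ℕ} (hN : 1 ≤ N) (hr : 1 ≤ r) (hrN : r ≤ N) :
    1 / (r.totient : ℝ) ≤ 3 * Real.log (N + 2) * (1 / r) := by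
  have h := div_totient_le (n := r) (by omega)
  have hr0 : (0 : ℝ) < r := by exact_mod_cast hr
  have hL := one_le_log_add_two hN
  have h1 := log_le_log_add_two hrN
  calc 1 / (r.totient : ℝ) = r / r.totient * (1 / r) := by field_simp
    _ ≤ 3 * Real.log (N + 2) * (1 / r) := by
      gcongr
      linarith

lemma sum_inv_totient_le {N R : ℕ} (hN : 1 ≤ N) (hR : R ≤ N) :
    ∑ r ∈ Icc 1 R, 1 / (r.totient : ℝ) ≤ 6 * Real.log (N + 2) ^ 2 := by
  have hL := one_le_log_add_two hN
  have h1 := log_le_log_add_two hR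
  calc ∑ r ∈ Icc 1 R, 1 / (r.totient : ℝ) ≤ ∑ r ∈ Icc 1 R, 3 * Real.log (N + 2) * (1 / r) := by
        refine sum_le_sum fun r hr => ?_
        rw [mem_Icc] at hr
        exact inv_totient_le hN hr.1 (hr.2.trans hR)
    _ = 3 * Real.log (N + 2) * ∑ r ∈ Icc 1 R, (1 : ℝ) / r := by rw [mul_sum]
    _ ≤ 3 * Real.log (N + 2) * (Real.log (N + 2) + Real.log (N + 2)) := by
        gcongr
        exact (sum_inv_le_one_add_log R).trans (by linarith)
    _ = _ := by ring

lemma exists_sum_reducedMoment_le :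
    ∃ C : ℝ, 0 < C ∧ ∀ N : ℕ, 1 ≤ N → ∀ R ≤ N, ∑ r ∈ Icc 1 R, reducedMoment N r ≤
      C * N * Real.log (N + 2) * (2 * N + 3 * Real.log (N + 2) * R ^ 2) := by
  obtain ⟨C, hC, h⟩ := exists_sum_vonMangoldt_sq_le
  refine ⟨C, hC, fun N hN R hR => ?_⟩
  have hL := one_le_log_add_two hN
  rcases Nat.eq_zero_or_pos R with rfl | hR1
  · simp
    positivity
  have h1 := large_sieve_farey (Nat.succ_le_of_lt hR1) N (fun n => (Λ n : ℂ))
  have h2 : ∀ n ∈ Icc 1 N, ‖(Λ n : ℂ)‖ ^ 2 = Λ n ^ 2 := by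
    intro n _
    rw [Complex.norm_real, Real.norm_eq_abs, sq_abs]
  rw [sum_congr rfl h2] at h1
  refine h1.trans ?_
  have h3 := log_le_log_add_two hR
  have h4 : (0 : ℝ) ≤ Real.log R := Real.log_natCast_nonneg R
  calc (2 * N + R ^ 2 * (1 + 2 * Real.log R)) * ∑ n ∈ Icc 1 N, Λ n ^ 2 ≤
      (2 * N + R ^ 2 * (3 * Real.log (N + 2))) * (C * N * Real.log (N + 2)) := by
        gcongr
        · linarith
        · exact h N
    _ = _ := by ring

theorem sum_abs_residueMoment_sub_le (A : ℕ) :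
    ∃ B : ℕ, ∃ C : ℝ, 0 < C ∧ ∀ N : ℕ, 1 ≤ N → ∀ Q : ℕ, (Q : ℝ) * Real.log (N + 2) ^ B ≤ N →
      ∑ q ∈ Icc 1 Q, |residueMoment N q - (N : ℝ) ^ 2 / q.totient| ≤
        C * N ^ 2 / Real.log (N + 2) ^ A := by
  obtain ⟨C₁, hC₁, h₁⟩ := abs_residueMoment_sub_le (2 * (A + 3) + 1 + A)
  obtain ⟨C₂, hC₂, h₂⟩ := exists_sum_reducedMoment_le
  refine ⟨A + 3, 2 * C₁ + 4 * C₂ + 12 + 12 * C₂, by positivity, fun N hN Q hQ => ?_⟩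
  have hL := one_le_log_add_two hN
  set L : ℝ := Real.log (N + 2) with hLdef
  have hL0 : 0 < L := by linarith
  have hN0 : (0 : ℝ) < N := by exact_mod_cast hN
  have hQN : Q ≤ N := by
    have : (Q : ℝ) ≤ N := by
      refine le_trans ?_ hQ
      exact le_mul_of_one_le_right (by positivity) (one_le_pow₀ hL)
    exact_mod_cast this
  set M : ℕ := ⌊L ^ (A + 3)⌋₊ with hM
  have hM1 : (M : ℝ) ≤ L ^ (A + 3) := Nat.floor_le (by positivity)
  have hM2 : L ^ (A + 3) < M + 1 := Nat.lt_floor_add_one _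
  set K : ℝ := C₁ * N ^ 2 / L ^ (2 * (A + 3) + 1 + A) with hK
  have hK0 : 0 ≤ K := by positivity
  have hsmall : ∑ r ∈ Icc 1 M, |reducedDeviation N r| / r ≤ (L ^ (A + 3)) ^ 2 * K := by
    calc ∑ r ∈ Icc 1 M, |reducedDeviation N r| / r ≤ ∑ r ∈ Icc 1 M, (M : ℝ) * K := by
          refine sum_le_sum fun r hr => ?_
          rw [mem_Icc] at hr
          have hr0 : (0 : ℝ) < r := by exact_mod_cast hr.1
          have hrM : (r : ℝ) ≤ M := by exact_mod_cast hr.2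
          rw [div_le_iff₀ hr0]
          refine (abs_reducedDeviation_le_sum hr.1 N).trans ?_
          calc ∑ d ∈ r.divisors, d * |residueMoment N d - (N : ℝ) ^ 2 / d.totient| ≤
              ∑ d ∈ r.divisors, (r : ℝ) * K := by
                refine sum_le_sum fun d hd => ?_
                have hd1 : 1 ≤ d := Nat.pos_of_mem_divisors hd
                have hdr : (d : ℝ) ≤ r := by exact_mod_cast Nat.divisor_le hd
                have hdL : (d : ℝ) ≤ L ^ (2 * (A + 3) + 1 + A) :=
                  (hdr.trans (hrM.trans hM1)).trans (pow_le_pow_right₀ hL (by omega))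
                have := h₁ N hN d hd1 hdL
                gcongr
            _ = #r.divisors * (r * K) := by rw [sum_const, nsmul_eq_mul]
            _ ≤ M * (r * K) := by
                gcongr
                exact_mod_cast (Nat.card_divisors_le_self r).trans hr.2
            _ = M * K * r := by ring
      _ = M * (M * K) := by
          rw [sum_const, Nat.card_Icc, nsmul_eq_mul, Nat.add_sub_cancel]
      _ ≤ L ^ (A + 3) * (L ^ (A + 3) * K) := by gcongr
      _ = _ := by ring
  have hlarge : ∑ r ∈ Ioc M Q, |reducedDeviation N r| / r ≤
      (2 * C₂ + 6) * N ^ 2 * L ^ 2 / (M + 1) + 2 * (3 * C₂ * N * L ^ 2) * Q := by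
    refine sum_Ioc_div_le (by positivity) (by positivity) fun k hk => ?_
    calc ∑ r ∈ Ioc M k, |reducedDeviation N r| ≤ ∑ r ∈ Icc 1 k, |reducedDeviation N r| := by
          refine sum_le_sum_of_subset_of_nonneg (fun r hr => ?_) fun _ _ _ => abs_nonneg _
          rw [mem_Ioc] at hr
          rw [mem_Icc]
          omega
      _ ≤ ∑ r ∈ Icc 1 k, (reducedMoment N r + (N : ℝ) ^ 2 * (1 / r.totient)) := by
          refine sum_le_sum fun r _ => (abs_reducedDeviation_le N r).trans ?_
          gcongr
          exact sqfreeInvTotient_le r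
      _ = ∑ r ∈ Icc 1 k, reducedMoment N r + N ^ 2 * ∑ r ∈ Icc 1 k, 1 / (r.totient : ℝ) := by
          rw [sum_add_distrib, mul_sum]
      _ ≤ C₂ * N * L * (2 * N + 3 * L * k ^ 2) + N ^ 2 * (6 * L ^ 2) := by
          gcongr
          · exact h₂ N hN k (hk.trans hQN)
          · exact sum_inv_totient_le hN (hk.trans hQN)
      _ = 2 * C₂ * N ^ 2 * (L * 1) + 6 * N ^ 2 * L ^ 2 + 3 * C₂ * N * L ^ 2 * k ^ 2 := by ring
      _ ≤ 2 * C₂ * N ^ 2 * (L * L) + 6 * N ^ 2 * L ^ 2 + 3 * C₂ * N * L ^ 2 * k ^ 2 := by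
          gcongr
      _ = _ := by ring
  have hall : ∑ r ∈ Icc 1 Q, |reducedDeviation N r| / r ≤
      (L ^ (A + 3)) ^ 2 * K +
        ((2 * C₂ + 6) * N ^ 2 * L ^ 2 / (M + 1) + 2 * (3 * C₂ * N * L ^ 2) * Q) := by
    refine le_trans ?_ (add_le_add hsmall hlarge)
    rw [← sum_union (disjoint_left.mpr fun r h1 h2 => by
      rw [mem_Icc] at h1; rw [mem_Ioc] at h2; omega)]
    refine sum_le_sum_of_subset_of_nonneg (fun r hr => ?_) fun _ _ _ => by positivity
    rw [mem_Icc] at hr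
    rw [mem_union, mem_Icc, mem_Ioc]
    omega
  have hlog := log_le_log_add_two hQN
  have hLA : 0 < L ^ A := by positivity
  have e1 : 2 * L * ((L ^ (A + 3)) ^ 2 * K) = 2 * C₁ * (N ^ 2 / L ^ A) := by
    rw [hK]
    field_simp
    ring
  have e2 : 2 * L * ((2 * C₂ + 6) * N ^ 2 * L ^ 2 / (M + 1)) ≤
      (4 * C₂ + 12) * (N ^ 2 / L ^ A) := by
    calc 2 * L * ((2 * C₂ + 6) * N ^ 2 * L ^ 2 / (M + 1)) ≤
        2 * L * ((2 * C₂ + 6) * N ^ 2 * L ^ 2 / L ^ (A + 3)) := by gcongr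
      _ = _ := by
        field_simp
        ring
  have e3 : 2 * L * (2 * (3 * C₂ * N * L ^ 2) * Q) ≤ 12 * C₂ * (N ^ 2 / L ^ A) := by
    calc 2 * L * (2 * (3 * C₂ * N * L ^ 2) * Q) =
        12 * C₂ * N * (Q * L ^ (A + 3)) / L ^ A := by
          field_simp
          ring
      _ ≤ 12 * C₂ * N * N / L ^ A := by gcongr
      _ = _ := by ring
  calc _ ≤ (1 + Real.log Q) * ∑ r ∈ Icc 1 Q, |reducedDeviation N r| / r :=
        sum_abs_residueMoment_sub_le_sum
    _ ≤ 2 * L * ((L ^ (A + 3)) ^ 2 * K +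
        ((2 * C₂ + 6) * N ^ 2 * L ^ 2 / (M + 1) + 2 * (3 * C₂ * N * L ^ 2) * Q)) := by
        gcongr
        linarith
    _ = 2 * L * ((L ^ (A + 3)) ^ 2 * K) + 2 * L * ((2 * C₂ + 6) * N ^ 2 * L ^ 2 / (M + 1)) +
        2 * L * (2 * (3 * C₂ * N * L ^ 2) * Q) := by ring
    _ ≤ 2 * C₁ * (N ^ 2 / L ^ A) + (4 * C₂ + 12) * (N ^ 2 / L ^ A) +
        12 * C₂ * (N ^ 2 / L ^ A) := by
        rw [e1]
        gcongr
    _ = _ := by ring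

end BarbanDavenportHalberstam

section TotientSums

/-- `totientWeight d = μ²(d)/(d φ(d))`. -/
noncomputable def totientWeight (d : ℕ) : ℝ := sqfreeInvTotient d / d

lemma totientWeight_nonneg (d : ℕ) : 0 ≤ totientWeight d :=
  div_nonneg (sqfreeInvTotient_nonneg d) (Nat.cast_nonneg d)

lemma totientWeight_mul_sqrt_le (d : ℕ) :
    totientWeight d * √d ≤ 9 * (1 / (d : ℝ) ^ (5 / 4 : ℝ)) := by
  rcases Nat.eq_zero_or_pos d with rfl | hd
  · simp
  have hd0 : (0 : ℝ) < d := by exact_mod_cast hd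
  have hd1 : (1 : ℝ) ≤ d := by exact_mod_cast hd
  have h1 : Real.log d ≤ (d : ℝ) ^ (1 / 4 : ℝ) / (1 / 4) :=
    Real.log_le_rpow_div hd0.le (by norm_num)
  have h2 : (1 : ℝ) ≤ (d : ℝ) ^ (1 / 4 : ℝ) := Real.one_le_rpow hd1 (by norm_num)
  have h3 : 1 / (d.totient : ℝ) ≤ 9 * (d : ℝ) ^ (1 / 4 : ℝ) / d := by
    rw [le_div_iff₀ hd0]
    calc 1 / (d.totient : ℝ) * d = d / d.totient := by ring
      _ ≤ 2 * Real.log d + 1 := div_totient_le (by omega)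
      _ ≤ _ := by linarith
  have h4 : (d : ℝ) ^ (5 / 4 : ℝ) * (d : ℝ) ^ (1 / 4 : ℝ) * √d = d * d := by
    rw [Real.sqrt_eq_rpow, ← Real.rpow_add hd0, ← Real.rpow_add hd0]
    norm_num
    ring
  have h5 : (0 : ℝ) < (d : ℝ) ^ (5 / 4 : ℝ) := by positivity
  calc totientWeight d * √d ≤ 9 * (d : ℝ) ^ (1 / 4 : ℝ) / d / d * √d := by
        rw [totientWeight]
        gcongr
        exact (sqfreeInvTotient_le d).trans h3
    _ = 9 * ((d : ℝ) ^ (5 / 4 : ℝ) * (d : ℝ) ^ (1 / 4 : ℝ) * √d) / (d * d) *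
        (1 / (d : ℝ) ^ (5 / 4 : ℝ)) := by field_simp
    _ = _ := by
        rw [h4]
        field_simp

lemma summable_totientWeight_mul_sqrt : Summable fun d => totientWeight d * √d := by
  refine Summable.of_nonneg_of_le
    (fun d => mul_nonneg (totientWeight_nonneg d) (Real.sqrt_nonneg _))
    totientWeight_mul_sqrt_le ?_
  exact (Real.summable_one_div_nat_rpow.mpr (by norm_num)).mul_left 9

lemma totientWeight_zero : totientWeight 0 = 0 := by simp [totientWeight]

lemma summable_totientWeight : Summable totientWeight := by
  refine Summable.of_nonneg_of_le totientWeight_nonneg (fun d => ?_)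
    summable_totientWeight_mul_sqrt
  rcases Nat.eq_zero_or_pos d with rfl | hd
  · simp [totientWeight_zero]
  · refine le_mul_of_one_le_right (totientWeight_nonneg d) ?_
    rw [Real.one_le_sqrt]
    exact_mod_cast hd

lemma log_le_two_mul_sqrt {y : ℝ} (hy : 0 ≤ y) : Real.log y ≤ 2 * √y := by
  have := Real.log_le_rpow_div hy (by norm_num : (0 : ℝ) < 1 / 2)
  rw [Real.sqrt_eq_rpow]
  linarith

lemma summable_totientWeight_mul_log :
    Summable fun d => totientWeight d * Real.log d := by
  refine Summable.of_nonneg_of_le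
    (fun d => mul_nonneg (totientWeight_nonneg d) (Real.log_natCast_nonneg d)) (fun d => ?_)
    (summable_totientWeight_mul_sqrt.mul_left 2)
  calc totientWeight d * Real.log d ≤ totientWeight d * (2 * √d) :=
        mul_le_mul_of_nonneg_left (log_le_two_mul_sqrt d.cast_nonneg) (totientWeight_nonneg d)
    _ = _ := by ring

lemma abs_sub_log_sub_le {H : ℝ → ℝ} {κ : ℝ} (h1 : ∀ y, 1 ≤ y → |H y - Real.log y - κ| ≤ 4 / y)
    (h0 : ∀ y, 0 < y → y < 1 → H y = 0) {y : ℝ} (hy : 0 < y) :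
    |H y - Real.log y - κ| ≤ (4 + |κ|) * √(1 / y) := by
  rcases le_or_gt 1 y with h | h
  · refine (h1 y h).trans ?_
    have h2 : 1 / y ≤ √(1 / y) := by
      rw [Real.le_sqrt (by positivity) (by positivity), sq]
      exact mul_le_of_le_one_left (by positivity) ((div_le_one hy).mpr h)
    calc 4 / y = 4 * (1 / y) := by ring
      _ ≤ (4 + |κ|) * √(1 / y) := by
        gcongr
        linarith [abs_nonneg κ]
  · rw [h0 y hy h]
    have h2 : 1 ≤ √(1 / y) := by
      rw [Real.one_le_sqrt, le_div_iff₀ hy]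
      linarith
    have h3 : -Real.log y ≤ 2 * √(1 / y) := by
      rw [← Real.log_inv, ← one_div]
      exact log_le_two_mul_sqrt (by positivity)
    have h4 := Real.log_nonpos hy.le h.le
    have h5 : |κ| ≤ |κ| * √(1 / y) := le_mul_of_one_le_right (abs_nonneg κ) h2
    have h6 := abs_le.mp (le_refl |κ|)
    rw [abs_le]
    constructor <;> nlinarith

lemma exists_sum_totientWeight_mul {H : ℝ → ℝ} {κ : ℝ}
    (h1 : ∀ y, 1 ≤ y → |H y - Real.log y - κ| ≤ 4 / y)
    (h0 : ∀ y, 0 < y → y < 1 → H y = 0) :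
    ∃ b C : ℝ, 0 < C ∧ ∀ R : ℕ, 1 ≤ R →
      |∑ d ∈ Icc 1 R, totientWeight d * H (R / d) - (∑' d, totientWeight d) * Real.log R - b| ≤
        C / √R := by
  have hS0 : 0 ≤ ∑' d, totientWeight d * √d :=
    tsum_nonneg fun d => mul_nonneg (totientWeight_nonneg d) (Real.sqrt_nonneg _)
  refine ⟨κ * (∑' d, totientWeight d) - ∑' d, totientWeight d * Real.log d,
    (4 + |κ|) * (∑' d, totientWeight d * √d) + 1, by positivity, fun R hR => ?_⟩
  have hR0 : (0 : ℝ) < R := by exact_mod_cast hR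
  have hsupp : ∀ d ∉ Icc 1 R, totientWeight d * H (R / d) = 0 := by
    intro d hd
    rw [mem_Icc, not_and_or, not_le, not_le] at hd
    rcases hd with hd | hd
    · rw [Nat.lt_one_iff.mp hd, totientWeight_zero, zero_mul]
    · have hd0 : (0 : ℝ) < d := by exact_mod_cast (by omega : 0 < d)
      rw [h0 _ (by positivity) ((div_lt_one hd0).mpr (by exact_mod_cast hd)), mul_zero]
  have hterm : ∀ d : ℕ, totientWeight d * H (R / d) - totientWeight d * Real.log R -
      (κ * totientWeight d - totientWeight d * Real.log d) =
      totientWeight d * (H (R / d) - Real.log (R / d) - κ) := by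
    intro d
    rcases Nat.eq_zero_or_pos d with rfl | hd
    · simp [totientWeight_zero]
    · have hd0 : (d : ℝ) ≠ 0 := by positivity
      rw [Real.log_div hR0.ne' hd0]
      ring
  have hbound : ∀ d : ℕ, ‖totientWeight d * (H (R / d) - Real.log (R / d) - κ)‖ ≤
      (4 + |κ|) / √R * (totientWeight d * √d) := by
    intro d
    rcases Nat.eq_zero_or_pos d with rfl | hd
    · simp [totientWeight_zero]
    · have hd0 : (0 : ℝ) < d := by exact_mod_cast hd
      rw [Real.norm_eq_abs, abs_mul, abs_of_nonneg (totientWeight_nonneg d)]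
      calc _ ≤ totientWeight d * ((4 + |κ|) * √(1 / (R / d))) :=
            mul_le_mul_of_nonneg_left (abs_sub_log_sub_le h1 h0 (by positivity))
              (totientWeight_nonneg d)
        _ = _ := by
            rw [one_div_div, Real.sqrt_div hd0.le]
            ring
  have htot := ((hasSum_sum_of_ne_finset_zero hsupp).sub
    (summable_totientWeight.hasSum.mul_right (Real.log R))).sub
    ((summable_totientWeight.hasSum.mul_left κ).sub summable_totientWeight_mul_log.hasSum)
  simp only [hterm] at htot
  have h2 := tsum_of_norm_bounded
    (summable_totientWeight_mul_sqrt.hasSum.mul_left ((4 + |κ|) / √R)) hbound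
  rw [htot.tsum_eq, Real.norm_eq_abs] at h2
  refine h2.trans ?_
  rw [div_mul_eq_mul_div]
  gcongr
  linarith

lemma abs_sum_inv_sub_log_le {y : ℝ} (hy : 1 ≤ y) :
    |∑ k ∈ Icc 1 ⌊y⌋₊, (1 : ℝ) / k - Real.log y - Real.eulerMascheroniConstant| ≤ 2 / y := by
  set m : ℕ := ⌊y⌋₊ with hm
  have hm1 : 1 ≤ m := (Nat.one_le_floor_iff y).mpr hy
  have hm0 : (0 : ℝ) < m := by exact_mod_cast hm1
  have hmy : (m : ℝ) ≤ y := Nat.floor_le (by linarith)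
  have hym : y < m + 1 := Nat.lt_floor_add_one y
  have hharm : ∑ k ∈ Icc 1 m, (1 : ℝ) / k = (harmonic m : ℝ) := by
    rw [harmonic_eq_sum_Icc]
    push_cast
    exact sum_congr rfl fun k _ => one_div _
  have h1 := Real.eulerMascheroniSeq_lt_eulerMascheroniConstant m
  have h2 := Real.eulerMascheroniConstant_lt_eulerMascheroniSeq' m
  rw [Real.eulerMascheroniSeq] at h1
  rw [Real.eulerMascheroniSeq', if_neg (by omega)] at h2
  have h3 : Real.log (m + 1) ≤ Real.log m + 1 / m := by
    have := Real.log_le_sub_one_of_pos (x := ((m : ℝ) + 1) / m) (by positivity)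
    rw [Real.log_div (by positivity) hm0.ne', add_div, div_self hm0.ne'] at this
    linarith
  have h4 : Real.log m ≤ Real.log y := Real.log_le_log hm0 hmy
  have h5 : Real.log y ≤ Real.log (m + 1) := Real.log_le_log (by linarith) hym.le
  have h6 : 1 / (m : ℝ) ≤ 2 / y := by
    rw [div_le_div_iff₀ hm0 (by linarith)]
    have : (1 : ℝ) ≤ m := by exact_mod_cast hm1
    linarith
  rw [hharm, abs_le]
  constructor <;> linarith

lemma abs_sum_sq_div_sub_log_le {y : ℝ} (hy : 1 ≤ y) :
    |∑ k ∈ Icc 1 ⌊y⌋₊, (1 - k / y) ^ 2 / k - Real.log y -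
      (Real.eulerMascheroniConstant - 3 / 2)| ≤ 4 / y := by
  have h := abs_sum_inv_sub_log_le hy
  set m : ℕ := ⌊y⌋₊ with hm
  have hy0 : 0 < y := by linarith
  have hmy : (m : ℝ) ≤ y := Nat.floor_le hy0.le
  have hym : y < m + 1 := Nat.lt_floor_add_one y
  have hgauss : ∑ k ∈ Icc 1 m, (k : ℝ) = m * (m + 1) / 2 := by
    clear_value m
    clear h hm hmy hym
    induction m with
    | zero => simp
    | succ m ih =>
      rw [sum_Icc_succ_top (by omega), ih]
      push_cast
      ring
  have h1 : ∑ k ∈ Icc 1 m, (1 - k / y) ^ 2 / k =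
      ∑ k ∈ Icc 1 m, (1 : ℝ) / k - 2 * m / y + m * (m + 1) / 2 / y ^ 2 := by
    rw [← hgauss, sum_div]
    have : (2 : ℝ) * m / y = ∑ k ∈ Icc 1 m, 2 / y := by
      rw [sum_const, Nat.card_Icc, nsmul_eq_mul, Nat.add_sub_cancel]
      ring
    rw [this, ← sum_sub_distrib, ← sum_add_distrib]
    refine sum_congr rfl fun k hk => ?_
    have hk0 : (k : ℝ) ≠ 0 := by
      have := (mem_Icc.mp hk).1
      positivity
    field_simp
    ring
  have h2 : |-(2 * m / y) + m * (m + 1) / 2 / y ^ 2 + 3 / 2| ≤ 2 / y := by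
    have e : -(2 * m / y) + m * (m + 1) / 2 / y ^ 2 + 3 / 2 =
        (3 * y ^ 2 - 4 * m * y + m ^ 2 + m) / (2 * y ^ 2) := by
      field_simp
      ring
    rw [e, abs_div, abs_of_pos (by positivity : 0 < 2 * y ^ 2), div_le_div_iff₀ (by positivity) hy0,
      show 2 * (2 * y ^ 2) = (4 * y) * y by ring]
    refine mul_le_mul_of_nonneg_right ?_ hy0.le
    rw [abs_le]
    have hm0 : (0 : ℝ) ≤ m := m.cast_nonneg
    constructor <;> nlinarith
  have e : ∑ k ∈ Icc 1 m, (1 - k / y) ^ 2 / k - Real.log y -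
      (Real.eulerMascheroniConstant - 3 / 2) =
      (∑ k ∈ Icc 1 m, (1 : ℝ) / k - Real.log y - Real.eulerMascheroniConstant) +
      (-(2 * m / y) + m * (m + 1) / 2 / y ^ 2 + 3 / 2) := by
    rw [h1]
    ring
  rw [e]
  refine (abs_add_le _ _).trans ((add_le_add h h2).trans_eq ?_)
  ring

lemma sum_div_totient_eq (f : ℕ → ℝ) (R : ℕ) :
    ∑ q ∈ Icc 1 R, f q / q.totient =
      ∑ d ∈ Icc 1 R, totientWeight d * ∑ k ∈ Icc 1 (R / d), f (d * k) / k := by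
  have h1 : ∀ q ∈ Icc 1 R, f q / q.totient =
      ∑ d ∈ q.divisors, sqfreeInvTotient d * (f q / q) := by
    intro q hq
    have hq0 : (q : ℝ) ≠ 0 := by
      have := (mem_Icc.mp hq).1
      positivity
    rw [← sum_mul, sum_divisors_sqfreeInvTotient (by exact_mod_cast hq0)]
    field_simp
  rw [sum_congr rfl h1, sum_Icc_sum_divisors R (fun d q => sqfreeInvTotient d * (f q / q))]
  refine sum_congr rfl fun d _ => ?_
  rw [mul_sum]
  refine sum_congr rfl fun k _ => ?_
  rw [totientWeight]
  push_cast
  ring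

theorem exists_totient_sums :
    ∃ a b b' C : ℝ, 0 < C ∧ ∀ R : ℕ, 1 ≤ R →
      |∑ q ∈ Icc 1 R, 1 / (q.totient : ℝ) - a * Real.log R - b| ≤ C / √R ∧
      |∑ q ∈ Icc 1 R, (1 - (q : ℝ) / R) ^ 2 / q.totient - a * Real.log R - b'| ≤ C / √R := by
  obtain ⟨b, C, hC, h⟩ := exists_sum_totientWeight_mul
    (H := fun y => ∑ k ∈ Icc 1 ⌊y⌋₊, (1 : ℝ) / k) (κ := Real.eulerMascheroniConstant)
    (fun y hy => (abs_sum_inv_sub_log_le hy).trans (by gcongr; norm_num))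
    (fun y _ hy => by simp [Nat.floor_eq_zero.mpr hy])
  obtain ⟨b', C', hC', h'⟩ := exists_sum_totientWeight_mul
    (H := fun y => ∑ k ∈ Icc 1 ⌊y⌋₊, (1 - k / y) ^ 2 / k)
    (κ := Real.eulerMascheroniConstant - 3 / 2)
    (fun y hy => abs_sum_sq_div_sub_log_le hy)
    (fun y _ hy => by simp [Nat.floor_eq_zero.mpr hy])
  refine ⟨∑' d, totientWeight d, b, b', C + C', by positivity, fun R hR => ⟨?_, ?_⟩⟩
  · have e := sum_div_totient_eq (fun _ => 1) R
    rw [e]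
    have h2 := h R hR
    simp only [Nat.floor_div_natCast, Nat.floor_natCast] at h2
    refine h2.trans ?_
    gcongr
    linarith
  · have e := sum_div_totient_eq (fun q => (1 - (q : ℝ) / R) ^ 2) R
    rw [e]
    have h2 := h' R hR
    simp only [Nat.floor_div_natCast, Nat.floor_natCast] at h2
    have e2 : ∀ d ∈ Icc 1 R, totientWeight d *
        ∑ k ∈ Icc 1 (R / d), (1 - ((d * k : ℕ) : ℝ) / R) ^ 2 / k =
        totientWeight d * ∑ k ∈ Icc 1 (R / d), (1 - (k : ℝ) / (R / d)) ^ 2 / k := by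
      intro d _
      congr 1
      refine sum_congr rfl fun k _ => ?_
      push_cast
      congr 3
      rw [div_div_eq_mul_div]
      ring
    rw [sum_congr rfl e2]
    refine h2.trans ?_
    gcongr
    linarith

end TotientSums

section DivisorSwitching

open scoped ArithmeticFunction.vonMangoldt

lemma sum_sum_Icc_eq_diag_add_two_mul {f : ℕ → ℕ → ℝ} (hf : ∀ n m, f n m = f m n) (N : ℕ) :
    ∑ n ∈ Icc 1 N, ∑ m ∈ Icc 1 N, f n m =
      ∑ n ∈ Icc 1 N, f n n + 2 * ∑ n ∈ Icc 1 N, ∑ m ∈ Ico 1 n, f n m := by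
  induction N with
  | zero => simp
  | succ N ih =>
    have h1 : ∀ n ∈ Icc 1 N, ∑ m ∈ Icc 1 (N + 1), f n m =
        ∑ m ∈ Icc 1 N, f n m + f (N + 1) n := by
      intro n _
      rw [sum_Icc_succ_top (by omega), hf n (N + 1)]
    have h2 : Ico 1 (N + 1) = Icc 1 N := by
      ext k
      simp
    rw [sum_Icc_succ_top (by omega), sum_congr rfl h1, sum_add_distrib, ih,
      sum_Icc_succ_top (by omega), sum_Icc_succ_top (by omega),
      sum_Icc_succ_top (by omega) (fun n => ∑ m ∈ Ico 1 n, f n m), h2]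
    ring

/-- The off-diagonal part of the second moment, each pair counted once. -/
noncomputable def offDiagonal (N q : ℕ) : ℝ :=
  ∑ n ∈ Icc 1 N, ∑ m ∈ Ico 1 n, if q ∣ n - m then Λ n * Λ m else 0

lemma residueMoment_eq (N q : ℕ) :
    residueMoment N q = ∑ n ∈ Icc 1 N, Λ n ^ 2 + 2 * offDiagonal N q := by
  have h1 : residueMoment N q =
      ∑ n ∈ Icc 1 N, ∑ m ∈ Icc 1 N, if m % q = n % q then Λ n * Λ m else 0 := by
    rw [residueMoment]
    refine sum_congr rfl fun n _ => ?_
    rw [psiNat, mul_sum, sum_filter]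
  rw [h1, sum_sum_Icc_eq_diag_add_two_mul (f := fun n m =>
    if m % q = n % q then Λ n * Λ m else 0)
    (fun n m => by simp only [eq_comm (a := m % q), mul_comm (Λ m)])]
  congr 1
  · refine sum_congr rfl fun n _ => ?_
    rw [if_pos rfl, sq]
  · rw [offDiagonal]
    congr 1
    refine sum_congr rfl fun n _ => sum_congr rfl fun m hm => ?_
    have : m % q = n % q ↔ q ∣ n - m := Nat.modEq_iff_dvd' (mem_Ico.mp hm).2.le
    simp only [this]

lemma card_large_divisors {N R h : ℕ} (hR : 1 ≤ R) (h1 : 1 ≤ h) (hN : h ≤ N) :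
    #((Ioc (N / R) N).filter (fun q => q ∣ h)) =
      #((Icc 1 R).filter (fun r => r ∣ h ∧ r * N / R < h)) := by
  refine card_bij' (fun q _ => h / q) (fun r _ => h / r) ?_ ?_ ?_ ?_
  · intro q hq
    rw [mem_filter, mem_Ioc, Nat.div_lt_iff_lt_mul hR] at hq
    obtain ⟨⟨hq1, hq2⟩, c, rfl⟩ := hq
    have hq0 : 0 < q := Nat.pos_of_mul_pos_right h1
    have hc0 : 0 < c := Nat.pos_of_mul_pos_left h1
    rw [mem_filter, mem_Icc, Nat.mul_div_cancel_left _ hq0, Nat.div_lt_iff_lt_mul hR]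
    have h3 : c * N < q * c * R := by nlinarith
    refine ⟨⟨hc0, ?_⟩, dvd_mul_left _ _, h3⟩
    by_contra hcR
    nlinarith
  · intro r hr
    rw [mem_filter, mem_Icc, Nat.div_lt_iff_lt_mul hR] at hr
    obtain ⟨⟨hr1, hr2⟩, ⟨c, rfl⟩, hr3⟩ := hr
    have hc0 : 0 < c := Nat.pos_of_mul_pos_left h1
    rw [mem_filter, mem_Ioc, Nat.mul_div_cancel_left _ hr1, Nat.div_lt_iff_lt_mul hR]
    refine ⟨⟨?_, ?_⟩, dvd_mul_left _ _⟩
    · by_contra hcN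
      nlinarith
    · nlinarith
  · intro q hq
    exact Nat.div_div_self (mem_filter.mp hq).2 (by omega)
  · intro r hr
    exact Nat.div_div_self (mem_filter.mp hr).2.1 (by omega)

lemma sum_Ioc_offDiagonal {N R : ℕ} (hR : 1 ≤ R) :
    ∑ q ∈ Ioc (N / R) N, offDiagonal N q =
      ∑ r ∈ Icc 1 R, ∑ n ∈ Icc 1 N, Λ n * psiNat (n - r * N / R - 1) r n := by
  have h1 : ∀ r n : ℕ, Λ n * psiNat (n - r * N / R - 1) r n =
      ∑ m ∈ Ico 1 n, if r ∣ n - m ∧ r * N / R < n - m then Λ n * Λ m else 0 := by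
    intro r n
    rw [psiNat, mul_sum, ← sum_filter]
    refine sum_congr ?_ fun _ _ => rfl
    ext m
    generalize r * N / R = K
    simp only [mem_filter, mem_Icc, mem_Ico]
    constructor
    · rintro ⟨⟨h1, h2⟩, h3⟩
      exact ⟨⟨h1, by omega⟩, (Nat.modEq_iff_dvd' (by omega)).mp h3, by omega⟩
    · rintro ⟨⟨h1, h2⟩, h3, h4⟩
      exact ⟨⟨h1, by omega⟩, (Nat.modEq_iff_dvd' h2.le).mpr h3⟩
  simp only [h1, offDiagonal]
  rw [sum_comm, sum_comm (s := Icc 1 R)]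
  refine sum_congr rfl fun n hn => ?_
  rw [sum_comm, sum_comm (s := Icc 1 R)]
  refine sum_congr rfl fun m hm => ?_
  rw [mem_Icc] at hn
  rw [mem_Ico] at hm
  rw [← sum_filter, ← sum_filter, sum_const, sum_const,
    card_large_divisors hR (by omega) (by omega)]

lemma sum_residueMoment_eq {N R : ℕ} (hR : 1 ≤ R) :
    ∑ q ∈ Icc 1 N, residueMoment N q = N * ∑ n ∈ Icc 1 N, Λ n ^ 2 +
      (∑ q ∈ Icc 1 (N / R), residueMoment N q - (N / R : ℕ) * ∑ n ∈ Icc 1 N, Λ n ^ 2) +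
      2 * ∑ r ∈ Icc 1 R, ∑ n ∈ Icc 1 N, Λ n * psiNat (n - r * N / R - 1) r n := by
  have h1 : ∀ M : ℕ, ∑ q ∈ Icc 1 M, residueMoment N q =
      M * ∑ n ∈ Icc 1 N, Λ n ^ 2 + 2 * ∑ q ∈ Icc 1 M, offDiagonal N q := by
    intro M
    simp only [residueMoment_eq, sum_add_distrib, sum_const, Nat.card_Icc, nsmul_eq_mul,
      Nat.add_sub_cancel, mul_sum]
  have h2 : ∑ q ∈ Icc 1 N, offDiagonal N q =
      ∑ q ∈ Icc 1 (N / R), offDiagonal N q + ∑ q ∈ Ioc (N / R) N, offDiagonal N q := by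
    rw [← sum_union (disjoint_left.mpr fun q h1 h2 => by
      rw [mem_Icc] at h1; rw [mem_Ioc] at h2; omega)]
    refine sum_congr ?_ fun _ _ => rfl
    ext q
    have := Nat.div_le_self N R
    generalize N / R = Q at *
    simp only [mem_union, mem_Icc, mem_Ioc]
    omega
  rw [h1, h1, h2, ← sum_Ioc_offDiagonal hR]
  ring

end DivisorSwitching

section LargeModuli

open scoped ArithmeticFunction.vonMangoldt

lemma sum_vonMangoldt_mul_sub_eq (N K : ℕ) :
    ∑ n ∈ Icc 1 N, Λ n * ((n - K - 1 : ℕ) : ℝ) =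
      ∑ k ∈ Ico (K + 1) N, (∑ n ∈ Icc 1 N, Λ n - ∑ n ∈ Icc 1 k, Λ n) := by
  have h1 : ∀ k ∈ Ico (K + 1) N, ∑ n ∈ Icc 1 N, Λ n - ∑ n ∈ Icc 1 k, Λ n =
      ∑ n ∈ Icc 1 N, if k < n then Λ n else 0 := by
    intro k hk
    rw [mem_Ico] at hk
    have : Icc 1 k = (Icc 1 N).filter (fun n => ¬ k < n) := by
      ext n
      rw [mem_filter, mem_Icc, mem_Icc]
      omega
    rw [this, ← sum_filter_add_sum_filter_not (Icc 1 N) (fun n => k < n), sum_filter]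
    ring
  rw [sum_congr rfl h1, sum_comm]
  refine sum_congr rfl fun n hn => ?_
  rw [← sum_filter, sum_const, nsmul_eq_mul, mul_comm]
  congr 2
  have : (Ico (K + 1) N).filter (fun k => k < n) = Ico (K + 1) n := by
    ext k
    rw [mem_Icc] at hn
    rw [mem_filter, mem_Ico, mem_Ico]
    omega
  rw [this, Nat.card_Ico]
  omega

lemma sum_Ico_sub_eq {N K : ℕ} (h : K ≤ N) :
    ∑ k ∈ Ico (K + 1) N, ((N : ℝ) - k) = ((N : ℝ) - K) * (N - K - 1) / 2 := by
  induction N, h using Nat.le_induction with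
  | base => simp
  | succ N h ih =>
    rcases h.eq_or_lt with rfl | hlt
    · simp
    · rw [sum_Ico_succ_top (by omega)]
      have h1 : ∑ k ∈ Ico (K + 1) N, (((N + 1 : ℕ) : ℝ) - k) =
          ∑ k ∈ Ico (K + 1) N, ((N : ℝ) - k) + ((N : ℝ) - K - 1) := by
        have h2 : ((N : ℝ) - K - 1) = ∑ k ∈ Ico (K + 1) N, (1 : ℝ) := by
          rw [sum_const, Nat.card_Ico, nsmul_eq_mul, Nat.cast_sub (by omega)]
          push_cast
          ring
        rw [h2, ← sum_add_distrib]
        refine sum_congr rfl fun k _ => ?_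
        push_cast
        ring
      rw [h1, ih]
      push_cast
      ring

lemma abs_sum_vonMangoldt_mul_sub_le (A : ℕ) :
    ∃ C : ℝ, 0 < C ∧ ∀ N : ℕ, 1 ≤ N → ∀ K ≤ N,
      |∑ n ∈ Icc 1 N, Λ n * ((n - K - 1 : ℕ) : ℝ) - ((N : ℝ) - K) ^ 2 / 2| ≤
        C * N ^ 2 / Real.log (N + 2) ^ A := by
  obtain ⟨C₁, hC₁, h₁⟩ := abs_sum_vonMangoldt_sub_le_uniform A
  obtain ⟨C₂, hC₂, h₂⟩ := exists_log_pow_le_mul A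
  refine ⟨2 * C₁ + C₂, by positivity, fun N hN K hK => ?_⟩
  have hL := one_le_log_add_two hN
  set L : ℝ := Real.log (N + 2) with hLdef
  have hN0 : (0 : ℝ) < N := by exact_mod_cast hN
  have hLA : 0 < L ^ A := by positivity
  set ψ : ℕ → ℝ := fun M => ∑ n ∈ Icc 1 M, Λ n with hψ
  have e1 : ∑ n ∈ Icc 1 N, Λ n * ((n - K - 1 : ℕ) : ℝ) - ((N : ℝ) - K) ^ 2 / 2 =
      ∑ k ∈ Ico (K + 1) N, (ψ N - N - (ψ k - k)) - ((N : ℝ) - K) / 2 := by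
    have h3 : ∑ k ∈ Ico (K + 1) N, (ψ N - N - (ψ k - k)) =
        ∑ k ∈ Ico (K + 1) N, (ψ N - ψ k) - ∑ k ∈ Ico (K + 1) N, ((N : ℝ) - k) := by
      rw [← sum_sub_distrib]
      exact sum_congr rfl fun k _ => by ring
    rw [h3, sum_Ico_sub_eq hK, sum_vonMangoldt_mul_sub_eq]
    ring
  have e2 : |∑ k ∈ Ico (K + 1) N, (ψ N - N - (ψ k - k))| ≤ N * (2 * (C₁ * N / L ^ A)) := by
    calc _ ≤ ∑ k ∈ Ico (K + 1) N, 2 * (C₁ * N / L ^ A) := by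
          refine (abs_sum_le_sum_abs _ _).trans (sum_le_sum fun k hk => ?_)
          refine (abs_sub _ _).trans ?_
          have a1 := h₁ N hN N le_rfl
          have a2 := h₁ N hN k (mem_Ico.mp hk).2.le
          simp only [hψ]
          linarith
      _ ≤ _ := by
          rw [sum_const, Nat.card_Ico, nsmul_eq_mul]
          gcongr
          omega
  have e3 : ((N : ℝ) - K) / 2 ≤ C₂ * N ^ 2 / L ^ A := by
    rw [le_div_iff₀ hLA]
    have h4 : ((N : ℝ) - K) / 2 ≤ N := by
      have : (0 : ℝ) ≤ K := K.cast_nonneg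
      linarith
    calc ((N : ℝ) - K) / 2 * L ^ A ≤ N * (C₂ * N) := by
          gcongr
          exact h₂ N hN
      _ = _ := by ring
  have e4 : 0 ≤ ((N : ℝ) - K) / 2 := by
    have : (K : ℝ) ≤ N := by exact_mod_cast hK
    linarith
  have e5 : (2 * C₁ + C₂) * N ^ 2 / L ^ A = N * (2 * (C₁ * N / L ^ A)) + C₂ * N ^ 2 / L ^ A := by
    ring
  rw [e1, e5]
  refine (abs_sub _ _).trans (add_le_add e2 ?_)
  rwa [abs_of_nonneg e4]

lemma abs_sq_sub_sq_le {N R r : ℕ} (hR : 1 ≤ R) (hr : r ≤ R) :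
    |((N : ℝ) - (r * N / R : ℕ)) ^ 2 / 2 - N ^ 2 * (1 - (r : ℝ) / R) ^ 2 / 2| ≤ (N : ℝ) := by
  have hR0 : (0 : ℝ) < R := by exact_mod_cast hR
  set K : ℕ := r * N / R with hK
  set u : ℝ := (r : ℝ) * N / R with hu
  have h1 : (K : ℝ) ≤ u := by
    have := Nat.cast_div_le (α := ℝ) (m := r * N) (n := R)
    rw [hu, hK]
    exact_mod_cast this
  have h2 : u ≤ K + 1 := by
    rw [hu, div_le_iff₀ hR0]
    have := (Nat.lt_mul_div_succ (r * N) hR).le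
    have h3 : ((r * N : ℕ) : ℝ) ≤ ((R * (r * N / R + 1) : ℕ) : ℝ) := by exact_mod_cast this
    rw [← hK] at h3
    push_cast at h3
    linarith
  have h4 : u ≤ N := by
    rw [hu, div_le_iff₀ hR0, mul_comm]
    have : (r : ℝ) ≤ R := by exact_mod_cast hr
    gcongr
  have h5 : (N : ℝ) ^ 2 * (1 - (r : ℝ) / R) ^ 2 = (N - u) ^ 2 := by
    rw [hu]
    ring
  have hK0 : (0 : ℝ) ≤ K := K.cast_nonneg
  rw [h5, abs_le]
  constructor <;> nlinarith

lemma abs_sum_vonMangoldt_mul_psiNat_sub_le (A : ℕ) :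
    ∃ C : ℝ, 0 < C ∧ ∀ N : ℕ, 1 ≤ N → ∀ R r : ℕ, 1 ≤ r → r ≤ R → (r : ℝ) ≤ Real.log (N + 2) ^ A →
      |∑ n ∈ Icc 1 N, Λ n * psiNat (n - r * N / R - 1) r n -
        N ^ 2 / 2 * ((1 - (r : ℝ) / R) ^ 2 / r.totient)| ≤ C * N ^ 2 / Real.log (N + 2) ^ A := by
  obtain ⟨C₁, hC₁, h₁⟩ := siegel_walfisz_uniform A
  obtain ⟨C₂, hC₂, h₂⟩ := abs_sum_vonMangoldt_mul_sub_le A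
  obtain ⟨C₃, hC₃, h₃⟩ := exists_log_pow_le_div (A + 2) A
  obtain ⟨C₄, hC₄, h₄⟩ := exists_sum_vonMangoldt_le
  obtain ⟨C₅, hC₅, h₅⟩ := exists_log_pow_le_mul A
  refine ⟨C₁ * C₄ + (C₂ + C₅ + 6 * C₃), by positivity, fun N hN R r hr hrR hrL => ?_⟩
  have hL := one_le_log_add_two hN
  set L : ℝ := Real.log (N + 2) with hLdef
  have hφ : (1 : ℝ) ≤ r.totient := by exact_mod_cast Nat.totient_pos.mpr hr
  have hN0 : (0 : ℝ) < N := by exact_mod_cast hN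
  have hLA : 0 < L ^ A := by positivity
  have hR : 1 ≤ R := hr.trans hrR
  have hKN : r * N / R ≤ N := Nat.div_le_of_le_mul (Nat.mul_le_mul_right N hrR)
  have hsq := abs_sq_sub_sq_le (N := N) hR hrR
  have hlin := h₂ N hN _ hKN
  set K : ℕ := r * N / R with hK
  set g : ℕ → ℝ := fun n => ((n - K - 1 : ℕ) : ℝ) with hg
  have hgN : ∀ n ∈ Icc 1 N, g n ≤ N := by
    intro n hn
    rw [mem_Icc] at hn
    simp only [hg]
    exact_mod_cast (Nat.sub_le _ _).trans ((Nat.sub_le _ _).trans hn.2)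
  have e1 : ∑ n ∈ Icc 1 N, Λ n * psiNat (n - K - 1) r n -
        N ^ 2 / 2 * ((1 - (r : ℝ) / R) ^ 2 / r.totient) =
      ∑ n ∈ Icc 1 N, Λ n * (psiNat (n - K - 1) r n - if n.Coprime r then g n / r.totient else 0) +
      1 / r.totient * (∑ n ∈ (Icc 1 N).filter (fun n => n.Coprime r), Λ n * g n -
        N ^ 2 * (1 - (r : ℝ) / R) ^ 2 / 2) := by
    have : ∑ n ∈ Icc 1 N, Λ n * (if n.Coprime r then g n / r.totient else 0) =
        1 / r.totient * ∑ n ∈ (Icc 1 N).filter (fun n => n.Coprime r), Λ n * g n := by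
      rw [sum_filter, mul_sum]
      refine sum_congr rfl fun n _ => ?_
      split_ifs <;> ring
    simp only [mul_sub, sum_sub_distrib]
    rw [this]
    ring
  have e2 : |∑ n ∈ Icc 1 N, Λ n *
      (psiNat (n - K - 1) r n - if n.Coprime r then g n / r.totient else 0)|
      ≤ C₁ * C₄ * N ^ 2 / L ^ A := by
    calc _ ≤ ∑ n ∈ Icc 1 N, Λ n * (C₁ * N / L ^ A) := by
          refine (abs_sum_le_sum_abs _ _).trans (sum_le_sum fun n hn => ?_)
          rw [abs_mul, abs_of_nonneg ArithmeticFunction.vonMangoldt_nonneg]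
          rw [mem_Icc] at hn
          exact mul_le_mul_of_nonneg_left (h₁ N hN (n - K - 1) ((Nat.sub_le _ _).trans ((Nat.sub_le _ _).trans hn.2)) r n hr hrL)
            ArithmeticFunction.vonMangoldt_nonneg
      _ = (∑ n ∈ Icc 1 N, Λ n) * (C₁ * N / L ^ A) := by rw [sum_mul]
      _ ≤ C₄ * N * (C₁ * N / L ^ A) := by
          gcongr
          exact h₄ N
      _ = _ := by ring
  have e3 : |∑ n ∈ (Icc 1 N).filter (fun n => n.Coprime r), Λ n * g n -
      N ^ 2 * (1 - (r : ℝ) / R) ^ 2 / 2| ≤ (C₂ + C₅ + 6 * C₃) * N ^ 2 / L ^ A := by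
    have a0 : ∑ n ∈ (Icc 1 N).filter (fun n => n.Coprime r), Λ n * g n =
        ∑ n ∈ Icc 1 N, Λ n * g n -
          ∑ n ∈ (Icc 1 N).filter (fun n => ¬ n.Coprime r), Λ n * g n := by
      rw [← sum_filter_add_sum_filter_not (Icc 1 N) (fun n => n.Coprime r)]
      ring
    have a1 : 0 ≤ ∑ n ∈ (Icc 1 N).filter (fun n => ¬ n.Coprime r), Λ n * g n :=
      sum_nonneg fun n _ => mul_nonneg ArithmeticFunction.vonMangoldt_nonneg (Nat.cast_nonneg _)
    have a2 : ∑ n ∈ (Icc 1 N).filter (fun n => ¬ n.Coprime r), Λ n * g n ≤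
        6 * C₃ * N ^ 2 / L ^ A := by
      have b1 : Real.log r ≤ L ^ A := by
        have := Real.log_le_sub_one_of_pos (x := r) (by positivity)
        linarith
      calc _ ≤ ∑ n ∈ (Icc 1 N).filter (fun n => ¬ n.Coprime r), Λ n * N :=
            sum_le_sum fun n hn => mul_le_mul_of_nonneg_left
              (hgN n (mem_filter.mp hn).1) ArithmeticFunction.vonMangoldt_nonneg
        _ = (∑ n ∈ (Icc 1 N).filter (fun n => ¬ n.Coprime r), Λ n) * N := by rw [sum_mul]
        _ ≤ 6 * Real.log r * L ^ 2 * N := by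
            gcongr
            exact sum_vonMangoldt_not_coprime_le_log hN hr
        _ ≤ 6 * L ^ A * L ^ 2 * N := by gcongr
        _ = 6 * L ^ (A + 2) * N := by ring
        _ ≤ 6 * (C₃ * N / L ^ A) * N := by
            gcongr
            exact h₃ N hN
        _ = _ := by ring
    have a3 : (N : ℝ) ≤ C₅ * N ^ 2 / L ^ A := by
      rw [le_div_iff₀ hLA]
      calc N * L ^ A ≤ N * (C₅ * N) := by
            gcongr
            exact h₅ N hN
        _ = _ := by ring
    have a4 : (C₂ + C₅ + 6 * C₃) * N ^ 2 / L ^ A =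
        C₂ * N ^ 2 / L ^ A + C₅ * N ^ 2 / L ^ A + 6 * C₃ * N ^ 2 / L ^ A := by ring
    have a5 : 0 ≤ 6 * C₃ * N ^ 2 / L ^ A := by positivity
    rw [a0, a4]
    rw [abs_le] at hlin hsq ⊢
    simp only [hg] at *
    constructor <;> linarith
  rw [e1]
  refine (abs_add_le _ _).trans ?_
  have e4 : |1 / (r.totient : ℝ) * (∑ n ∈ (Icc 1 N).filter (fun n => n.Coprime r), Λ n * g n -
      N ^ 2 * (1 - (r : ℝ) / R) ^ 2 / 2)| ≤ (C₂ + C₅ + 6 * C₃) * N ^ 2 / L ^ A := by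
    rw [abs_mul, abs_of_nonneg (by positivity)]
    refine (mul_le_of_le_one_left (abs_nonneg _) ?_).trans e3
    rw [div_le_one (by linarith)]
    exact hφ
  calc _ ≤ C₁ * C₄ * N ^ 2 / L ^ A + (C₂ + C₅ + 6 * C₃) * N ^ 2 / L ^ A := add_le_add e2 e4
    _ = _ := by ring

lemma abs_sum_sum_vonMangoldt_mul_psiNat_sub_le (A : ℕ) :
    ∃ C : ℝ, 0 < C ∧ ∀ N : ℕ, 1 ≤ N → ∀ R : ℕ, (R : ℝ) ≤ Real.log (N + 2) ^ A →
      |∑ r ∈ Icc 1 R, ∑ n ∈ Icc 1 N, Λ n * psiNat (n - r * N / R - 1) r n -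
        N ^ 2 / 2 * ∑ r ∈ Icc 1 R, (1 - (r : ℝ) / R) ^ 2 / r.totient| ≤
          R * (C * N ^ 2 / Real.log (N + 2) ^ A) := by
  obtain ⟨C, hC, h⟩ := abs_sum_vonMangoldt_mul_psiNat_sub_le A
  refine ⟨C, hC, fun N hN R hR => ?_⟩
  rw [mul_sum, ← sum_sub_distrib]
  calc _ ≤ ∑ r ∈ Icc 1 R, C * N ^ 2 / Real.log (N + 2) ^ A := by
        refine (abs_sum_le_sum_abs _ _).trans (sum_le_sum fun r hr => ?_)
        rw [mem_Icc] at hr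
        have : (r : ℝ) ≤ R := by exact_mod_cast hr.2
        exact h N hN R r hr.1 hr.2 (this.trans hR)
    _ = _ := by rw [sum_const, Nat.card_Icc, nsmul_eq_mul, Nat.add_sub_cancel]

end LargeModuli

section FullSecondMoment

open scoped ArithmeticFunction.vonMangoldt

lemma eventually_le_log_add_two (T : ℝ) : ∃ N₀ : ℕ, ∀ N ≥ N₀, T ≤ Real.log (N + 2) := by
  refine ⟨⌈Real.exp T⌉₊, fun N hN => ?_⟩
  rw [Real.le_log_iff_exp_le (by positivity)]
  have h1 : Real.exp T ≤ N := (Nat.le_ceil _).trans (by exact_mod_cast hN)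
  linarith

lemma eventually_mul_log_pow_le (j : ℕ) :
    ∃ N₀ : ℕ, ∀ N ≥ N₀, 1 ≤ N → 4 * Real.log (N + 2) ^ j ≤ N := by
  obtain ⟨C, hC, h⟩ := exists_log_pow_le_mul (j + 1)
  obtain ⟨N₀, hN₀⟩ := eventually_le_log_add_two (4 * C)
  refine ⟨N₀, fun N hN hN1 => ?_⟩
  have hL := one_le_log_add_two hN1
  have h1 := h N hN1
  have h2 := hN₀ N hN
  set L : ℝ := Real.log (N + 2)
  have hN0 : (0 : ℝ) ≤ N := N.cast_nonneg
  refine le_of_mul_le_mul_left ?_ (by linarith : 0 < L)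
  calc L * (4 * L ^ j) = 4 * L ^ (j + 1) := by ring
    _ ≤ 4 * (C * N) := by gcongr
    _ = 4 * C * N := by ring
    _ ≤ L * N := by gcongr

lemma div_sqrt_le_div_pow {L y D : ℝ} {A : ℕ} (hL : 1 ≤ L) (hD : 0 ≤ D) (h : L ^ (2 * A) ≤ y) :
    D / √y ≤ D / L ^ A := by
  have h1 : L ^ A ≤ √y := by
    refine Real.le_sqrt_of_sq_le ?_
    rw [← pow_mul, mul_comm A 2]
    exact h
  gcongr

lemma abs_log_floor_div_le {N R : ℕ} (hR : 1 ≤ R) (hQ : 1 ≤ N / R) :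
    |Real.log (N / R : ℕ) + Real.log R - Real.log N| ≤ 1 / (N / R : ℕ) := by
  have h1 : R * (N / R) ≤ N := Nat.mul_div_le N R
  have h2 : N < R * (N / R + 1) := Nat.lt_mul_div_succ N hR
  set Q : ℕ := N / R
  have hR0 : (0 : ℝ) < R := by exact_mod_cast hR
  have hQ0 : (0 : ℝ) < Q := by exact_mod_cast hQ
  have h3 : (R : ℝ) * Q ≤ N := by exact_mod_cast h1
  have h4 : (N : ℝ) ≤ R * (Q + 1) := by exact_mod_cast h2.le
  have hN0 : (0 : ℝ) < N := lt_of_lt_of_le (by positivity) h3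
  have e1 : Real.log R + Real.log Q ≤ Real.log N := by
    rw [← Real.log_mul hR0.ne' hQ0.ne']
    exact Real.log_le_log (by positivity) h3
  have e2 : Real.log N ≤ Real.log R + Real.log (Q + 1) := by
    rw [← Real.log_mul hR0.ne' (by positivity)]
    exact Real.log_le_log hN0 h4
  have e3 : Real.log (Q + 1) ≤ Real.log Q + 1 / Q := by
    have := Real.log_le_sub_one_of_pos (x := ((Q : ℝ) + 1) / Q) (by positivity)
    rw [Real.log_div (by positivity) hQ0.ne', add_div, div_self hQ0.ne'] at this
    linarith
  rw [abs_le]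
  constructor <;> linarith [one_div_pos.mpr hQ0]

theorem abs_sum_residueMoment_sub_le {a b b' D : ℝ} (hD : 0 < D)
    (hΦ : ∀ R : ℕ, 1 ≤ R →
      |∑ q ∈ Icc 1 R, 1 / (q.totient : ℝ) - a * Real.log R - b| ≤ D / √R ∧
      |∑ q ∈ Icc 1 R, (1 - (q : ℝ) / R) ^ 2 / q.totient - a * Real.log R - b'| ≤ D / √R)
    (A : ℕ) : ∃ C : ℝ, 0 < C ∧ ∃ N₀ : ℕ, ∀ N ≥ N₀, 1 ≤ N →
      |∑ q ∈ Icc 1 N, residueMoment N q -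
        N ^ 2 * (Real.log N + (a * Real.log N - 1 + b + b'))| ≤
          C * (N ^ 2 / Real.log (N + 2) ^ A) := by
  obtain ⟨C₀, hC₀, h₀⟩ := abs_sum_vonMangoldt_sq_sub_le A
  obtain ⟨B₀, C₁, hC₁, h₁⟩ := sum_abs_residueMoment_sub_le A
  obtain ⟨C₂, hC₂, h₂⟩ := exists_sum_vonMangoldt_sq_le
  set B : ℕ := B₀ + 2 * A + 1 with hB
  obtain ⟨C₃, hC₃, h₃⟩ := abs_sum_sum_vonMangoldt_mul_psiNat_sub_le (B + 1 + A)
  obtain ⟨N₁, hN₁⟩ := eventually_le_log_add_two 2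
  obtain ⟨N₂, hN₂⟩ := eventually_mul_log_pow_le (B + 2 * A)
  refine ⟨C₀ + C₁ + C₂ + 2 * C₃ + 2 * D + |a|, by positivity, max N₁ N₂, fun N hN hN1 => ?_⟩
  have hL2 := hN₁ N ((le_max_left _ _).trans hN)
  have hNL := hN₂ N ((le_max_right _ _).trans hN) hN1
  have i₀ := h₀ N hN1
  have i₁ := h₁ N hN1
  have i₂ := h₂ N
  have i₃ := h₃ N hN1
  set L : ℝ := Real.log (N + 2) with hLdef
  have hL : 1 ≤ L := by linarith
  have hN0 : (0 : ℝ) < N := by exact_mod_cast hN1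
  have hLA : 0 < L ^ A := by positivity
  have hLB1 : 1 ≤ L ^ B := one_le_pow₀ hL
  set R : ℕ := ⌈L ^ B⌉₊ with hR
  have hRB : L ^ B ≤ R := Nat.le_ceil _
  have hRB2 : (R : ℝ) ≤ 2 * L ^ B := by
    have := Nat.ceil_lt_add_one (show 0 ≤ L ^ B by positivity)
    linarith
  have hRB3 : (R : ℝ) ≤ L ^ (B + 1) := by
    rw [pow_succ']
    exact hRB2.trans (mul_le_mul_of_nonneg_right hL2 (by positivity))
  have hR0 : (0 : ℝ) < R := by linarith
  have hR1 : 1 ≤ R := by exact_mod_cast hR0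
  set Q : ℕ := N / R with hQ
  have hQN : (Q : ℝ) * R ≤ N := by exact_mod_cast Nat.div_mul_le_self N R
  have hQB : (Q : ℝ) * L ^ B ≤ N := (mul_le_mul_of_nonneg_left hRB Q.cast_nonneg).trans hQN
  have hQ2 : L ^ (2 * A) ≤ Q := by
    have e1 : (N : ℝ) ≤ R * (Q + 1) := by exact_mod_cast (Nat.lt_mul_div_succ N hR1).le
    have e2 : (4 : ℝ) * L ^ (B + 2 * A) ≤ 2 * L ^ B * (Q + 1) :=
      (hNL.trans e1).trans (mul_le_mul_of_nonneg_right hRB2 (by positivity))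
    have e3 : 2 * L ^ (2 * A) ≤ Q + 1 := by
      refine le_of_mul_le_mul_left ?_ (by positivity : 0 < 2 * L ^ B)
      refine le_trans (le_of_eq ?_) e2
      ring
    have e4 : 1 ≤ L ^ (2 * A) := one_le_pow₀ hL
    linarith
  have hQ0 : (0 : ℝ) < Q := lt_of_lt_of_le (by positivity) hQ2
  have hQ1 : 1 ≤ Q := by exact_mod_cast hQ0
  set S : ℝ := ∑ n ∈ Icc 1 N, Λ n ^ 2 with hS
  set U : ℝ := ∑ r ∈ Icc 1 R, ∑ n ∈ Icc 1 N, Λ n * psiNat (n - r * N / R - 1) r n with hU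
  set Φ : ℝ := ∑ q ∈ Icc 1 Q, 1 / (q.totient : ℝ) with hΦdef
  set Ψ : ℝ := ∑ q ∈ Icc 1 R, (1 - (q : ℝ) / R) ^ 2 / q.totient with hΨdef
  set X : ℝ := N ^ 2 / L ^ A with hX
  have hX0 : 0 < X := by positivity
  have k0 : |N * (S - (N * Real.log N - N))| ≤ C₀ * X := by
    rw [abs_mul, Nat.abs_cast]
    calc N * |S - (N * Real.log N - N)| ≤ N * (C₀ * N / L ^ A) := by gcongr
      _ = _ := by rw [hX]; ring
  have k1 : |∑ q ∈ Icc 1 Q, residueMoment N q - N ^ 2 * Φ| ≤ C₁ * X := by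
    rw [hΦdef, mul_sum, ← sum_sub_distrib]
    calc _ ≤ ∑ q ∈ Icc 1 Q, |residueMoment N q - (N : ℝ) ^ 2 / q.totient| := by
          simp only [mul_one_div]
          exact abs_sum_le_sum_abs _ _
      _ ≤ C₁ * N ^ 2 / L ^ A := by
          refine i₁ Q (le_trans ?_ hQB)
          gcongr
          · omega
      _ = _ := by rw [hX]; ring
  have k2 : |Q * S| ≤ C₂ * X := by
    have hS0 : 0 ≤ S := sum_nonneg fun _ _ => sq_nonneg _
    rw [abs_of_nonneg (by positivity), hX, mul_div_assoc', le_div_iff₀ hLA]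
    calc Q * S * L ^ A ≤ Q * (C₂ * N * L) * L ^ A := by gcongr
      _ = C₂ * N * (Q * L ^ (A + 1)) := by ring
      _ ≤ C₂ * N * N := by
          gcongr
          refine le_trans ?_ hQB
          gcongr
          · omega
      _ = _ := by ring
  have k3 : |2 * (U - N ^ 2 / 2 * Ψ)| ≤ 2 * C₃ * X := by
    rw [abs_mul, abs_two]
    calc 2 * |U - N ^ 2 / 2 * Ψ| ≤ 2 * (R * (C₃ * N ^ 2 / L ^ (B + 1 + A))) := by
          gcongr
          exact i₃ R (hRB3.trans (pow_le_pow_right₀ hL (by omega)))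
      _ ≤ 2 * (L ^ (B + 1) * (C₃ * N ^ 2 / L ^ (B + 1 + A))) := by gcongr
      _ = _ := by
          rw [hX, pow_add _ (B + 1) A]
          field_simp
  have k4 : |N ^ 2 * (Φ - a * Real.log Q - b)| ≤ D * X := by
    rw [abs_mul, abs_of_nonneg (by positivity)]
    calc _ ≤ (N : ℝ) ^ 2 * (D / L ^ A) := by
          gcongr
          exact (hΦ Q hQ1).1.trans (div_sqrt_le_div_pow hL hD.le hQ2)
      _ = _ := by rw [hX]; ring
  have k5 : |N ^ 2 * (Ψ - a * Real.log R - b')| ≤ D * X := by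
    rw [abs_mul, abs_of_nonneg (by positivity)]
    calc _ ≤ (N : ℝ) ^ 2 * (D / L ^ A) := by
          gcongr
          refine (hΦ R hR1).2.trans (div_sqrt_le_div_pow hL hD.le (le_trans ?_ hRB))
          exact pow_le_pow_right₀ hL (by omega)
      _ = _ := by rw [hX]; ring
  have k6 : |N ^ 2 * (a * (Real.log Q + Real.log R - Real.log N))| ≤ |a| * X := by
    rw [abs_mul, abs_mul, abs_of_nonneg (by positivity : (0 : ℝ) ≤ (N : ℝ) ^ 2)]
    calc _ ≤ (N : ℝ) ^ 2 * (|a| * (1 / L ^ A)) := by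
          gcongr
          refine (abs_log_floor_div_le hR1 hQ1).trans ?_
          gcongr
          exact (pow_le_pow_right₀ hL (by omega)).trans hQ2
      _ = _ := by rw [hX]; ring
  have key : ∑ q ∈ Icc 1 N, residueMoment N q -
        N ^ 2 * (Real.log N + (a * Real.log N - 1 + b + b')) =
      N * (S - (N * Real.log N - N)) + (∑ q ∈ Icc 1 Q, residueMoment N q - N ^ 2 * Φ) - Q * S +
        2 * (U - N ^ 2 / 2 * Ψ) + N ^ 2 * (Φ - a * Real.log Q - b) +
        N ^ 2 * (Ψ - a * Real.log R - b') +
        N ^ 2 * (a * (Real.log Q + Real.log R - Real.log N)) := by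
    rw [sum_residueMoment_eq hR1]
    ring
  rw [key]
  rw [abs_le] at k0 k1 k2 k3 k4 k5 k6 ⊢
  constructor <;> linarith [k0.1, k0.2, k1.1, k1.2, k2.1, k2.2, k3.1, k3.2, k4.1, k4.2, k5.1, k5.2,
    k6.1, k6.2]

end FullSecondMoment

section Assembly

open scoped ArithmeticFunction.vonMangoldt

lemma sum_ite_mod_eq {q : ℕ} (hq : 1 ≤ q) (n : ℕ) (c : ℝ) :
    ∑ a ∈ (Icc 1 q).filter (fun a => Nat.gcd a q = 1), (if n % q = a % q then c else 0) =
      if n.Coprime q then c else 0 := by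
  have hgcd : ∀ a, n % q = a % q → Nat.gcd n q = Nat.gcd a q := fun a h => Nat.ModEq.gcd_eq h
  split_ifs with hn
  · set r : ℕ := if n % q = 0 then q else n % q with hr
    have hrq : n % q = r % q := by
      rw [hr]
      split_ifs with h
      · rw [h, Nat.mod_self]
      · rw [Nat.mod_mod]
    have hlt := Nat.mod_lt n hq
    have hr1 : 1 ≤ r ∧ r ≤ q := by
      rw [hr]
      split_ifs <;> omega
    rw [sum_eq_single r]
    · rw [if_pos hrq]
    · intro a ha har
      rw [mem_filter, mem_Icc] at ha
      refine if_neg fun h => har ?_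
      rcases eq_or_lt_of_le ha.1.2 with h1 | h1
      · rw [h1, Nat.mod_self] at h
        rw [h1, hr, if_pos h]
      · rw [Nat.mod_eq_of_lt h1] at h
        rw [hr, if_neg (by omega), h]
    · intro h
      refine absurd ?_ h
      rw [mem_filter, mem_Icc]
      exact ⟨hr1, (hgcd r hrq).symm.trans hn⟩
  · refine sum_eq_zero fun a ha => if_neg fun h => hn ?_
    exact (hgcd a h).trans (mem_filter.mp ha).2

lemma sum_psiNat_mul_eq (N : ℕ) {q : ℕ} (hq : 1 ≤ q) (g : ℕ → ℝ)
    (hg : ∀ a n, n % q = a % q → g a = g n) :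
    ∑ a ∈ (Icc 1 q).filter (fun a => Nat.gcd a q = 1), psiNat N q a * g a =
      ∑ n ∈ (Icc 1 N).filter (fun n => n.Coprime q), Λ n * g n := by
  have h1 : ∀ a, psiNat N q a * g a =
      ∑ n ∈ Icc 1 N, if n % q = a % q then Λ n * g n else 0 := by
    intro a
    rw [psiNat, sum_mul, sum_filter]
    refine sum_congr rfl fun n _ => ?_
    split_ifs with h
    · rw [hg a n h]
    · rfl
  simp only [h1]
  rw [sum_comm, sum_filter]
  exact sum_congr rfl fun n _ => sum_ite_mod_eq hq n _

lemma card_filter_gcd_eq_one (q : ℕ) :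
    #((Icc 1 q).filter (fun a => Nat.gcd a q = 1)) = q.totient := by
  rw [← Nat.filter_coprime_Ico_eq_totient q 1]
  congr 1
  ext a
  simp only [mem_filter, mem_Icc, mem_Ico, Nat.coprime_iff_gcd_eq_one, Nat.gcd_comm q a]
  omega

lemma sum_psiNat_sub_sq_eq (N : ℕ) {q : ℕ} (hq : 1 ≤ q) (x : ℝ) :
    ∑ a ∈ (Icc 1 q).filter (fun a => Nat.gcd a q = 1), (psiNat N q a - x / q.totient) ^ 2 =
      ∑ n ∈ (Icc 1 N).filter (fun n => n.Coprime q), Λ n * psiNat N q n -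
        2 * x * (1 / q.totient) * ∑ n ∈ (Icc 1 N).filter (fun n => n.Coprime q), Λ n +
        x ^ 2 * (1 / q.totient) := by
  have h1 := sum_psiNat_mul_eq N hq (psiNat N q) (fun a n h => by simp only [psiNat, h])
  have h2 := sum_psiNat_mul_eq N hq (fun _ => 1) (fun _ _ _ => rfl)
  simp only [mul_one] at h2
  have h3 : (q.totient : ℝ) ≠ 0 := by exact_mod_cast (Nat.totient_pos.mpr hq).ne'
  rw [← h1, ← h2, mul_sum, ← sum_sub_distrib]
  calc _ = ∑ a ∈ (Icc 1 q).filter (fun a => Nat.gcd a q = 1),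
        ((psiNat N q a * psiNat N q a - 2 * x * (1 / q.totient) * psiNat N q a) +
          (x / q.totient) ^ 2) := sum_congr rfl fun a _ => by ring
    _ = _ := by
        rw [sum_add_distrib, sum_const, card_filter_gcd_eq_one, nsmul_eq_mul]
        congr 1
        field_simp

lemma residueMoment_sub_coprime_mem {N q : ℕ} (hN : 1 ≤ N) (hq : 1 ≤ q) (hqN : q ≤ N) :
    |residueMoment N q - ∑ n ∈ (Icc 1 N).filter (fun n => n.Coprime q), Λ n * psiNat N q n| ≤
      36 * Real.log (N + 2) ^ 6 := by
  have hL := one_le_log_add_two hN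
  set L : ℝ := Real.log (N + 2)
  set T : ℝ := ∑ n ∈ (Icc 1 N).filter (fun n => ¬ n.Coprime q), Λ n with hT
  have hT0 : 0 ≤ T := sum_nonneg fun _ _ => ArithmeticFunction.vonMangoldt_nonneg
  have hTL : T ≤ 6 * L ^ 3 := by
    refine (sum_vonMangoldt_not_coprime_le_log hN hq).trans ?_
    have := log_le_log_add_two hqN
    calc 6 * Real.log q * L ^ 2 ≤ 6 * L * L ^ 2 := by gcongr
      _ = _ := by ring
  have h1 : residueMoment N q - ∑ n ∈ (Icc 1 N).filter (fun n => n.Coprime q),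
      Λ n * psiNat N q n =
      ∑ n ∈ (Icc 1 N).filter (fun n => ¬ n.Coprime q), Λ n * psiNat N q n := by
    rw [residueMoment, ← sum_filter_add_sum_filter_not (Icc 1 N) (fun n => n.Coprime q)]
    ring
  have h2 : ∀ n ∈ (Icc 1 N).filter (fun n => ¬ n.Coprime q), psiNat N q n ≤ T := by
    intro n hn
    refine sum_le_sum_of_subset_of_nonneg ?_ fun _ _ _ => ArithmeticFunction.vonMangoldt_nonneg
    intro m hm
    rw [mem_filter] at hm hn ⊢
    refine ⟨hm.1, fun h => hn.2 ?_⟩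
    exact (Nat.ModEq.gcd_eq hm.2).symm.trans h
  rw [h1, abs_of_nonneg (sum_nonneg fun _ _ =>
    mul_nonneg ArithmeticFunction.vonMangoldt_nonneg (psiNat_nonneg _ _ _))]
  calc _ ≤ ∑ n ∈ (Icc 1 N).filter (fun n => ¬ n.Coprime q), Λ n * T :=
        sum_le_sum fun n hn =>
          mul_le_mul_of_nonneg_left (h2 n hn) ArithmeticFunction.vonMangoldt_nonneg
    _ = T ^ 2 := by rw [← sum_mul, ← hT, sq]
    _ ≤ (6 * L ^ 3) ^ 2 := by gcongr
    _ = _ := by ring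

lemma exists_abs_sum_coprime_sub_le (A : ℕ) : ∃ C : ℝ, 0 < C ∧ ∀ N q : ℕ, 1 ≤ N → 1 ≤ q → q ≤ N →
    |∑ n ∈ (Icc 1 N).filter (fun n => n.Coprime q), Λ n - N| ≤ C * N / Real.log (N + 2) ^ A := by
  obtain ⟨C₁, hC₁, h₁⟩ := abs_sum_vonMangoldt_sub_le_uniform A
  obtain ⟨C₂, hC₂, h₂⟩ := exists_log_pow_le_div 3 A
  refine ⟨C₁ + 6 * C₂, by positivity, fun N q hN hq hqN => ?_⟩
  have hL := one_le_log_add_two hN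
  have e1 := h₁ N hN N le_rfl
  have e2 := h₂ N hN
  have e3 := log_le_log_add_two hqN
  have e4 := sum_vonMangoldt_not_coprime_le_log hN hq
  rw [sum_vonMangoldt_coprime_eq]
  set L : ℝ := Real.log (N + 2)
  set T : ℝ := ∑ n ∈ (Icc 1 N).filter (fun n => ¬ n.Coprime q), Λ n with hT
  have hT0 : 0 ≤ T := sum_nonneg fun _ _ => ArithmeticFunction.vonMangoldt_nonneg
  have hTL : T ≤ 6 * L ^ 3 := by
    refine e4.trans ?_
    calc 6 * Real.log q * L ^ 2 ≤ 6 * L * L ^ 2 := by gcongr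
      _ = _ := by ring
  have e5 : (C₁ + 6 * C₂) * N / L ^ A = C₁ * N / L ^ A + 6 * (C₂ * N / L ^ A) := by ring
  rw [e5]
  rw [abs_le] at e1 ⊢
  constructor <;> linarith

lemma exists_abs_V_sub_le (A : ℕ) : ∃ C : ℝ, 0 < C ∧ ∀ x : ℝ, 1 ≤ x → ∀ N : ℕ, N = ⌊x⌋₊ →
    |V x x - (∑ q ∈ Icc 1 N, residueMoment N q - N ^ 2 * ∑ q ∈ Icc 1 N, 1 / (q.totient : ℝ))| ≤
      C * (N ^ 2 / Real.log (N + 2) ^ A) := by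
  obtain ⟨C₁, hC₁, h₁⟩ := exists_abs_sum_coprime_sub_le (A + 2)
  obtain ⟨C₂, hC₂, h₂⟩ := exists_log_pow_le_div 6 A
  refine ⟨6 * C₂ + 36 * C₂ + 24 * C₁, by positivity, fun x hx N hNx => ?_⟩
  have hN : 1 ≤ N := by
    rw [hNx, Nat.one_le_floor_iff]
    exact hx
  have hN1 : (1 : ℝ) ≤ N := by exact_mod_cast hN
  have hx1 : (N : ℝ) ≤ x := by
    rw [hNx]
    exact Nat.floor_le (by linarith)
  have hx2 : x < N + 1 := by
    rw [hNx]
    exact Nat.lt_floor_add_one x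
  have hL := one_le_log_add_two hN
  have hΦ := sum_inv_totient_le hN (le_refl N)
  have hlog := h₂ N hN
  have hcop := fun q => h₁ N q hN
  set L : ℝ := Real.log (N + 2)
  set Φ : ℝ := ∑ q ∈ Icc 1 N, 1 / (q.totient : ℝ) with hΦdef
  set δ : ℕ → ℝ := fun q => ∑ n ∈ (Icc 1 N).filter (fun n => n.Coprime q), Λ n - N with hδ
  set ε : ℕ → ℝ := fun q => residueMoment N q -
    ∑ n ∈ (Icc 1 N).filter (fun n => n.Coprime q), Λ n * psiNat N q n with hε
  have hΦ0 : 0 ≤ Φ := sum_nonneg fun _ _ => by positivity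
  have hV : V x x - (∑ q ∈ Icc 1 N, residueMoment N q - N ^ 2 * Φ) =
      (x - N) ^ 2 * Φ - ∑ q ∈ Icc 1 N, ε q - ∑ q ∈ Icc 1 N, 2 * x * (1 / q.totient) * δ q := by
    have e1 : V x x = ∑ q ∈ Icc 1 N, (residueMoment N q - N ^ 2 * (1 / q.totient) +
        (x - N) ^ 2 * (1 / q.totient) - ε q - 2 * x * (1 / q.totient) * δ q) := by
      rw [V, ← hNx]
      refine sum_congr rfl fun q hq => ?_
      have e2 := sum_psiNat_sub_sq_eq N (mem_Icc.mp hq).1 x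
      have e3 : ∀ a, psi x q a = psiNat N q a := fun a => by rw [psi, psiNat, ← hNx]
      simp only [e3]
      rw [e2, hε, hδ]
      ring
    rw [e1, sum_sub_distrib, sum_sub_distrib, sum_add_distrib, sum_sub_distrib, ← mul_sum,
      ← mul_sum]
    ring
  have hA : 0 < L ^ A := by positivity
  have k1 : |(x - N) ^ 2 * Φ| ≤ 6 * C₂ * (N ^ 2 / L ^ A) := by
    rw [abs_of_nonneg (by positivity)]
    calc (x - N) ^ 2 * Φ ≤ 1 * (6 * L ^ 2) := by
          gcongr
          exact pow_le_one₀ (by linarith) (by linarith)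
      _ ≤ 1 * (6 * L ^ 6) := by
          gcongr
          · norm_num
      _ ≤ N * (6 * (C₂ * N / L ^ A)) := by gcongr
      _ = _ := by ring
  have k2 : |∑ q ∈ Icc 1 N, ε q| ≤ 36 * C₂ * (N ^ 2 / L ^ A) := by
    calc |∑ q ∈ Icc 1 N, ε q| ≤ ∑ q ∈ Icc 1 N, |ε q| := abs_sum_le_sum_abs _ _
      _ ≤ ∑ q ∈ Icc 1 N, 36 * L ^ 6 := sum_le_sum fun q hq =>
          residueMoment_sub_coprime_mem hN (mem_Icc.mp hq).1 (mem_Icc.mp hq).2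
      _ = N * (36 * L ^ 6) := by simp
      _ ≤ N * (36 * (C₂ * N / L ^ A)) := by gcongr
      _ = _ := by ring
  have k3 : |∑ q ∈ Icc 1 N, 2 * x * (1 / q.totient) * δ q| ≤ 24 * C₁ * (N ^ 2 / L ^ A) := by
    calc |∑ q ∈ Icc 1 N, 2 * x * (1 / q.totient) * δ q|
        ≤ ∑ q ∈ Icc 1 N, |2 * x * (1 / q.totient) * δ q| := abs_sum_le_sum_abs _ _
      _ ≤ ∑ q ∈ Icc 1 N, 2 * (2 * N) * (1 / q.totient) * (C₁ * N / L ^ (A + 2)) := by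
          refine sum_le_sum fun q hq => ?_
          rw [abs_mul, abs_of_nonneg (by positivity : 0 ≤ 2 * x * (1 / (q.totient : ℝ)))]
          have e1 := hcop q (mem_Icc.mp hq).1 (mem_Icc.mp hq).2
          have e2 : x ≤ 2 * N := by linarith
          gcongr
      _ = 4 * N * (C₁ * N / L ^ (A + 2)) * Φ := by
          rw [hΦdef, mul_sum]
          exact sum_congr rfl fun q _ => by ring
      _ ≤ 4 * N * (C₁ * N / L ^ (A + 2)) * (6 * L ^ 2) := by gcongr
      _ = _ := by
          rw [pow_add]
          field_simp
          ring
  rw [hV]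
  have e6 : (6 * C₂ + 36 * C₂ + 24 * C₁) * (N ^ 2 / L ^ A) = 6 * C₂ * (N ^ 2 / L ^ A) +
      36 * C₂ * (N ^ 2 / L ^ A) + 24 * C₁ * (N ^ 2 / L ^ A) := by ring
  rw [e6]
  rw [abs_le] at k1 k2 k3 ⊢
  constructor <;> linarith

lemma exists_forall_abs_le_of_eventually {F g : ℕ → ℝ} (hg : ∀ N, 1 ≤ N → 0 < g N) {C : ℝ}
    (hC : 0 < C) {N₀ : ℕ} (h : ∀ N ≥ N₀, 1 ≤ N → |F N| ≤ C * g N) :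
    ∃ C' : ℝ, 0 < C' ∧ ∀ N, 1 ≤ N → |F N| ≤ C' * g N := by
  have h0 : ∀ N ∈ Icc 1 N₀, 0 ≤ |F N| / g N := fun N hN =>
    div_nonneg (abs_nonneg _) (hg N (mem_Icc.mp hN).1).le
  have h1 : 0 ≤ ∑ N ∈ Icc 1 N₀, |F N| / g N := sum_nonneg h0
  refine ⟨C + ∑ N ∈ Icc 1 N₀, |F N| / g N, by positivity, fun N hN => ?_⟩
  have hgN := hg N hN
  rcases le_total N₀ N with hN0 | hN0
  · refine (h N hN0 hN).trans ?_
    gcongr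
    linarith
  · have h2 := single_le_sum h0 (mem_Icc.mpr ⟨hN, hN0⟩)
    rw [div_le_iff₀ hgN] at h2
    refine h2.trans ?_
    gcongr
    linarith

lemma exists_abs_V_sub_main_le {a b b' D : ℝ} (hD : 0 < D)
    (hΦ : ∀ R : ℕ, 1 ≤ R →
      |∑ q ∈ Icc 1 R, 1 / (q.totient : ℝ) - a * Real.log R - b| ≤ D / √R ∧
      |∑ q ∈ Icc 1 R, (1 - (q : ℝ) / R) ^ 2 / q.totient - a * Real.log R - b'| ≤ D / √R)
    (A : ℕ) : ∃ C : ℝ, 0 < C ∧ ∀ x : ℝ, 1 ≤ x → ∀ N : ℕ, N = ⌊x⌋₊ →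
      |V x x - N ^ 2 * (Real.log N - 1 + b')| ≤ C * (N ^ 2 / Real.log (N + 2) ^ A) := by
  obtain ⟨C₁, hC₁, N₁, h₁⟩ := abs_sum_residueMoment_sub_le hD hΦ A
  obtain ⟨C₂, hC₂, h₂⟩ := exists_forall_abs_le_of_eventually
    (g := fun N => (N : ℝ) ^ 2 / Real.log (N + 2) ^ A) (fun N hN => by
      have := one_le_log_add_two hN
      have : (0 : ℝ) < N := by exact_mod_cast hN
      positivity) hC₁ h₁
  obtain ⟨C₃, hC₃, h₃⟩ := exists_abs_V_sub_le A
  obtain ⟨C₄, hC₄, h₄⟩ := exists_log_pow_le_mul (2 * A)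
  refine ⟨C₂ + C₃ + D * √C₄, by positivity, fun x hx N hNx => ?_⟩
  have hN : 1 ≤ N := by
    rw [hNx, Nat.one_le_floor_iff]
    exact hx
  have e1 := h₂ N hN
  have e2 := h₃ x hx N hNx
  have e3 := h₄ N hN
  have e4 := (hΦ N hN).1
  have hL := one_le_log_add_two hN
  have hN0 : (0 : ℝ) < N := by exact_mod_cast hN
  beta_reduce at e1
  set L : ℝ := Real.log (N + 2)
  set Φ : ℝ := ∑ q ∈ Icc 1 N, 1 / (q.totient : ℝ)
  have e5 : D / √N ≤ D * √C₄ / L ^ A := by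
    have h5 : L ^ A ≤ √C₄ * √N := by
      rw [← Real.sqrt_mul hC₄.le]
      refine Real.le_sqrt_of_sq_le ?_
      rwa [← pow_mul, mul_comm A 2]
    rw [div_le_div_iff₀ (by positivity) (by positivity), mul_assoc]
    gcongr
  have e6 : |(N : ℝ) ^ 2 * (Φ - a * Real.log N - b)| ≤ D * √C₄ * (N ^ 2 / L ^ A) := by
    rw [abs_mul, abs_of_nonneg (by positivity)]
    calc (N : ℝ) ^ 2 * |Φ - a * Real.log N - b| ≤ N ^ 2 * (D * √C₄ / L ^ A) := by
          gcongr
          exact e4.trans e5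
      _ = _ := by ring
  have e7 : (C₂ + C₃ + D * √C₄) * (N ^ 2 / L ^ A) = C₂ * (N ^ 2 / L ^ A) +
      C₃ * (N ^ 2 / L ^ A) + D * √C₄ * (N ^ 2 / L ^ A) := by ring
  rw [e7]
  rw [abs_le] at e1 e2 e6 ⊢
  constructor <;> linarith

lemma abs_sq_mul_log_sub_le {x N : ℝ} (hN : 1 ≤ N) (hNx : N ≤ x) (hxN : x ≤ N + 1) (c : ℝ) :
    |x ^ 2 * Real.log x - c * x ^ 2 - N ^ 2 * (Real.log N - c)| ≤
      (4 + 3 * |c|) * (N * Real.log (N + 2)) := by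
  have hL : 1 ≤ Real.log (N + 2) := by
    rw [Real.le_log_iff_exp_le (by linarith)]
    linarith [Real.exp_one_lt_d9]
  have h1 : x ^ 2 - N ^ 2 ≤ 3 * N := by nlinarith
  have h1' : 0 ≤ x ^ 2 - N ^ 2 := by nlinarith
  have h2 : Real.log x ≤ Real.log (N + 2) := Real.log_le_log (by linarith) (by linarith)
  have h2' : 0 ≤ Real.log x := Real.log_nonneg (by linarith)
  have h3 : 0 ≤ Real.log x - Real.log N :=
    sub_nonneg.mpr (Real.log_le_log (by linarith) hNx)
  have h3' : Real.log x - Real.log N ≤ 1 / N := by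
    rw [← Real.log_div (by linarith) (by linarith)]
    refine (Real.log_le_sub_one_of_pos (div_pos (by linarith) (by linarith))).trans ?_
    rw [div_sub_one (by linarith)]
    gcongr
    linarith
  have h4 : N ^ 2 * (Real.log x - Real.log N) ≤ N * Real.log (N + 2) := by
    calc N ^ 2 * (Real.log x - Real.log N) ≤ N ^ 2 * (1 / N) := by gcongr
      _ = N * 1 := by field_simp
      _ ≤ _ := by gcongr
  have h5 : |(x ^ 2 - N ^ 2) * Real.log x| ≤ 3 * (N * Real.log (N + 2)) := by
    rw [abs_of_nonneg (by positivity)]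
    calc (x ^ 2 - N ^ 2) * Real.log x ≤ 3 * N * Real.log (N + 2) := by gcongr
      _ = _ := by ring
  have h6 : |N ^ 2 * (Real.log x - Real.log N)| ≤ N * Real.log (N + 2) := by
    rwa [abs_of_nonneg (by positivity)]
  have h7 : |c * (x ^ 2 - N ^ 2)| ≤ 3 * |c| * (N * Real.log (N + 2)) := by
    rw [abs_mul, abs_of_nonneg h1']
    calc |c| * (x ^ 2 - N ^ 2) ≤ |c| * (3 * N * 1) := by
          gcongr
          linarith
      _ ≤ |c| * (3 * N * Real.log (N + 2)) := by gcongr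
      _ = _ := by ring
  have h8 : (4 + 3 * |c|) * (N * Real.log (N + 2)) = 3 * (N * Real.log (N + 2)) +
      N * Real.log (N + 2) + 3 * |c| * (N * Real.log (N + 2)) := by ring
  rw [h8]
  rw [abs_le] at h5 h6 h7 ⊢
  constructor <;> linarith

end Assembly

/-- Barban's asymptotic at Q = x: there is a constant c such that for every
A > 0 there is C with |V(x,x) − x² log x + c x²| ≤ C x² (log x)^{-A} for x ≥ 2. -/
theorem barban_asymptotic :
    ∃ c : ℝ, ∀ A : ℝ, 0 < A → ∃ C : ℝ, 0 < C ∧ ∀ x : ℝ, 2 ≤ x →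
      |V x x - x ^ 2 * Real.log x + c * x ^ 2| ≤ C * x ^ 2 * Real.log x ^ (-A) := by
  obtain ⟨a, b, b', D, hD, hΦ⟩ := exists_totient_sums
  refine ⟨1 - b', fun A hA => ?_⟩
  obtain ⟨C₁, hC₁, h₁⟩ := exists_abs_V_sub_main_le hD hΦ ⌈A⌉₊
  obtain ⟨C₂, hC₂, h₂⟩ := exists_log_pow_le_div 1 ⌈A⌉₊
  refine ⟨C₁ + (4 + 3 * |1 - b'|) * C₂, by positivity, fun x hx => ?_⟩
  obtain ⟨N, hNx⟩ : ∃ N, N = ⌊x⌋₊ := ⟨_, rfl⟩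
  have hN : 1 ≤ N := by
    rw [hNx, Nat.one_le_floor_iff]
    linarith
  have hN1 : (1 : ℝ) ≤ N := by exact_mod_cast hN
  have hx1 : (N : ℝ) ≤ x := by
    rw [hNx]
    exact Nat.floor_le (by linarith)
  have hx2 : x ≤ N + 1 := by
    rw [hNx]
    exact (Nat.lt_floor_add_one x).le
  have e1 := h₁ x (by linarith) N hNx
  have e2 := h₂ N hN
  have e3 := abs_sq_mul_log_sub_le hN1 hx1 hx2 (1 - b')
  have hL := one_le_log_add_two hN
  have hx0 : 0 < Real.log x := Real.log_pos (by linarith)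
  have hxL : Real.log x ≤ Real.log (N + 2) := Real.log_le_log (by linarith) (by linarith)
  set L : ℝ := Real.log (N + 2)
  have e4 : |V x x - x ^ 2 * Real.log x + (1 - b') * x ^ 2| ≤
      (C₁ + (4 + 3 * |1 - b'|) * C₂) * (N ^ 2 / L ^ ⌈A⌉₊) := by
    have e5 : (4 + 3 * |1 - b'|) * (N * L) ≤
        (4 + 3 * |1 - b'|) * C₂ * (N ^ 2 / L ^ ⌈A⌉₊) := by
      calc (4 + 3 * |1 - b'|) * (N * L)
          ≤ (4 + 3 * |1 - b'|) * (N * (C₂ * N / L ^ ⌈A⌉₊)) := by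
            gcongr
            rwa [pow_one] at e2
        _ = _ := by ring
    rw [add_mul]
    rw [abs_le] at e1 e3 ⊢
    constructor <;> linarith
  have e6 : 1 / L ^ ⌈A⌉₊ ≤ Real.log x ^ (-A) := by
    rw [Real.rpow_neg hx0.le, one_div, ← Real.rpow_natCast]
    gcongr
    exact (Real.rpow_le_rpow hx0.le hxL hA.le).trans
      (Real.rpow_le_rpow_of_exponent_le hL (Nat.le_ceil A))
  refine e4.trans ?_
  rw [mul_assoc, div_eq_mul_one_div]
  gcongr
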